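/- Let K be a number field with [K : ℚ] = 2 and negative discriminant (i.e., K is an imaginary quadratic field). If the class number of K equals 1, then the discriminant of K belongs to the set {-3, -4, -7, -8, -11, -19, -43, -67, -163}. -/

import Mathlib

open Filter Topology

namespace PeriodPair
variable (L : PeriodPair)

theorem exists_eventuallyEq_const_of_order_nonneg {f : ℂ → ℂ} (hf : Meromorphic f)
    (hper : ∀ l ∈ L.lattice, ∀ z, f (z + l) = f z)
    (hord : ∀ z, 0 ≤ meromorphicOrderAt f z) : ∃ C : ℂ, ∀ z, f =ᶠ[𝓝[≠] z] fun _ ↦ C := by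
  have hfU : MeromorphicOn f Set.univ := hf.meromorphicOn
  set g := toMeromorphicNFOn f Set.univ with hg
  have hfg : ∀ z, f =ᶠ[𝓝[≠] z] g := fun z ↦
    (hfU.toMeromorphicNFOn_eq_self_on_nhdsNE (Set.mem_univ z)).symm
  have hga : ∀ z, AnalyticAt ℂ g z := by
    intro z
    have h1 : MeromorphicNFAt g z := meromorphicNFOn_toMeromorphicNFOn f Set.univ (Set.mem_univ z)
    rw [← h1.meromorphicOrderAt_nonneg_iff_analyticAt, meromorphicOrderAt_toMeromorphicNFOn hfU
      (Set.mem_univ z)]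
    exact hord z
  have hgd : Differentiable ℂ g := fun z ↦ (hga z).differentiableAt
  have hgper : ∀ z, ∀ l ∈ L.lattice, g (z + l) = g z := by
    intro z l hl
    have h2 : Tendsto (fun w ↦ w + l) (𝓝[≠] z) (𝓝[≠] (z + l)) := by
      refine tendsto_nhdsWithin_iff.2 ⟨?_, ?_⟩
      · exact ((continuous_add_const l).tendsto z).mono_left nhdsWithin_le_nhds
      · filter_upwards [self_mem_nhdsWithin] with w hw
        simpa using hw
    have h3 : (fun w ↦ g (w + l)) =ᶠ[𝓝[≠] z] g := by
      filter_upwards [h2.eventually (hfg (z + l)), hfg z] with w h4 h5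
      rw [← h4, ← h5, hper l hl]
    have c1 : Tendsto (fun w ↦ g (w + l)) (𝓝[≠] z) (𝓝 (g (z + l))) :=
      ((hgd.continuous.comp (continuous_add_const l)).tendsto z).mono_left nhdsWithin_le_nhds
    have c2 : Tendsto g (𝓝[≠] z) (𝓝 (g z)) :=
      (hgd.continuous.tendsto z).mono_left nhdsWithin_le_nhds
    exact tendsto_nhds_unique (c1.congr' h3) c2
  refine ⟨g 0, fun z ↦ ?_⟩
  filter_upwards [hfg z] with w hw
  rw [hw]
  exact hgd.apply_eq_apply_of_bounded (IsZLattice.isCompact_range_of_periodic L.lattice _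
    hgd.continuous hgper).isBounded w 0

theorem exists_eventuallyEq_const_mul {f g : ℂ → ℂ} (hf : Meromorphic f) (hg : Meromorphic g)
    (hfper : ∀ l ∈ L.lattice, ∀ z, f (z + l) = f z)
    (hgper : ∀ l ∈ L.lattice, ∀ z, g (z + l) = g z)
    (htop : ∀ z, meromorphicOrderAt g z ≠ ⊤)
    (hord : ∀ z, meromorphicOrderAt f z = meromorphicOrderAt g z) :
    ∃ C : ℂ, ∀ z, f =ᶠ[𝓝[≠] z] fun z ↦ C * g z := by
  have hm : Meromorphic fun z ↦ f z / g z := fun z ↦ (hf z).div (hg z)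
  obtain ⟨C, hC⟩ := L.exists_eventuallyEq_const_of_order_nonneg hm
    (fun l hl z ↦ by rw [hfper l hl, hgper l hl]) (fun z ↦ by
      rw [fun_meromorphicOrderAt_div (hf z) (hg z), hord]
      have := htop z
      lift meromorphicOrderAt g z to ℤ using this with n
      exact_mod_cast (sub_self n).ge)
  refine ⟨C, fun z ↦ ?_⟩
  filter_upwards [hC z, (meromorphicOrderAt_ne_top_iff_eventually_ne_zero (hg z)).1 (htop z)]
    with w h1 h2
  rw [← h1, div_mul_cancel₀ _ h2]

end PeriodPair

theorem eventuallyEq_zero_of_second_order {D k : ℂ → ℂ} {z₀ : ℂ} (hD : AnalyticAt ℂ D z₀)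
    (hk : AnalyticAt ℂ k z₀) (h0 : D z₀ = 0) (h1 : deriv D z₀ = 0)
    (h2 : deriv (deriv D) =ᶠ[𝓝 z₀] k * D) : ∀ᶠ z in 𝓝 z₀, D z = 0 := by
  rw [← analyticOrderAt_eq_top]
  have e1 := hD.analyticOrderAt_deriv_add_one
  have e2 := hD.deriv.analyticOrderAt_deriv_add_one
  simp only [h0, h1, sub_zero] at e1 e2
  rw [analyticOrderAt_congr h2, analyticOrderAt_mul hk hD] at e2
  by_contra hne
  obtain ⟨n, hn⟩ := ENat.ne_top_iff_exists.1 hne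
  change _ = analyticOrderAt D z₀ at e1
  change _ = analyticOrderAt (deriv D) z₀ at e2
  rw [← e2, ← hn] at e1
  cases h : analyticOrderAt k z₀ with
  | top => simp [h] at e1
  | coe m => rw [h] at e1; norm_cast at e1; omega

theorem eventuallyEq_of_ode {A : ℂ} {f g : ℂ → ℂ} {z₀ : ℂ} (hf : AnalyticAt ℂ f z₀)
    (hg : AnalyticAt ℂ g z₀) (hf2 : ∀ᶠ z in 𝓝 z₀, deriv (deriv f) z = 6 * f z ^ 2 - A / 2)
    (hg2 : ∀ᶠ z in 𝓝 z₀, deriv (deriv g) z = 6 * g z ^ 2 - A / 2)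
    (h0 : f z₀ = g z₀) (h1 : deriv f z₀ = deriv g z₀) : f =ᶠ[𝓝 z₀] g := by
  have hd : deriv (f - g) =ᶠ[𝓝 z₀] deriv f - deriv g := by
    filter_upwards [hf.eventually_analyticAt, hg.eventually_analyticAt] with z h3 h4
    exact deriv_sub h3.differentiableAt h4.differentiableAt
  have := eventuallyEq_zero_of_second_order (D := f - g) (k := fun z ↦ 6 * (f z + g z)) (z₀ := z₀)
    (hf.sub hg) (by fun_prop) (by simp [h0]) (by rw [hd.self_of_nhds]; simp [h1]) (by
      filter_upwards [hd.eventuallyEq_nhds, hf2, hg2, hf.deriv.eventually_analyticAt,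
        hg.deriv.eventually_analyticAt] with z h3 h4 h5 h6 h7
      rw [h3.deriv_eq, deriv_sub h6.differentiableAt h7.differentiableAt, h4, h5]
      simp only [Pi.mul_apply, Pi.sub_apply]
      ring)
  filter_upwards [this] with z hz
  exact sub_eq_zero.1 hz

theorem second_order_of_first_order {A B : ℂ} {f : ℂ → ℂ} {z₀ : ℂ} (hf : AnalyticAt ℂ f z₀)
    (h1 : ∀ᶠ z in 𝓝 z₀, deriv f z ^ 2 = 4 * f z ^ 3 - A * f z - B)
    (hne : ∃ᶠ z in 𝓝 z₀, deriv f z ≠ 0) :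
    ∀ᶠ z in 𝓝 z₀, deriv (deriv f) z = 6 * f z ^ 2 - A / 2 := by
  set F : ℂ → ℂ := fun z ↦ 2 * deriv (deriv f) z - 12 * f z ^ 2 + A with hF
  have hdd := hf.deriv.deriv
  have hd := hf.deriv
  have hFa : AnalyticAt ℂ F z₀ := by fun_prop
  have h2 : ∀ᶠ z in 𝓝 z₀, (deriv f * F) z = 0 := by
    filter_upwards [h1.eventually_nhds, hf.eventually_analyticAt, hd.eventually_analyticAt]
      with z h3 h4 h5
    have h6 : (fun z ↦ deriv f z ^ 2) =ᶠ[𝓝 z] fun z ↦ 4 * f z ^ 3 - A * f z - B := h3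
    have h7 := h6.deriv_eq
    have d1 : HasDerivAt (fun z ↦ deriv f z ^ 2) (2 * deriv f z * deriv (deriv f) z) z := by
      simpa using! h5.differentiableAt.hasDerivAt.fun_pow 2
    have d2 : HasDerivAt (fun z ↦ 4 * f z ^ 3 - A * f z - B)
        (4 * (3 * f z ^ 2 * deriv f z) - A * deriv f z) z := by
      have h8 := h4.differentiableAt.hasDerivAt
      simpa using (((h8.fun_pow 3).const_mul 4).sub (h8.const_mul A)).sub_const B
    rw [d1.deriv, d2.deriv] at h7
    simp only [Pi.mul_apply, hF]
    linear_combination h7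
  rw [← analyticOrderAt_eq_top, analyticOrderAt_mul hd hFa, ENat.add_eq_top] at h2
  rcases h2 with h2 | h2
  · rw [analyticOrderAt_eq_top] at h2
    exact absurd h2 (fun h3 ↦ hne (h3.mono fun _ h4 ↦ not_not.2 h4))
  · rw [analyticOrderAt_eq_top] at h2
    filter_upwards [h2] with z hz
    simp only [hF] at hz
    linear_combination hz / 2

theorem Meromorphic.eventuallyEq_of_eventuallyEq {f g : ℂ → ℂ} (hf : Meromorphic f)
    (hg : Meromorphic g) {z₀ : ℂ} (h : f =ᶠ[𝓝[≠] z₀] g) (z : ℂ) : f =ᶠ[𝓝[≠] z] g := by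
  have hm : Meromorphic (f - g) := fun z ↦ (hf z).sub (hg z)
  have h1 : meromorphicOrderAt (f - g) z = ⊤ := by
    by_contra hne
    apply MeromorphicOn.meromorphicOrderAt_ne_top_of_isPreconnected (U := Set.univ) (y := z₀)
      hm.meromorphicOn isPreconnected_univ (Set.mem_univ z) (Set.mem_univ _) hne
    rw [meromorphicOrderAt_eq_top_iff]
    filter_upwards [h] with w hw
    simp [hw]
  rw [meromorphicOrderAt_eq_top_iff] at h1
  filter_upwards [h1] with w hw
  exact sub_eq_zero.1 hw

theorem tendsto_add_const_nhdsNE (z a : ℂ) : Tendsto (fun w ↦ w + a) (𝓝[≠] z) (𝓝[≠] (z + a)) := by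
  refine tendsto_nhdsWithin_iff.2 ⟨?_, ?_⟩
  · exact ((continuous_add_const a).tendsto z).mono_left nhdsWithin_le_nhds
  · filter_upwards [self_mem_nhdsWithin] with w hw
    simpa using hw

theorem AnalyticAt.fun_comp_add {f : ℂ → ℂ} {z a : ℂ} (h : AnalyticAt ℂ f (z + a)) :
    AnalyticAt ℂ (fun w ↦ f (w + a)) z :=
  h.fun_comp (f := fun w ↦ w + a) (by fun_prop)

namespace PeriodPair
variable (L : PeriodPair)

theorem add_mem_iff {l : ℂ} (hl : l ∈ L.lattice) (z : ℂ) : z + l ∈ L.lattice ↔ z ∈ L.lattice :=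
  L.lattice.add_mem_iff_left hl

theorem P_add {l : ℂ} (hl : l ∈ L.lattice) (z : ℂ) : ℘[L] (z + l) = ℘[L] z :=
  L.weierstrassP_add_coe z ⟨l, hl⟩

theorem P'_add {l : ℂ} (hl : l ∈ L.lattice) (z : ℂ) : ℘'[L] (z + l) = ℘'[L] z :=
  L.derivWeierstrassP_add_coe z ⟨l, hl⟩

theorem compl_mem_nhds {z : ℂ} (hz : z ∉ L.lattice) : ∀ᶠ w in 𝓝 z, w ∉ L.lattice :=
  L.isClosed_lattice.isOpen_compl.mem_nhds hz

theorem compl_mem_nhdsNE (z : ℂ) : ∀ᶠ w in 𝓝[≠] z, w ∉ L.lattice := by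
  have := L.compl_lattice_sdiff_singleton_mem_nhds z
  filter_upwards [nhdsWithin_le_nhds this, self_mem_nhdsWithin] with w h1 h2 h3
  exact h1 ⟨h3, h2⟩

theorem order_sub_const (c : ℂ) {z : ℂ} (hz : z ∈ L.lattice) :
    meromorphicOrderAt (fun z ↦ ℘[L] z - c) z = (-2 : ℤ) := by
  have h1 : meromorphicOrderAt (fun _ : ℂ ↦ -c) z ≥ 0 := analyticAt_const.meromorphicOrderAt_nonneg
  have h2 := L.order_weierstrassP z hz
  have h3 := meromorphicOrderAt_add_eq_left_of_lt (f₁ := ℘[L]) (f₂ := fun _ ↦ -c) (x := z)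
    (by fun_prop)
    (by rw [h2]; exact lt_of_lt_of_le (by decide) h1)
  rw [h2] at h3
  exact h3

theorem order_sub_const_ne_top (c : ℂ) (z : ℂ) :
    meromorphicOrderAt (fun z ↦ ℘[L] z - c) z ≠ ⊤ := by
  apply MeromorphicOn.meromorphicOrderAt_ne_top_of_isPreconnected (U := Set.univ) (x := 0) (y := z)
      (f := fun z ↦ ℘[L] z - c) (fun z _ ↦ by fun_prop) isPreconnected_univ
      (Set.mem_univ _) (Set.mem_univ _)
  rw [L.order_sub_const c L.lattice.zero_mem]
  exact WithTop.coe_ne_top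

theorem frequently_P'_ne {z : ℂ} : ∃ᶠ w in 𝓝[≠] z, ℘'[L] w ≠ 0 := by
  apply Eventually.frequently
  refine (meromorphicOrderAt_ne_top_iff_eventually_ne_zero (by fun_prop)).1 ?_
  apply MeromorphicOn.meromorphicOrderAt_ne_top_of_isPreconnected (U := Set.univ) (x := 0) (y := z)
      (f := ℘'[L]) (fun z _ ↦ by fun_prop) isPreconnected_univ (Set.mem_univ _) (Set.mem_univ _)
  rw [← deriv_weierstrassP, meromorphicOrderAt_deriv_eq_sub_one (n := -2) (by norm_num)]
  · exact WithTop.coe_ne_top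
  · exact L.order_weierstrassP 0 L.lattice.zero_mem

theorem analyticAt_P {z : ℂ} (hz : z ∉ L.lattice) : AnalyticAt ℂ ℘[L] z :=
  L.analyticOnNhd_weierstrassP z hz
theorem analyticAt_P' {z : ℂ} (hz : z ∉ L.lattice) : AnalyticAt ℂ ℘'[L] z :=
  L.analyticOnNhd_derivWeierstrassP z hz

theorem deriv_P' {z : ℂ} (hz : z ∉ L.lattice) : deriv ℘'[L] z = 6 * ℘[L] z ^ 2 - L.g₂ / 2 := by
  have := second_order_of_first_order (A := L.g₂) (B := L.g₃) (L.analyticAt_P hz) (by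
    filter_upwards [L.compl_mem_nhds hz] with w hw
    rw [deriv_weierstrassP, L.derivWeierstrassP_sq w hw])
    (by rw [deriv_weierstrassP]; exact (L.frequently_P'_ne (z := z)).filter_mono nhdsWithin_le_nhds)
  rw [deriv_weierstrassP] at this
  exact this.self_of_nhds

theorem exists_P_eq (c : ℂ) : ∃ z, z ∉ L.lattice ∧ ℘[L] z = c := by
  by_contra! hne
  have hm : Meromorphic fun z ↦ ℘[L] z - c := by fun_prop
  obtain ⟨C, hC⟩ := L.exists_eventuallyEq_const_of_order_nonneg (f := fun z ↦ (℘[L] z - c)⁻¹)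
    (by fun_prop)
    (fun l hl z ↦ by rw [L.P_add hl]) (fun z ↦ by
      rw [fun_meromorphicOrderAt_inv]
      by_cases hz : z ∈ L.lattice
      · rw [L.order_sub_const c hz]
        decide
      · have ha : AnalyticAt ℂ (fun z ↦ ℘[L] z - c) z := by have := L.analyticAt_P hz; fun_prop
        rw [ha.meromorphicOrderAt_eq, ha.analyticOrderAt_eq_zero.2 (sub_ne_zero.2 (hne z hz))]
        simp)
  have h1 : meromorphicOrderAt (fun z ↦ (℘[L] z - c)⁻¹) 0 = (2 : ℤ) := by
    rw [fun_meromorphicOrderAt_inv, L.order_sub_const c L.lattice.zero_mem]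
    rfl
  have h2 := meromorphicOrderAt_congr (hC 0)
  classical
  rw [h1, meromorphicOrderAt_const] at h2
  split_ifs at h2 <;> revert h2 <;> decide

/-- A meromorphic solution of the Weierstrass equation is a translate of `℘`. -/
theorem exists_translate {f : ℂ → ℂ} (hf : Meromorphic f) {z₀ : ℂ}
    (hfa : AnalyticAt ℂ f z₀)
    (hode : ∀ᶠ z in 𝓝 z₀, deriv f z ^ 2 = 4 * f z ^ 3 - L.g₂ * f z - L.g₃)
    (hne : ∃ᶠ z in 𝓝 z₀, deriv f z ≠ 0) {w : ℂ} (hw : w ∉ L.lattice) (h0 : f z₀ = ℘[L] w)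
    (h1 : deriv f z₀ = ℘'[L] w) (z : ℂ) :
    f =ᶠ[𝓝[≠] z] fun z ↦ ℘[L] (z + (w - z₀)) := by
  have e : z₀ + (w - z₀) = w := by ring
  have han : AnalyticAt ℂ (fun z ↦ ℘[L] (z + (w - z₀))) z₀ := by
    have := L.analyticAt_P hw
    rw [← e] at this
    exact this.fun_comp_add
  have hd : deriv (fun z ↦ ℘[L] (z + (w - z₀))) = fun z ↦ ℘'[L] (z + (w - z₀)) := by
    ext z; rw [deriv_comp_add_const, deriv_weierstrassP]
  have := eventuallyEq_of_ode (A := L.g₂) hfa han (second_order_of_first_order hfa hode hne)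
    (by
      rw [hd]
      have h2 : Tendsto (fun z ↦ z + (w - z₀)) (𝓝 z₀) (𝓝 w) := by
        nth_rw 2 [← e]; exact (continuous_add_const _).tendsto _
      filter_upwards [h2.eventually (L.compl_mem_nhds hw)] with z hz
      rw [deriv_comp_add_const (f := ℘'[L]), L.deriv_P' hz])
    (by rw [h0, e]) (by simp only [h1, hd, e])
  refine hf.eventuallyEq_of_eventuallyEq ?_ (this.filter_mono nhdsWithin_le_nhds) z
  intro z
  exact (L.meromorphic_weierstrassP _).comp_analyticAt (by fun_prop)

theorem sub_mem_of_eq {a b : ℂ} (ha : a ∉ L.lattice) (hb : b ∉ L.lattice) (h : ℘[L] a = ℘[L] b)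
    (h' : ℘'[L] a = ℘'[L] b) : a - b ∈ L.lattice := by
  have h1 := L.exists_translate L.meromorphic_weierstrassP (L.analyticAt_P hb)
    (by
      filter_upwards [L.compl_mem_nhds hb] with w hw
      rw [deriv_weierstrassP, L.derivWeierstrassP_sq w hw])
    (by rw [deriv_weierstrassP]; exact (L.frequently_P'_ne (z := b)).filter_mono nhdsWithin_le_nhds)
    ha h.symm (by rw [deriv_weierstrassP, h']) 0
  by_contra hab
  have h2 := meromorphicOrderAt_congr h1
  rw [L.order_weierstrassP 0 L.lattice.zero_mem] at h2
  have : AnalyticAt ℂ (fun z ↦ ℘[L] (z + (a - b))) 0 := by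
    have := L.analyticAt_P hab
    rw [← zero_add (a - b)] at this
    exact this.fun_comp_add
  have := this.meromorphicOrderAt_nonneg
  rw [← h2] at this
  revert this; decide

theorem P_eq_iff {a b : ℂ} (ha : a ∉ L.lattice) (hb : b ∉ L.lattice) :
    ℘[L] a = ℘[L] b ↔ a - b ∈ L.lattice ∨ a + b ∈ L.lattice := by
  constructor
  · intro h
    have h1 := L.derivWeierstrassP_sq a ha
    rw [h, ← L.derivWeierstrassP_sq b hb, sq_eq_sq_iff_eq_or_eq_neg] at h1
    rcases h1 with h1 | h1
    · exact Or.inl (L.sub_mem_of_eq ha hb h h1)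
    · right
      have := L.sub_mem_of_eq ha (b := -b) (by simpa using hb) (by simpa using h)
        (by simpa using h1)
      simpa using this
  · rintro (h | h)
    · have := L.P_add h b
      rwa [add_sub_cancel] at this
    · have := L.P_add h (-b)
      simpa using this

theorem P'_eq_zero_iff {a : ℂ} (ha : a ∉ L.lattice) : ℘'[L] a = 0 ↔ 2 * a ∈ L.lattice := by
  constructor
  · intro h
    have := L.sub_mem_of_eq ha (b := -a) (by simpa using ha) (by simp) (by simp [h])
    rwa [sub_neg_eq_add, ← two_mul] at this
  · intro h
    have := L.P'_add h (-a)
    rw [show -a + 2 * a = a by ring, L.derivWeierstrassP_neg] at this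
    linear_combination this / 2

theorem deriv_P'_ne_zero {a : ℂ} (ha : a ∉ L.lattice) (h : ℘'[L] a = 0) : deriv ℘'[L] a ≠ 0 := by
  intro h2
  have := eventuallyEq_of_ode (A := L.g₂) (L.analyticAt_P ha) (g := fun _ ↦ ℘[L] a) analyticAt_const
    (by
      rw [deriv_weierstrassP]
      filter_upwards [L.compl_mem_nhds ha] with w hw using L.deriv_P' hw)
    (by rw [← L.deriv_P' ha, h2]; simp) rfl (by simp [h])
  have h3 := L.order_sub_const_ne_top (℘[L] a) a
  apply h3
  rw [meromorphicOrderAt_eq_top_iff]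
  filter_upwards [this.filter_mono nhdsWithin_le_nhds] with w hw
  rw [hw, sub_self]

open Classical in
theorem order_sub_P {w : ℂ} (hw : w ∉ L.lattice) (z : ℂ) :
    meromorphicOrderAt (fun z ↦ ℘[L] z - ℘[L] w) z =
      (((if z - w ∈ L.lattice then 1 else 0) + (if z + w ∈ L.lattice then 1 else 0)
        - (if z ∈ L.lattice then 2 else 0) : ℤ) : WithTop ℤ) := by
  by_cases hz : z ∈ L.lattice
  · have h1 : z - w ∉ L.lattice := fun h ↦ hw (by simpa using L.lattice.sub_mem hz h)
    have h2 : z + w ∉ L.lattice := fun h ↦ hw (by simpa using L.lattice.sub_mem h hz)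
    rw [L.order_sub_const _ hz]
    simp [hz, h1, h2]
  have ha := L.analyticAt_P hz
  have ha' : AnalyticAt ℂ (fun z ↦ ℘[L] z - ℘[L] w) z := by fun_prop
  rw [ha'.meromorphicOrderAt_eq]
  have hd : deriv (fun z ↦ ℘[L] z - ℘[L] w) = ℘'[L] := by
    ext; rw [deriv_sub_const, deriv_weierstrassP]
  have key : ∀ n : ℕ, analyticOrderAt (fun z ↦ ℘[L] z - ℘[L] w) z = n →
    (analyticOrderAt (fun z ↦ ℘[L] z - ℘[L] w) z).map ((↑) : ℕ → ℤ) = ((n : ℤ) : WithTop ℤ) := by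
    intro n hn; rw [hn]; rfl
  have two : z - w ∈ L.lattice → (z + w ∈ L.lattice ↔ 2 * z ∈ L.lattice) := fun h ↦ by
    rw [← L.add_mem_iff h (z + w)]; ring_nf
  have two' : z + w ∈ L.lattice → (z - w ∈ L.lattice ↔ 2 * z ∈ L.lattice) := fun h ↦ by
    rw [← L.add_mem_iff h (z - w)]; ring_nf
  by_cases h0 : ℘[L] z = ℘[L] w
  · have e1 := ha'.analyticOrderAt_deriv_add_one
    simp only [h0, sub_self, sub_zero, hd] at e1
    by_cases h2 : 2 * z ∈ L.lattice
    · have h3 := (L.P'_eq_zero_iff hz).2 h2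
      have e2 := (L.analyticAt_P' hz).analyticOrderAt_deriv_add_one
      rw [(L.analyticAt_P' hz).deriv.analyticOrderAt_eq_zero.2 (L.deriv_P'_ne_zero hz h3)] at e2
      simp only [h3, sub_zero] at e2
      rw [key 2 (by rw [← e1]; rw [← e2]; rfl)]
      rcases (L.P_eq_iff hz hw).1 h0 with h | h
      · have := (two h).2 h2; simp [*]
      · have := (two' h).2 h2; simp [*]
    · have h3 := (L.P'_eq_zero_iff hz).not.2 h2
      rw [key 1 (by rw [← e1, (L.analyticAt_P' hz).analyticOrderAt_eq_zero.2 h3]; rfl)]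
      rcases (L.P_eq_iff hz hw).1 h0 with h | h
      · have := (two h).not.2 h2; simp [*]
      · have := (two' h).not.2 h2; simp [*]
  · rw [key 0 (by simpa using ha'.analyticOrderAt_eq_zero.2 (sub_ne_zero.2 h0))]
    have := (L.P_eq_iff hz hw).not.1 h0
    push Not at this
    simp [hz, this.1, this.2]

theorem tendsto_sq_mul_P : Tendsto (fun z ↦ z ^ 2 * ℘[L] z) (𝓝[≠] 0) (𝓝 1) := by
  have h1 : Tendsto (fun z ↦ z ^ 2 * L.weierstrassPExcept 0 z + 1) (𝓝[≠] 0) (𝓝 1) := by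
    have h2 := (L.analyticAt_weierstrassPExcept 0).continuousAt
    have h3 : ContinuousAt (fun z ↦ z ^ 2 * L.weierstrassPExcept 0 z + 1) 0 := by fun_prop
    have h4 := h3.tendsto.mono_left (nhdsWithin_le_nhds (s := {0}ᶜ))
    simpa using h4
  refine h1.congr' ?_
  filter_upwards [self_mem_nhdsWithin] with z hz
  have := L.ite_eq_one_sub_sq_mul_weierstrassP 0 L.lattice.zero_mem z
  rw [if_neg (by simpa using hz)] at this
  simp at this
  exact this.symm

theorem exists_P_eq_P'_eq {x y : ℂ} (h : y ^ 2 = 4 * x ^ 3 - L.g₂ * x - L.g₃) :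
    ∃ w, w ∉ L.lattice ∧ ℘[L] w = x ∧ ℘'[L] w = y := by
  obtain ⟨w, hw, hx⟩ := L.exists_P_eq x
  have h1 := L.derivWeierstrassP_sq w hw
  rw [hx, ← h, sq_eq_sq_iff_eq_or_eq_neg] at h1
  rcases h1 with h1 | h1
  · exact ⟨w, hw, hx, h1⟩
  · exact ⟨-w, by simpa using hw, by simpa using hx, by simp [h1]⟩

theorem _root_.tendsto_mul_const_nhdsNE {α : ℂ} (hα : α ≠ 0) (z : ℂ) :
    Tendsto (fun w ↦ α * w) (𝓝[≠] z) (𝓝[≠] (α * z)) := by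
  refine tendsto_nhdsWithin_iff.2 ⟨?_, ?_⟩
  · exact ((continuous_const_mul α).tendsto z).mono_left nhdsWithin_le_nhds
  · filter_upwards [self_mem_nhdsWithin] with w hw
    simpa [hα] using hw

/-- A meromorphic solution of the Weierstrass equation rescaled by `α` with a pole at the origin
is `z ↦ ℘(α z)`. -/
theorem eventuallyEq_P_mul {f : ℂ → ℂ} (hf : Meromorphic f) {α : ℂ} (hα : α ≠ 0)
    (hpole : Tendsto f (𝓝[≠] 0) (Bornology.cobounded ℂ))
    (hode : ∀ᶠ z in 𝓝[≠] 0, deriv f z ^ 2 = α ^ 2 * (4 * f z ^ 3 - L.g₂ * f z - L.g₃)) (z : ℂ) :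
    f =ᶠ[𝓝[≠] z] fun z ↦ ℘[L] (α * z) := by
  set F : ℂ → ℂ := fun z ↦ f (α⁻¹ * z) with hF
  have hα' : α⁻¹ ≠ 0 := inv_ne_zero hα
  have hFm : Meromorphic F := fun z ↦ (hf _).comp_analyticAt (by fun_prop)
  have hdF : ∀ z, deriv F z = α⁻¹ * deriv f (α⁻¹ * z) := fun z ↦ by
    rw [hF, deriv_comp_mul_left α⁻¹ f, smul_eq_mul]
  have t0 : Tendsto (fun w ↦ α⁻¹ * w) (𝓝[≠] 0) (𝓝[≠] 0) := by
    simpa using tendsto_mul_const_nhdsNE hα' 0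
  have hFpole : Tendsto F (𝓝[≠] 0) (Bornology.cobounded ℂ) := hpole.comp t0
  have hFode : ∀ᶠ z in 𝓝[≠] 0, deriv F z ^ 2 = 4 * F z ^ 3 - L.g₂ * F z - L.g₃ := by
    filter_upwards [t0.eventually hode] with z hz
    rw [hdF, mul_pow, hz]
    simp only [hF]
    rw [← mul_assoc, inv_pow, inv_mul_cancel₀ (pow_ne_zero 2 hα), one_mul]
  have hord : meromorphicOrderAt F 0 < 0 :=
    (tendsto_cobounded_iff_meromorphicOrderAt_neg (hFm 0)).1 hFpole
  have hne : ∀ᶠ z in 𝓝[≠] 0, deriv F z ≠ 0 := by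
    refine (meromorphicOrderAt_ne_top_iff_eventually_ne_zero (hFm 0).deriv).1 ?_
    lift meromorphicOrderAt F 0 to ℤ using hord.ne_top with n hn
    rw [meromorphicOrderAt_deriv_eq_sub_one (n := n) ?_ hn.symm]
    · exact WithTop.coe_ne_top
    · have : n < 0 := by exact_mod_cast hord
      exact_mod_cast this.ne
  have hall := ((eventually_eventually_nhdsWithin.2 hFode).and hne).and
    ((hFm 0).eventually_analyticAt)
  obtain ⟨z₀, ⟨⟨h1, h2⟩, h3⟩, h4⟩ := (hall.and self_mem_nhdsWithin).exists
  have h4' : z₀ ≠ 0 := h4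
  have h1' : ∀ᶠ z in 𝓝 z₀, deriv F z ^ 2 = 4 * F z ^ 3 - L.g₂ * F z - L.g₃ := by
    rwa [isOpen_compl_singleton.nhdsWithin_eq h4] at h1
  obtain ⟨w, hw, e1, e2⟩ := L.exists_P_eq_P'_eq h1'.self_of_nhds
  have key := L.exists_translate hFm h3 h1'
    ((h3.deriv.continuousAt.eventually_ne h2).frequently) hw e1.symm e2.symm
  have hs : w - z₀ ∈ L.lattice := by
    by_contra hs
    have h5 : AnalyticAt ℂ (fun z ↦ ℘[L] (z + (w - z₀))) 0 := by
      apply AnalyticAt.fun_comp_add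
      rw [zero_add]
      exact L.analyticAt_P hs
    have := h5.meromorphicOrderAt_nonneg
    rw [← meromorphicOrderAt_congr (key 0)] at this
    exact absurd this (not_le.2 hord)
  have key2 : ∀ z, F =ᶠ[𝓝[≠] z] ℘[L] := fun z ↦ by
    filter_upwards [key z] with u hu
    rw [hu, L.P_add hs]
  filter_upwards [(tendsto_mul_const_nhdsNE hα z).eventually (key2 (α * z))] with u hu
  rw [← hu, hF]
  simp [hα]

theorem eq_of_eventuallyEq {f g : ℂ → ℂ} {z : ℂ} (h : f =ᶠ[𝓝[≠] z] g) (hf : ContinuousAt f z)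
    (hg : ContinuousAt g z) : f z = g z :=
  tendsto_nhds_unique ((hf.tendsto.mono_left nhdsWithin_le_nhds).congr' h)
    (hg.tendsto.mono_left nhdsWithin_le_nhds)

theorem tendsto_P_cobounded {l : ℂ} (hl : l ∈ L.lattice) :
    Tendsto ℘[L] (𝓝[≠] l) (Bornology.cobounded ℂ) :=
  tendsto_cobounded_of_meromorphicOrderAt_neg (by rw [L.order_weierstrassP l hl]; decide)

theorem hasDerivAt_P {z : ℂ} (hz : z ∉ L.lattice) : HasDerivAt ℘[L] (℘'[L] z) z := by
  have := (L.analyticAt_P hz).differentiableAt.hasDerivAt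
  rwa [deriv_weierstrassP] at this

theorem hasDerivAt_P' {z : ℂ} (hz : z ∉ L.lattice) :
    HasDerivAt ℘'[L] (6 * ℘[L] z ^ 2 - L.g₂ / 2) z := by
  have := (L.analyticAt_P' hz).differentiableAt.hasDerivAt
  rwa [L.deriv_P' hz] at this

theorem meromorphic_P_comp_add (a : ℂ) : Meromorphic fun z ↦ ℘[L] (z + a) :=
  fun z ↦ (L.meromorphic_weierstrassP (z + a)).comp_analyticAt (g := fun z ↦ z + a) (by fun_prop)

theorem meromorphic_P'_comp_add (a : ℂ) : Meromorphic fun z ↦ ℘'[L] (z + a) :=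
  fun z ↦ (L.meromorphic_derivWeierstrassP (z + a)).comp_analyticAt (g := fun z ↦ z + a)
    (by fun_prop)

/-- Three representatives of the nonzero classes of half periods. -/
structure HalfTriple (h₁ h₂ h₃ : ℂ) : Prop where
  notMem₁ : h₁ ∉ L.lattice
  notMem₂ : h₂ ∉ L.lattice
  notMem₃ : h₃ ∉ L.lattice
  two₁ : 2 * h₁ ∈ L.lattice
  two₂ : 2 * h₂ ∈ L.lattice
  two₃ : 2 * h₃ ∈ L.lattice
  sum : h₁ + h₂ + h₃ ∈ L.lattice

namespace HalfTriple
variable {L} {h₁ h₂ h₃ : ℂ} (H : L.HalfTriple h₁ h₂ h₃)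
include H

theorem rot : L.HalfTriple h₂ h₃ h₁ where
  notMem₁ := H.notMem₂
  notMem₂ := H.notMem₃
  notMem₃ := H.notMem₁
  two₁ := H.two₂
  two₂ := H.two₃
  two₃ := H.two₁
  sum := by have := H.sum; rwa [add_assoc, add_comm] at this

theorem swap : L.HalfTriple h₂ h₁ h₃ where
  notMem₁ := H.notMem₂
  notMem₂ := H.notMem₁
  notMem₃ := H.notMem₃
  two₁ := H.two₂
  two₂ := H.two₁
  two₃ := H.two₃
  sum := by have := H.sum; rwa [add_comm h₁] at this

theorem sub_notMem : h₁ - h₂ ∉ L.lattice := by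
  intro h
  apply H.notMem₃
  have := L.lattice.sub_mem (L.lattice.sub_mem H.sum H.two₂) h
  convert! this using 1; ring

theorem P_ne : ℘[L] h₁ ≠ ℘[L] h₂ := by
  rw [Ne, L.P_eq_iff H.notMem₁ H.notMem₂]
  rintro (h | h)
  · exact H.sub_notMem h
  · exact H.notMem₃ (by simpa using L.lattice.sub_mem H.sum h)

theorem P'_eq_zero : ℘'[L] h₁ = 0 := (L.P'_eq_zero_iff H.notMem₁).2 H.two₁

theorem g_eq : ℘[L] h₁ + ℘[L] h₂ + ℘[L] h₃ = 0 ∧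
    L.g₂ = -4 * (℘[L] h₁ * ℘[L] h₂ + ℘[L] h₁ * ℘[L] h₃ + ℘[L] h₂ * ℘[L] h₃) ∧
    L.g₃ = 4 * ℘[L] h₁ * ℘[L] h₂ * ℘[L] h₃ := by
  have r1 := L.derivWeierstrassP_sq h₁ H.notMem₁
  have r2 := L.derivWeierstrassP_sq h₂ H.notMem₂
  have r3 := L.derivWeierstrassP_sq h₃ H.notMem₃
  rw [H.P'_eq_zero] at r1
  rw [H.rot.P'_eq_zero] at r2
  rw [H.rot.rot.P'_eq_zero] at r3
  have n12 := sub_ne_zero.2 H.P_ne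
  have n23 := sub_ne_zero.2 H.rot.P_ne
  have n13 := sub_ne_zero.2 H.rot.rot.P_ne
  set e₁ := ℘[L] h₁
  set e₂ := ℘[L] h₂
  set e₃ := ℘[L] h₃
  have a1 : L.g₂ = 4 * (e₁ ^ 2 + e₁ * e₂ + e₂ ^ 2) := by
    apply mul_left_cancel₀ n12; linear_combination r1 - r2
  have a2 : L.g₂ = 4 * (e₂ ^ 2 + e₂ * e₃ + e₃ ^ 2) := by
    apply mul_left_cancel₀ n23; linear_combination r2 - r3
  have a3 : e₁ + e₂ + e₃ = 0 := by
    apply mul_left_cancel₀ n13; linear_combination (a1 - a2) / 4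
  refine ⟨a3, ?_, ?_⟩
  · linear_combination a1 + 4 * (e₁ + e₂) * a3
  · linear_combination r1 - e₁ * a1 - 4 * e₁ ^ 2 * a3 + 4 * e₁ ^ 2 * a3 - 4 * e₁ * e₂ * a3

theorem P'_sq {z : ℂ} (hz : z ∉ L.lattice) :
    ℘'[L] z ^ 2 = 4 * (℘[L] z - ℘[L] h₁) * (℘[L] z - ℘[L] h₂) * (℘[L] z - ℘[L] h₃) := by
  obtain ⟨a, b, c⟩ := H.g_eq
  rw [L.derivWeierstrassP_sq z hz, b, c]
  linear_combination 4 * ℘[L] z ^ 2 * a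

theorem P_eq_iff_sub_mem {z : ℂ} (hz : z ∉ L.lattice) : ℘[L] z = ℘[L] h₁ ↔ z + h₁ ∈ L.lattice := by
  rw [L.P_eq_iff hz H.notMem₁]
  refine ⟨?_, Or.inr⟩
  rintro (h | h)
  · have := L.lattice.add_mem h H.two₁
    convert! this using 1; ring
  · exact h

theorem P_add_mul {z : ℂ} (hz : z ∉ L.lattice) (hz' : z + h₁ ∉ L.lattice) :
    (℘[L] (z + h₁) - ℘[L] h₁) * (℘[L] z - ℘[L] h₁) =
      (℘[L] h₁ - ℘[L] h₂) * (℘[L] h₁ - ℘[L] h₃) := by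
  obtain ⟨a, b, c⟩ := H.g_eq
  have n12 := sub_ne_zero.2 H.P_ne
  have n13 := sub_ne_zero.2 H.rot.rot.P_ne.symm
  set e₁ := ℘[L] h₁ with he₁
  set e₂ := ℘[L] h₂
  set e₃ := ℘[L] h₃
  set B := (e₁ - e₂) * (e₁ - e₃) with hB
  have hBne : B ≠ 0 := mul_ne_zero n12 n13
  have hne : ∀ᶠ w in 𝓝[≠] (0 : ℂ), w + h₁ ∉ L.lattice ∧ ℘[L] (w + h₁) - e₁ ≠ 0 := by
    filter_upwards [(tendsto_add_const_nhdsNE 0 h₁).eventually (L.compl_mem_nhdsNE (0 + h₁)),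
      L.compl_mem_nhdsNE 0] with w h1 h2
    refine ⟨h1, fun h3 ↦ h2 ?_⟩
    have h4 := (H.P_eq_iff_sub_mem h1).1 (sub_eq_zero.1 h3)
    have := L.lattice.sub_mem h4 H.two₁
    convert! this using 1; ring
  have key := L.eventuallyEq_P_mul (f := fun z ↦ e₁ + B / (℘[L] (z + h₁) - e₁)) (α := 1)
    (fun z ↦ by have := L.meromorphic_P_comp_add h₁ z; fun_prop) one_ne_zero
    (by
      refine (tendsto_const_add_cobounded e₁).comp ?_
      have t : Tendsto (fun z ↦ (℘[L] (z + h₁) - e₁) / B) (𝓝[≠] 0) (𝓝[≠] 0) := by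
        refine tendsto_nhdsWithin_iff.2 ⟨?_, ?_⟩
        · have : ContinuousAt (fun z ↦ (℘[L] (z + h₁) - e₁) / B) 0 := by
            have : AnalyticAt ℂ (fun z ↦ ℘[L] (z + h₁)) 0 := by
              apply AnalyticAt.fun_comp_add; simpa using L.analyticAt_P H.notMem₁
            have := this.continuousAt
            fun_prop
          simpa [he₁] using this.tendsto.mono_left (nhdsWithin_le_nhds (s := {0}ᶜ))
        · filter_upwards [hne] with w hw
          exact div_ne_zero hw.2 hBne
      have := tendsto_inv₀_nhdsNE_zero.comp t
      refine this.congr fun z ↦ ?_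
      simp)
    (by
      filter_upwards [hne] with w ⟨h1, h2⟩
      have hd : HasDerivAt (fun z ↦ e₁ + B / (℘[L] (z + h₁) - e₁))
          (-(B * ℘'[L] (w + h₁)) / (℘[L] (w + h₁) - e₁) ^ 2) w := by
        have h3 := (L.hasDerivAt_P h1).comp_add_const w h₁
        simpa using! ((hasDerivAt_const w B).fun_div (h3.sub_const e₁) h2).const_add e₁
      rw [hd.deriv, div_pow, neg_sq, mul_pow, H.P'_sq h1, b, c]
      have ha : e₃ = -e₁ - e₂ := by linear_combination a
      change B ^ 2 * (4 * (℘[L] (w + h₁) - e₁) * (℘[L] (w + h₁) - e₂) * (℘[L] (w + h₁) - e₃)) / _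
        = _
      rw [hB, ha]
      field_simp
      ring) z
  have hne' : ℘[L] (z + h₁) - e₁ ≠ 0 := fun h ↦ hz (by
    have h4 := (H.P_eq_iff_sub_mem hz').1 (sub_eq_zero.1 h)
    have := L.lattice.sub_mem h4 H.two₁
    convert! this using 1; ring)
  have := eq_of_eventuallyEq key (by
      have : AnalyticAt ℂ (fun z ↦ ℘[L] (z + h₁)) z := (L.analyticAt_P hz').fun_comp_add
      have := this.continuousAt
      fun_prop (disch := exact hne')) (by
      simpa using (L.analyticAt_P hz).continuousAt)
  rw [one_mul] at this
  rw [← this]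
  field_simp
  ring

end HalfTriple

theorem tendsto_inv_P : Tendsto (fun z ↦ (℘[L] z)⁻¹) (𝓝[≠] 0) (𝓝 0) :=
  tendsto_inv₀_cobounded.comp (L.tendsto_P_cobounded L.lattice.zero_mem)

theorem notMem_of_two_mul {z : ℂ} (hz : 2 * z ∉ L.lattice) : z ∉ L.lattice := fun h ↦
  hz (by rw [two_mul]; exact L.lattice.add_mem h h)

theorem P'_ne_zero {z : ℂ} (hz : 2 * z ∉ L.lattice) : ℘'[L] z ≠ 0 := fun h ↦
  hz ((L.P'_eq_zero_iff (L.notMem_of_two_mul hz)).1 h)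

/-- For a half period `h`, a square root of `z ↦ ℘(2z) - ℘(h)`. -/
noncomputable def halfRoot (h z : ℂ) : ℂ :=
  ((℘[L] z - ℘[L] h) ^ 2 - (3 * ℘[L] h ^ 2 - L.g₂ / 4)) / ℘'[L] z

theorem meromorphic_halfRoot (h : ℂ) : Meromorphic (L.halfRoot h) := fun z ↦ by
  have h1 := L.meromorphic_weierstrassP z
  have h2 := L.meromorphic_derivWeierstrassP z
  unfold halfRoot
  fun_prop

theorem meromorphic_halfRoot_comp_add (h a : ℂ) : Meromorphic fun z ↦ L.halfRoot h (z + a) :=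
  fun z ↦ (L.meromorphic_halfRoot h (z + a)).comp_analyticAt (g := fun z ↦ z + a) (by fun_prop)

theorem continuousAt_halfRoot (h : ℂ) {z : ℂ} (hz : 2 * z ∉ L.lattice) :
    ContinuousAt (L.halfRoot h) z := by
  have h1 := (L.analyticAt_P (L.notMem_of_two_mul hz)).continuousAt
  have h2 := (L.analyticAt_P' (L.notMem_of_two_mul hz)).continuousAt
  have := L.P'_ne_zero hz
  unfold halfRoot
  fun_prop (disch := assumption)

theorem halfRoot_add_of_mem (h : ℂ) {l : ℂ} (hl : l ∈ L.lattice) (z : ℂ) :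
    L.halfRoot h (z + l) = L.halfRoot h z := by
  simp [halfRoot, L.P_add hl, L.P'_add hl]

theorem halfRoot_neg (h z : ℂ) : L.halfRoot h (-z) = - L.halfRoot h z := by
  simp [halfRoot, div_neg]

theorem eventually_two_mul_notMem (z : ℂ) : ∀ᶠ w in 𝓝[≠] z, 2 * w ∉ L.lattice :=
  (tendsto_mul_const_nhdsNE two_ne_zero z).eventually (L.compl_mem_nhdsNE (2 * z))

namespace HalfTriple
variable {L} {h₁ h₂ h₃ : ℂ} (H : L.HalfTriple h₁ h₂ h₃)
include H

theorem halfRoot_eq (z : ℂ) : L.halfRoot h₁ z = ((℘[L] z - ℘[L] h₁) ^ 2 -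
    (℘[L] h₁ - ℘[L] h₂) * (℘[L] h₁ - ℘[L] h₃)) / ℘'[L] z := by
  obtain ⟨a, b, c⟩ := H.g_eq
  rw [halfRoot]
  congr 1
  rw [b]
  linear_combination -2 * ℘[L] h₁ * a

theorem halfRoot_sq_sub {z : ℂ} (hz : 2 * z ∉ L.lattice) :
    L.halfRoot h₁ z ^ 2 - L.halfRoot h₂ z ^ 2 = ℘[L] h₂ - ℘[L] h₁ := by
  rw [H.halfRoot_eq, H.swap.halfRoot_eq, div_pow, div_pow, H.P'_sq (L.notMem_of_two_mul hz)]
  have h0 := H.P'_sq (L.notMem_of_two_mul hz)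
  have h4 : 4 * (℘[L] z - ℘[L] h₁) * (℘[L] z - ℘[L] h₂) * (℘[L] z - ℘[L] h₃) ≠ 0 := by
    rw [← h0]; exact pow_ne_zero 2 (L.P'_ne_zero hz)
  rw [← sub_div, div_eq_iff h4]
  ring

theorem hasDerivAt_halfRoot {z : ℂ} (hz : 2 * z ∉ L.lattice) :
    HasDerivAt (L.halfRoot h₁) (2 * L.halfRoot h₂ z * L.halfRoot h₃ z) z := by
  have hz' := L.notMem_of_two_mul hz
  have hne := L.P'_ne_zero hz
  have d := ((((L.hasDerivAt_P hz').sub_const (℘[L] h₁)).fun_pow 2).sub_const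
    (3 * ℘[L] h₁ ^ 2 - L.g₂ / 4)).fun_div (L.hasDerivAt_P' hz') hne
  refine d.congr_deriv ?_
  obtain ⟨a, b, c⟩ := H.g_eq
  rw [H.swap.halfRoot_eq, H.rot.rot.halfRoot_eq]
  have h0 := H.P'_sq hz'
  have ha : ℘[L] h₃ = -℘[L] h₁ - ℘[L] h₂ := by linear_combination a
  simp only [Nat.cast_ofNat, Nat.add_one_sub_one, pow_one]
  rw [mul_assoc (2 : ℂ) (_ / _), div_mul_div_comm, ← sq, mul_div_assoc']
  congr 1
  rw [b]
  rw [ha] at h0 ⊢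
  linear_combination (2 * (℘[L] z - ℘[L] h₁)) * h0

theorem P_two_mul_sub {z : ℂ} (hz : 2 * z ∉ L.lattice) :
    ℘[L] (2 * z) - ℘[L] h₁ = L.halfRoot h₁ z ^ 2 := by
  obtain ⟨a, b, c⟩ := H.g_eq
  have key := L.eventuallyEq_P_mul (f := fun z ↦ ℘[L] h₁ + L.halfRoot h₁ z ^ 2) (α := 2)
    (fun z ↦ by have := L.meromorphic_halfRoot h₁ z; fun_prop) two_ne_zero
    (by
      refine (tendsto_const_add_cobounded (℘[L] h₁)).comp ?_
      have t : Tendsto (fun z ↦ (L.halfRoot h₁ z ^ 2)⁻¹) (𝓝[≠] 0) (𝓝[≠] 0) := by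
        refine tendsto_nhdsWithin_iff.2 ⟨?_, ?_⟩
        · have c1 : ContinuousAt (fun s : ℂ ↦ 4 * s * (1 - ℘[L] h₁ * s) * (1 - ℘[L] h₂ * s) *
              (1 - ℘[L] h₃ * s) / ((1 - ℘[L] h₁ * s) ^ 2 - (℘[L] h₁ - ℘[L] h₂) *
              (℘[L] h₁ - ℘[L] h₃) * s ^ 2) ^ 2) 0 := by
            fun_prop (disch := simp)
          have c2 := c1.tendsto.comp L.tendsto_inv_P
          simp only [mul_zero, zero_mul, zero_div] at c2
          refine c2.congr' ?_
          have e0 := (L.tendsto_P_cobounded L.lattice.zero_mem).eventually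
            (Bornology.eventually_ne_cobounded (0 : ℂ))
          filter_upwards [L.eventually_two_mul_notMem 0, e0] with w hw hw0
          rw [H.halfRoot_eq, div_pow, H.P'_sq (L.notMem_of_two_mul hw)]
          simp only [Function.comp]
          rw [inv_div]
          have e1 (t : ℂ) : 1 - t * (℘[L] w)⁻¹ = (℘[L] w - t) / ℘[L] w := by field_simp
          rw [e1, e1, e1]
          field_simp
        · have e0 : ∀ᶠ w in 𝓝[≠] (0 : ℂ), L.halfRoot h₁ w ≠ 0 := by
            have e1 := (tendsto_mul_const_nhdsNE (show (4 : ℂ) ≠ 0 by norm_num) 0).eventually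
              (L.compl_mem_nhdsNE (4 * 0))
            filter_upwards [L.eventually_two_mul_notMem 0, e1,
              (L.tendsto_P_cobounded L.lattice.zero_mem).eventually
                (Bornology.eventually_ne_cobounded (℘[L] h₁))] with w hw hw1 hw2
            intro h
            have hw' := L.notMem_of_two_mul hw
            rw [H.halfRoot_eq, div_eq_zero_iff, or_iff_left (L.P'_ne_zero hw)] at h
            have hwh : w + h₁ ∉ L.lattice := fun h' ↦ hw2 ((H.P_eq_iff_sub_mem hw').2 h')
            rw [← H.P_add_mul hw' hwh] at h
            have h5 : ℘[L] (w + h₁) = ℘[L] w := by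
              apply mul_right_cancel₀ (sub_ne_zero.2 hw2)
              linear_combination -h
            rw [L.P_eq_iff hwh hw'] at h5
            rcases h5 with h5 | h5
            · exact H.notMem₁ (by simpa using h5)
            · apply hw1
              have := L.lattice.sub_mem (L.lattice.add_mem h5 h5) H.two₁
              convert! this using 1
              ring
          filter_upwards [e0] with w hw
          simpa using hw
      have := tendsto_inv₀_nhdsNE_zero.comp t
      refine this.congr fun z ↦ ?_
      simp)
    (by
      filter_upwards [L.eventually_two_mul_notMem 0] with w hw
      have hd := ((H.hasDerivAt_halfRoot hw).fun_pow 2).const_add (℘[L] h₁)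
      rw [hd.deriv]
      have s1 := H.halfRoot_sq_sub hw
      have s2 := H.rot.rot.halfRoot_sq_sub hw
      have s3 : L.halfRoot h₂ w ^ 2 = L.halfRoot h₁ w ^ 2 + ℘[L] h₁ - ℘[L] h₂ := by
        linear_combination -s1
      have s4 : L.halfRoot h₃ w ^ 2 = L.halfRoot h₁ w ^ 2 + ℘[L] h₁ - ℘[L] h₃ := by
        linear_combination s2
      rw [show (((2 : ℕ) : ℂ) * L.halfRoot h₁ w ^ (2 - 1) *
        (2 * L.halfRoot h₂ w * L.halfRoot h₃ w)) ^ 2 = 16 * L.halfRoot h₁ w ^ 2 *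
          L.halfRoot h₂ w ^ 2 * L.halfRoot h₃ w ^ 2 by push_cast; ring, s3, s4, b, c]
      have ha : ℘[L] h₃ = -℘[L] h₁ - ℘[L] h₂ := by linear_combination a
      rw [ha]
      ring) z
  have := eq_of_eventuallyEq key (by
      have := L.continuousAt_halfRoot h₁ hz
      fun_prop) (by
      have := (L.analyticAt_P hz).continuousAt
      exact ContinuousAt.comp (f := fun z ↦ 2 * z) this (by fun_prop))
  rw [← this]
  ring

theorem P'_two_mul {z : ℂ} (hz : 2 * z ∉ L.lattice) :
    ℘'[L] (2 * z) = 2 * L.halfRoot h₁ z * L.halfRoot h₂ z * L.halfRoot h₃ z := by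
  have d1 : HasDerivAt (fun z ↦ ℘[L] (2 * z) - ℘[L] h₁) (℘'[L] (2 * z) * 2) z := by
    have := (L.hasDerivAt_P hz).comp z ((hasDerivAt_id z).const_mul 2)
    simpa using! this.sub_const (℘[L] h₁)
  have d2 := (H.hasDerivAt_halfRoot hz).fun_pow 2
  have e : (fun z ↦ ℘[L] (2 * z) - ℘[L] h₁) =ᶠ[𝓝 z] fun z ↦ L.halfRoot h₁ z ^ 2 := by
    have : ∀ᶠ w in 𝓝 z, 2 * w ∉ L.lattice :=
      ((continuous_const_mul (2 : ℂ)).tendsto z).eventually (L.compl_mem_nhds hz)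
    filter_upwards [this] with w hw using H.P_two_mul_sub hw
  have := d1.unique (d2.congr_of_eventuallyEq e)
  simp at this
  linear_combination this / 2

theorem P'_add_mul {z : ℂ} (hz : z ∉ L.lattice) (hz' : z + h₁ ∉ L.lattice) :
    ℘'[L] (z + h₁) * (℘[L] z - ℘[L] h₁) ^ 2 =
      - ((℘[L] h₁ - ℘[L] h₂) * (℘[L] h₁ - ℘[L] h₃)) * ℘'[L] z := by
  have d1 := (((L.hasDerivAt_P hz').comp_add_const z h₁).sub_const (℘[L] h₁)).fun_mul
    ((L.hasDerivAt_P hz).sub_const (℘[L] h₁))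
  have e : (fun z ↦ (℘[L] (z + h₁) - ℘[L] h₁) * (℘[L] z - ℘[L] h₁)) =ᶠ[𝓝 z]
      fun z ↦ (℘[L] h₁ - ℘[L] h₂) * (℘[L] h₁ - ℘[L] h₃) := by
    have : ∀ᶠ w in 𝓝 z, w + h₁ ∉ L.lattice :=
      ((continuous_add_const (h₁ : ℂ)).tendsto z).eventually (L.compl_mem_nhds hz')
    filter_upwards [this, L.compl_mem_nhds hz] with w hw hw' using H.P_add_mul hw' hw
  have := d1.unique ((hasDerivAt_const z _).congr_of_eventuallyEq e)
  rw [← H.P_add_mul hz hz']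
  linear_combination (℘[L] z - ℘[L] h₁) * this

end HalfTriple

namespace HalfTriple
variable {L} {h₁ h₂ h₃ : ℂ} (H : L.HalfTriple h₁ h₂ h₃)
include H

theorem two_mul_add_notMem {z : ℂ} (hz : 2 * z ∉ L.lattice) : 2 * (z + h₁) ∉ L.lattice := fun h ↦
  hz (by simpa [mul_add] using L.lattice.sub_mem h H.two₁)

theorem P_sub_ne {z : ℂ} (hz : 2 * z ∉ L.lattice) : ℘[L] z - ℘[L] h₁ ≠ 0 := fun h ↦
  L.notMem_of_two_mul (H.two_mul_add_notMem hz)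
    ((H.P_eq_iff_sub_mem (L.notMem_of_two_mul hz)).1 (sub_eq_zero.1 h))

theorem halfRoot_add_self {z : ℂ} (hz : 2 * z ∉ L.lattice) :
    L.halfRoot h₁ (z + h₁) = L.halfRoot h₁ z := by
  have hz' := H.two_mul_add_notMem hz
  have p := H.P_add_mul (L.notMem_of_two_mul hz) (L.notMem_of_two_mul hz')
  have q := H.P'_add_mul (L.notMem_of_two_mul hz) (L.notMem_of_two_mul hz')
  have hx := H.P_sub_ne hz
  rw [H.halfRoot_eq, H.halfRoot_eq, div_eq_div_iff (L.P'_ne_zero hz') (L.P'_ne_zero hz), ← p]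
  rw [← p] at q
  have : ℘'[L] (z + h₁) * (℘[L] z - ℘[L] h₁) = -(℘[L] (z + h₁) - ℘[L] h₁) * ℘'[L] z := by
    apply mul_right_cancel₀ hx
    linear_combination q
  linear_combination -(℘[L] z - ℘[L] (z + h₁)) * this

theorem halfRoot_add_of_ne {z : ℂ} (hz : 2 * z ∉ L.lattice) :
    L.halfRoot h₁ (z + h₂) = -L.halfRoot h₁ z := by
  have hz' := H.swap.two_mul_add_notMem hz
  have p := H.swap.P_add_mul (L.notMem_of_two_mul hz) (L.notMem_of_two_mul hz')
  have q := H.swap.P'_add_mul (L.notMem_of_two_mul hz) (L.notMem_of_two_mul hz')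
  have hx := H.swap.P_sub_ne hz
  rw [H.halfRoot_eq, H.halfRoot_eq, ← neg_div, div_eq_div_iff (L.P'_ne_zero hz') (L.P'_ne_zero hz)]
  apply mul_right_cancel₀ (pow_ne_zero 2 hx)
  have hX : ℘[L] (z + h₂) = (℘[L] h₂ - ℘[L] h₁) * (℘[L] h₂ - ℘[L] h₃) / (℘[L] z - ℘[L] h₂) +
      ℘[L] h₂ := by rw [← p]; field_simp; ring
  rw [mul_assoc (-_), q, hX]
  field_simp
  ring

theorem tendsto_halfRoot_div :
    Tendsto (fun z ↦ L.halfRoot h₁ z / L.halfRoot h₂ z) (𝓝[≠] 0) (𝓝 1) := by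
  have c1 : ContinuousAt (fun s : ℂ ↦
      ((1 - ℘[L] h₁ * s) ^ 2 - (℘[L] h₁ - ℘[L] h₂) * (℘[L] h₁ - ℘[L] h₃) * s ^ 2) /
      ((1 - ℘[L] h₂ * s) ^ 2 - (℘[L] h₂ - ℘[L] h₁) * (℘[L] h₂ - ℘[L] h₃) * s ^ 2)) 0 := by
    fun_prop (disch := simp)
  have c2 := c1.tendsto.comp L.tendsto_inv_P
  norm_num at c2
  refine c2.congr' ?_
  filter_upwards [L.eventually_two_mul_notMem 0,
    (L.tendsto_P_cobounded L.lattice.zero_mem).eventually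
      (Bornology.eventually_ne_cobounded (0 : ℂ))] with w hw hw0
  rw [H.halfRoot_eq, H.swap.halfRoot_eq, div_div_div_cancel_right₀ (L.P'_ne_zero hw)]
  simp only [Function.comp]
  have e1 (t : ℂ) : 1 - t * (℘[L] w)⁻¹ = (℘[L] w - t) / ℘[L] w := by field_simp
  rw [e1, e1]
  field_simp

/-- Translation of a half root by a quarter period. -/
theorem halfRoot_add_mul {P : ℂ} (hP : 2 * P + h₂ ∈ L.lattice) {z : ℂ} (hz : 2 * z ∉ L.lattice)
    (hz' : 2 * (z + P) ∉ L.lattice) :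
    L.halfRoot h₁ (z + P) * L.halfRoot h₂ z = L.halfRoot h₁ P * L.halfRoot h₃ z := by
  have hP2 : 2 * P ∉ L.lattice := fun h ↦ H.notMem₂ (by simpa using L.lattice.sub_mem hP h)
  have hPsq : L.halfRoot h₁ P ^ 2 = ℘[L] h₂ - ℘[L] h₁ := by
    rw [← H.P_two_mul_sub hP2, (H.swap.P_eq_iff_sub_mem hP2).2 hP]
  have hP0 : L.halfRoot h₁ P ≠ 0 := fun h ↦ H.P_ne.symm (by
    rw [h] at hPsq; linear_combination -hPsq)
  set F : ℂ → ℂ := fun z ↦ L.halfRoot h₁ (z + P) * L.halfRoot h₂ z with hF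
  set G : ℂ → ℂ := fun z ↦ L.halfRoot h₁ P * L.halfRoot h₃ z with hG
  have mF : Meromorphic F := fun z ↦
    (L.meromorphic_halfRoot_comp_add h₁ P z).mul (L.meromorphic_halfRoot h₂ z)
  have mG : Meromorphic G := fun z ↦
    (MeromorphicAt.const (L.halfRoot h₁ P) z).mul (L.meromorphic_halfRoot h₃ z)
  have ev (z : ℂ) : ∀ᶠ w in 𝓝[≠] z, 2 * w ∉ L.lattice ∧ 2 * (w + P) ∉ L.lattice :=
    (L.eventually_two_mul_notMem z).and
      ((tendsto_add_const_nhdsNE z P).eventually (L.eventually_two_mul_notMem _))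
  have ev0 : ∀ᶠ z in 𝓝[≠] (0 : ℂ), L.halfRoot h₂ z ≠ 0 ∧ L.halfRoot h₃ z ≠ 0 := by
    filter_upwards [L.eventually_two_mul_notMem 0,
      (tendsto_mul_const_nhdsNE (show (4 : ℂ) ≠ 0 by norm_num) 0).eventually
        (L.compl_mem_nhdsNE (4 * 0))] with w hw hw4
    have aux (h : ℂ) (h2 : 2 * h ∈ L.lattice) : 2 * w + h ∉ L.lattice := fun h' ↦ hw4 (by
      have := L.lattice.sub_mem (L.lattice.add_mem h' h') h2
      convert! this using 1; ring)
    constructor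
    · intro h
      have := H.rot.P_two_mul_sub hw
      rw [h, zero_pow two_ne_zero, sub_eq_zero, H.rot.P_eq_iff_sub_mem hw] at this
      exact aux _ H.two₂ this
    · intro h
      have := H.rot.rot.P_two_mul_sub hw
      rw [h, zero_pow two_ne_zero, sub_eq_zero, H.rot.rot.P_eq_iff_sub_mem hw] at this
      exact aux _ H.two₃ this
  have sq : ∀ᶠ z in 𝓝[≠] 0, (F z - G z) * (F z + G z) = 0 := by
    filter_upwards [ev 0] with w ⟨hw, hw'⟩
    have hl : 2 * (w + P) - (2 * w + h₂) ∈ L.lattice := by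
      have := L.lattice.sub_mem hP H.two₂
      convert! this using 1; ring
    have hw2 : 2 * w + h₂ ∉ L.lattice := fun h ↦ hw' (by simpa using L.lattice.add_mem hl h)
    have e1 : ℘[L] (2 * (w + P)) = ℘[L] (2 * w + h₂) := by
      rw [← L.P_add hl (2 * w + h₂)]; congr 1; ring
    have e2 := H.swap.P_add_mul hw hw2
    have e3 := H.P_two_mul_sub hw'
    have e4 := H.swap.P_two_mul_sub hw
    have e5 := H.rot.rot.P_two_mul_sub hw
    have : F w ^ 2 - G w ^ 2 = 0 := by
      simp only [hF, hG, mul_pow, hPsq, ← e3, ← e4, ← e5, e1]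
      linear_combination e2
    linear_combination this
  have hm : F =ᶠ[𝓝[≠] 0] G := by
    have h1 : meromorphicOrderAt (fun z ↦ (F z - G z) * (F z + G z)) 0 = ⊤ :=
      meromorphicOrderAt_eq_top_iff.2 sq
    have h2 := meromorphicOrderAt_mul ((mF 0).sub (mG 0)) ((mF 0).add (mG 0))
    have h2' : meromorphicOrderAt (F - G) 0 + meromorphicOrderAt (F + G) 0 = ⊤ := by
      rw [← h2]; exact h1
    rcases WithTop.add_eq_top.1 h2' with h | h
    · filter_upwards [meromorphicOrderAt_eq_top_iff.1 h] with w hw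
      exact sub_eq_zero.1 hw
    · exfalso
      have t1 : Tendsto (fun z ↦ L.halfRoot h₁ (z + P)) (𝓝[≠] 0) (𝓝 (L.halfRoot h₁ P)) := by
        have c := L.continuousAt_halfRoot h₁ hP2
        have : ContinuousAt (fun z ↦ L.halfRoot h₁ (z + P)) 0 :=
          ContinuousAt.comp (f := fun z ↦ z + P) (g := L.halfRoot h₁) (by simpa using c)
            (by fun_prop)
        simpa using this.tendsto.mono_left (nhdsWithin_le_nhds (s := {0}ᶜ))
      have t2 : Tendsto (fun z ↦ L.halfRoot h₁ (z + P)) (𝓝[≠] 0) (𝓝 (-L.halfRoot h₁ P * 1)) := by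
        refine (H.rot.swap.tendsto_halfRoot_div.const_mul (-L.halfRoot h₁ P)).congr' ?_
        filter_upwards [meromorphicOrderAt_eq_top_iff.1 h, ev0] with w hw ⟨h2, h3⟩
        simp only [hF, hG, Pi.add_apply] at hw
        field_simp
        linear_combination -hw
      have := tendsto_nhds_unique t1 t2
      apply hP0
      linear_combination this / 2
  have := Meromorphic.eventuallyEq_of_eventuallyEq mF mG hm z
  refine eq_of_eventuallyEq (f := F) (g := G) this ?_ ?_
  · have c := L.continuousAt_halfRoot h₁ hz'
    have : ContinuousAt (fun z ↦ L.halfRoot h₁ (z + P)) z :=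
      ContinuousAt.comp (f := fun z ↦ z + P) (g := L.halfRoot h₁) c (by fun_prop)
    exact this.mul (L.continuousAt_halfRoot h₂ hz)
  · exact continuousAt_const.mul (L.continuousAt_halfRoot h₃ hz)

end HalfTriple

theorem P_add_formula {z v : ℂ} (hz : z ∉ L.lattice) (hv : 2 * v ∉ L.lattice)
    (hp : z + v ∉ L.lattice) (hm : z - v ∉ L.lattice) :
    ℘[L] (z + v) = ((℘'[L] z - ℘'[L] v) / (℘[L] z - ℘[L] v)) ^ 2 / 4 - ℘[L] z - ℘[L] v ∧
    ℘'[L] (z + v) = -℘'[L] z - (℘'[L] z - ℘'[L] v) / (℘[L] z - ℘[L] v) *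
      (℘[L] (z + v) - ℘[L] z) := by
  have hv' := L.notMem_of_two_mul hv
  set q := ℘[L] v with hq
  set q' := ℘'[L] v with hq'
  set φ : ℂ → ℂ := fun w ↦ ((℘'[L] w - q') / (℘[L] w - q)) ^ 2 / 4 - ℘[L] w - q with hφ
  have hne {w : ℂ} (hw : w ∉ L.lattice) (h1 : w + v ∉ L.lattice) (h2 : w - v ∉ L.lattice) :
      ℘[L] w - q ≠ 0 := by
    rw [sub_ne_zero, Ne, L.P_eq_iff hw hv']
    tauto
  have hd {w : ℂ} (hw : w ∉ L.lattice) (h1 : w + v ∉ L.lattice) (h2 : w - v ∉ L.lattice) :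
      HasDerivAt φ (-℘'[L] w - (℘'[L] w - q') / (℘[L] w - q) * (φ w - ℘[L] w)) w := by
    have h3 := hne hw h1 h2
    have := (((((L.hasDerivAt_P' hw).sub_const q').fun_div ((L.hasDerivAt_P hw).sub_const q)
      h3).fun_pow 2).div_const 4 |>.sub (L.hasDerivAt_P hw)).sub_const q
    refine this.congr_deriv ?_
    have r1 := L.derivWeierstrassP_sq w hw
    have r2 := L.derivWeierstrassP_sq v hv'
    rw [← hq, ← hq'] at r2
    have g2 : L.g₂ = (4 * ℘[L] w ^ 3 - 4 * q ^ 3 - ℘'[L] w ^ 2 + q' ^ 2) / (℘[L] w - q) := by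
      rw [eq_div_iff h3]; linear_combination r1 - r2
    simp only [hφ, g2]
    push_cast
    field_simp
    ring
  have ode {w : ℂ} (hw : w ∉ L.lattice) (h1 : w + v ∉ L.lattice) (h2 : w - v ∉ L.lattice) :
      deriv φ w ^ 2 = 4 * φ w ^ 3 - L.g₂ * φ w - L.g₃ := by
    rw [(hd hw h1 h2).deriv]
    have h3 := hne hw h1 h2
    have r1 := L.derivWeierstrassP_sq w hw
    have r2 := L.derivWeierstrassP_sq v hv'
    rw [← hq, ← hq'] at r2
    have g2 : L.g₂ = (4 * ℘[L] w ^ 3 - 4 * q ^ 3 - ℘'[L] w ^ 2 + q' ^ 2) / (℘[L] w - q) := by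
      rw [eq_div_iff h3]; linear_combination r1 - r2
    have g3 : L.g₃ = 4 * ℘[L] w ^ 3 - L.g₂ * ℘[L] w - ℘'[L] w ^ 2 := by linear_combination r1
    simp only [hφ]
    rw [g3, g2]
    field_simp
    ring
  have evw (a : ℂ) (z : ℂ) : ∀ᶠ u in 𝓝[≠] z, u + a ∉ L.lattice :=
    (tendsto_add_const_nhdsNE z a).eventually (L.compl_mem_nhdsNE _)
  have key := L.eventuallyEq_P_mul (f := fun u ↦ φ (u + -v)) (α := 1)
    (fun u ↦ by
      have h1 := L.meromorphic_P_comp_add (-v) u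
      have h2 := L.meromorphic_P'_comp_add (-v) u
      simp only [hφ]
      fun_prop) one_ne_zero
    (by
      have c1 : Tendsto (fun u ↦ ℘[L] (u + -v)) (𝓝[≠] 0) (𝓝 q) := by
        have : AnalyticAt ℂ (fun u ↦ ℘[L] (u + -v)) 0 :=
          AnalyticAt.fun_comp_add (by simpa using L.analyticAt_P (z := -v) (by simpa using hv'))
        simpa [hq] using this.continuousAt.tendsto.mono_left (nhdsWithin_le_nhds (s := {0}ᶜ))
      have c2 : Tendsto (fun u ↦ ℘'[L] (u + -v)) (𝓝[≠] 0) (𝓝 (-q')) := by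
        have : AnalyticAt ℂ (fun u ↦ ℘'[L] (u + -v)) 0 :=
          AnalyticAt.fun_comp_add (by simpa using L.analyticAt_P' (z := -v) (by simpa using hv'))
        simpa [hq'] using this.continuousAt.tendsto.mono_left (nhdsWithin_le_nhds (s := {0}ᶜ))
      have c3 : Tendsto (fun u ↦ ℘[L] (u + -v) - q) (𝓝[≠] 0) (𝓝[≠] 0) := by
        refine tendsto_nhdsWithin_iff.2 ⟨by simpa using c1.sub_const q, ?_⟩
        filter_upwards [L.compl_mem_nhdsNE 0, evw (-v) 0, evw (-2 * v) 0] with u h1 h2 h3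
        exact hne h2 (by simpa using! h1) (by convert! h3 using 2; ring)
      have c4 := (tendsto_inv₀_nhdsNE_zero.comp c3)
      have c5 : Tendsto (fun u ↦ (℘'[L] (u + -v) - q') / (℘[L] (u + -v) - q)) (𝓝[≠] 0)
          (Bornology.cobounded ℂ) := by
        have hq0 : -q' - q' ≠ 0 := by
          have := L.P'_ne_zero hv
          rw [← hq'] at this
          intro h; apply this; linear_combination -h / 2
        rw [← tendsto_norm_atTop_iff_cobounded] at c4 ⊢
        have := ((c2.sub_const q').norm).pos_mul_atTop (norm_pos_iff.2 hq0) c4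
        refine this.congr fun u ↦ ?_
        simp [div_eq_mul_inv]
      have c6 : Tendsto (fun u ↦ ((℘'[L] (u + -v) - q') / (℘[L] (u + -v) - q)) ^ 2 / 4)
          (𝓝[≠] 0) (Bornology.cobounded ℂ) := by
        rw [← tendsto_norm_atTop_iff_cobounded] at c5 ⊢
        have := ((tendsto_pow_atTop two_ne_zero).comp c5).atTop_div_const (r := 4) (by norm_num)
        refine this.congr fun u ↦ ?_
        simp
      rw [← tendsto_norm_atTop_iff_cobounded] at c6 ⊢
      have c7 := ((c1.add_const q).norm.neg).add_atTop c6
      refine tendsto_atTop_mono (fun u ↦ ?_) c7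
      simp only [hφ]
      have := norm_sub_norm_le (((℘'[L] (u + -v) - q') / (℘[L] (u + -v) - q)) ^ 2 / 4)
        (℘[L] (u + -v) + q)
      rw [sub_sub]
      linarith)
    (by
      filter_upwards [L.compl_mem_nhdsNE 0, evw (-v) 0, evw (-2 * v) 0] with u h1 h2 h3
      rw [deriv_comp_add_const, ode h2 (by simpa using! h1) (by convert! h3 using 2; ring)]
      ring)
  have fin {w : ℂ} (hw : w ∉ L.lattice) (h1 : w + v ∉ L.lattice) (h2 : w - v ∉ L.lattice) :
      φ w = ℘[L] (w + v) := by
    have h3 := key (w + v)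
    have h4 := eq_of_eventuallyEq h3 (by
      have := (hd hw h1 h2).continuousAt
      exact ContinuousAt.comp (f := fun z ↦ z + -v) (g := φ) (by simpa using this)
        (by fun_prop)) (by simpa using (L.analyticAt_P h1).continuousAt)
    simpa using h4
  refine ⟨(fin hz hp hm).symm, ?_⟩
  have e : φ =ᶠ[𝓝 z] fun w ↦ ℘[L] (w + v) := by
    filter_upwards [L.compl_mem_nhds hz,
      ((continuous_add_const v).tendsto z).eventually (L.compl_mem_nhds hp),
      ((continuous_sub_right v).tendsto z).eventually (L.compl_mem_nhds hm)] with w h1 h2 h3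
    exact fin h1 h2 h3
  have d := ((L.hasDerivAt_P hp).comp_add_const z v).congr_of_eventuallyEq e
  rw [d.unique (hd hz hp hm), fin hz hp hm]

/-- `U` is a set of representatives of `α⁻¹Λ / Λ` containing `0`. -/
structure IsKernel (α : ℂ) (U : Finset ℂ) : Prop where
  zero_mem : 0 ∈ U
  mul_mem : ∀ u ∈ U, α * u ∈ L.lattice
  exists_sub_mem : ∀ z, α * z ∈ L.lattice → ∃ u ∈ U, z - u ∈ L.lattice
  eq_of_sub_mem : ∀ u ∈ U, ∀ v ∈ U, u - v ∈ L.lattice → u = v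

theorem exists_isKernel {α : ℂ} (hα : α ≠ 0) (hL : ∀ l ∈ L.lattice, α * l ∈ L.lattice) :
    ∃ U, L.IsKernel α U := by
  classical
  have hfin : Module.Finite ℤ L.lattice := ZLattice.module_finite ℝ _
  have hfree : Module.Free ℤ L.lattice := ZLattice.module_free ℝ _
  let φ : L.lattice →ₗ[ℤ] L.lattice :=
    (LinearMap.mulLeft ℤ α).restrict hL
  have hφ : Function.Injective φ := fun a b h ↦ by
    have : α * (a : ℂ) = α * b := congrArg Subtype.val h
    exact Subtype.ext (mul_left_cancel₀ hα this)
  have hrank := LinearMap.finrank_range_of_inj hφ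
  have : Finite (L.lattice ⧸ LinearMap.range φ) := Submodule.finiteQuotientOfFreeOfRankEq _ hrank
  have := Fintype.ofFinite (L.lattice ⧸ LinearMap.range φ)
  let s : L.lattice ⧸ LinearMap.range φ → ℂ := fun c ↦
    if c = 0 then 0 else α⁻¹ * (Quotient.out c : L.lattice)
  have hs (c : L.lattice ⧸ LinearMap.range φ) :
      ∃ l : L.lattice, α * s c = l ∧ Submodule.Quotient.mk l = c := by
    by_cases hc : c = 0
    · exact ⟨0, by simp [s, hc], by simp [hc]⟩
    · refine ⟨Quotient.out c, by simp [s, hc, hα], Quotient.out_eq c⟩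
  refine ⟨Finset.univ.image s, ?_, ?_, ?_, ?_⟩
  · exact Finset.mem_image.2 ⟨0, Finset.mem_univ _, by simp [s]⟩
  · intro u hu
    obtain ⟨c, -, rfl⟩ := Finset.mem_image.1 hu
    obtain ⟨l, hl, -⟩ := hs c
    rw [hl]; exact l.2
  · intro z hz
    obtain ⟨l, hl, hc⟩ := hs (Submodule.Quotient.mk ⟨α * z, hz⟩)
    refine ⟨_, Finset.mem_image_of_mem s (Finset.mem_univ (Submodule.Quotient.mk ⟨α * z, hz⟩)), ?_⟩
    rw [eq_comm, Submodule.Quotient.eq] at hc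
    obtain ⟨m, hm⟩ := hc
    have h1 : α * (m : ℂ) = α * z - l := congrArg Subtype.val hm
    rw [← hl, ← mul_sub] at h1
    rw [← mul_left_cancel₀ hα h1]
    exact m.2
  · intro u hu v hv huv
    obtain ⟨c, -, rfl⟩ := Finset.mem_image.1 hu
    obtain ⟨d, -, rfl⟩ := Finset.mem_image.1 hv
    obtain ⟨l, hl, hc⟩ := hs c
    obtain ⟨m, hm, hd⟩ := hs d
    congr 1
    rw [← hc, ← hd, Submodule.Quotient.eq]
    refine ⟨⟨_, huv⟩, Subtype.ext ?_⟩
    change α * (s c - s d) = (l : ℂ) - m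
    rw [mul_sub, hl, hm]

open Classical in
theorem order_prod_sub_P (S : Finset ℂ) (p : ℂ → ℂ) (hp : ∀ u ∈ S, p u ∉ L.lattice) (z : ℂ) :
    meromorphicOrderAt (fun z ↦ ∏ u ∈ S, (℘[L] z - ℘[L] (p u))) z =
      ((∑ u ∈ S, ((if z - p u ∈ L.lattice then 1 else 0) + (if z + p u ∈ L.lattice then 1 else 0)
        - (if z ∈ L.lattice then 2 else 0)) : ℤ) : WithTop ℤ) := by
  rw [meromorphicOrderAt_fun_prod fun u _ ↦ by
    have := L.meromorphic_weierstrassP z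
    fun_prop, WithTop.coe_sum]
  exact Finset.sum_congr rfl fun u hu ↦ L.order_sub_P (hp u hu) z

namespace IsKernel
variable {L} {α : ℂ} {U : Finset ℂ} (hU : L.IsKernel α U)
include hU

open Classical in
theorem sum_ite (hL : ∀ l ∈ L.lattice, α * l ∈ L.lattice) (z : ℂ) :
    ∑ u ∈ U, (if z - u ∈ L.lattice then (1 : ℤ) else 0) =
      if α * z ∈ L.lattice then 1 else 0 := by
  split_ifs with h
  · obtain ⟨v, hv, hzv⟩ := hU.exists_sub_mem z h
    rw [Finset.sum_eq_single_of_mem v hv, if_pos hzv]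
    intro u hu huv
    rw [if_neg]
    intro h'
    apply huv
    apply hU.eq_of_sub_mem u hu v hv
    have := L.lattice.sub_mem hzv h'
    simpa using this
  · refine Finset.sum_eq_zero fun u hu ↦ if_neg fun h' ↦ h ?_
    have := L.lattice.add_mem (hL _ h') (hU.mul_mem u hu)
    rw [← mul_add, sub_add_cancel] at this
    exact this

open Classical in
theorem sum_erase_ite (hL : ∀ l ∈ L.lattice, α * l ∈ L.lattice) (z : ℂ) :
    ∑ u ∈ U.erase 0, (if z - u ∈ L.lattice then (1 : ℤ) else 0) =
      (if α * z ∈ L.lattice then 1 else 0) - if z ∈ L.lattice then 1 else 0 := by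
  rw [← hU.sum_ite hL, ← Finset.add_sum_erase _ _ hU.zero_mem, sub_zero]
  ring

theorem notMem_of_mem_erase {u : ℂ} (hu : u ∈ U.erase 0) : u ∉ L.lattice := fun h ↦
  (Finset.mem_erase.1 hu).1
    (hU.eq_of_sub_mem u (Finset.mem_erase.1 hu).2 0 hU.zero_mem (by simpa using h))

theorem add_notMem (hL : ∀ l ∈ L.lattice, α * l ∈ L.lattice) {w u : ℂ}
    (hw : α * w ∉ L.lattice) (hu : u ∈ U) : w + u ∉ L.lattice := fun h ↦ hw (by
  have := L.lattice.sub_mem (hL _ h) (hU.mul_mem u hu)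
  rwa [← mul_sub, add_sub_cancel_right] at this)

theorem sub_notMem (hL : ∀ l ∈ L.lattice, α * l ∈ L.lattice) {w u : ℂ}
    (hw : α * w ∉ L.lattice) (hu : u ∈ U) : w - u ∉ L.lattice := fun h ↦ hw (by
  have := L.lattice.add_mem (hL _ h) (hU.mul_mem u hu)
  rwa [← mul_add, sub_add_cancel] at this)

theorem prod_erase_ne_zero (hL : ∀ l ∈ L.lattice, α * l ∈ L.lattice) {z : ℂ}
    (hz : α * z ∉ L.lattice) : ∏ u ∈ U.erase 0, (℘[L] z - ℘[L] u) ≠ 0 := by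
  refine Finset.prod_ne_zero_iff.2 fun u hu ↦ sub_ne_zero.2 fun h ↦ ?_
  have hz' : z ∉ L.lattice := fun h ↦ hz (hL _ h)
  rw [L.P_eq_iff hz' (hU.notMem_of_mem_erase hu)] at h
  exact h.elim (hU.sub_notMem hL hz (Finset.mem_of_mem_erase hu))
    (hU.add_notMem hL hz (Finset.mem_of_mem_erase hu))

theorem P_mul_sub_mul_prod (hα : α ≠ 0) (hL : ∀ l ∈ L.lattice, α * l ∈ L.lattice) {w z : ℂ}
    (hw : α * w ∉ L.lattice) (hz : α * z ∉ L.lattice) :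
    (℘[L] (α * z) - ℘[L] (α * w)) * ∏ u ∈ U.erase 0, (℘[L] z - ℘[L] u) =
      (α ^ 2)⁻¹ * ∏ u ∈ U, (℘[L] z - ℘[L] (w + u)) := by
  classical
  set f₁ : ℂ → ℂ := fun z ↦ ℘[L] (α * z) - ℘[L] (α * w) with hf₁
  set f₂ : ℂ → ℂ := fun z ↦ ∏ u ∈ U.erase 0, (℘[L] z - ℘[L] u) with hf₂
  set g : ℂ → ℂ := fun z ↦ ∏ u ∈ U, (℘[L] z - ℘[L] (w + u)) with hg
  have mα : Meromorphic fun z ↦ ℘[L] (α * z) := fun z ↦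
    (L.meromorphic_weierstrassP (α * z)).comp_analyticAt (g := fun z ↦ α * z) (by fun_prop)
  have mf₁ : Meromorphic f₁ := fun z ↦ by have := mα z; fun_prop
  have mf₂ : Meromorphic f₂ := fun z ↦ by
    have := L.meromorphic_weierstrassP z
    exact MeromorphicAt.fun_prod fun u _ ↦ by fun_prop
  have mg : Meromorphic g := fun z ↦ by
    have := L.meromorphic_weierstrassP z
    exact MeromorphicAt.fun_prod fun u _ ↦ by fun_prop
  have og (z : ℂ) := L.order_prod_sub_P U (fun u ↦ w + u) (fun u hu ↦ hU.add_notMem hL hw hu) z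
  obtain ⟨C, hC⟩ := L.exists_eventuallyEq_const_mul (f := fun z ↦ f₁ z * f₂ z) (g := g)
    (fun z ↦ (mf₁ z).mul (mf₂ z)) mg
    (fun l hl z ↦ by
      simp only [hf₁, hf₂, mul_add, L.P_add hl, L.P_add (hL l hl)])
    (fun l hl z ↦ by simp only [hg, L.P_add hl])
    (fun z ↦ by rw [hg, og]; exact WithTop.coe_ne_top)
    (fun z ↦ by
      have o1 : meromorphicOrderAt f₁ z =
          (((if α * (z - w) ∈ L.lattice then 1 else 0) +
            (if α * (z + w) ∈ L.lattice then 1 else 0)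
            - (if α * z ∈ L.lattice then 2 else 0) : ℤ) : WithTop ℤ) := by
        have := meromorphicOrderAt_comp_of_deriv_ne_zero (f := fun z ↦ ℘[L] z - ℘[L] (α * w))
          (g := fun z ↦ α * z) (x := z) (by fun_prop) (by simpa using hα)
        rw [L.order_sub_P hw] at this
        rw [mul_sub, mul_add]
        exact this
      have o2 := L.order_prod_sub_P (U.erase 0) (fun u ↦ u)
        (fun u hu ↦ hU.notMem_of_mem_erase hu) z
      have om := meromorphicOrderAt_mul (mf₁ z) (mf₂ z)
      change meromorphicOrderAt (fun z ↦ f₁ z * f₂ z) z = _ at om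
      rw [om, o1, o2, hg, og]
      rw [← WithTop.coe_add, WithTop.coe_inj]
      simp only [Finset.sum_sub_distrib, Finset.sum_add_distrib, Finset.sum_const]
      have s1 := hU.sum_ite hL (z - w)
      have s2 := hU.sum_ite hL (-(z + w))
      have s3 := hU.sum_erase_ite hL z
      have s4 := hU.sum_erase_ite hL (-z)
      have i1 (u : ℂ) : (-(z + w) - u ∈ L.lattice) = (z + (w + u) ∈ L.lattice) := by
        rw [← neg_mem_iff]; congr 1; ring_nf
      have i2 (u : ℂ) : (-z - u ∈ L.lattice) = (z + u ∈ L.lattice) := by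
        rw [← neg_mem_iff]; congr 1; ring_nf
      simp only [i1, mul_neg, neg_mem_iff] at s2
      simp only [i2, mul_neg, neg_mem_iff] at s4
      simp only [sub_sub] at s1
      rw [s1, s2, s3, s4, Finset.card_erase_of_mem hU.zero_mem]
      have hc : 1 ≤ U.card := Finset.card_pos.2 ⟨0, hU.zero_mem⟩
      simp only [nsmul_eq_mul]
      push_cast [Nat.cast_sub hc]
      split_ifs <;> ring)
  have tP := L.tendsto_sq_mul_P
  have tc (c : ℂ) : Tendsto (fun z ↦ z ^ 2 * (℘[L] z - c)) (𝓝[≠] 0) (𝓝 1) := by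
    have : Tendsto (fun z : ℂ ↦ z ^ 2 * c) (𝓝[≠] 0) (𝓝 0) := by
      have : ContinuousAt (fun z : ℂ ↦ z ^ 2 * c) 0 := by fun_prop
      simpa using this.tendsto.mono_left (nhdsWithin_le_nhds (s := {0}ᶜ))
    simpa [mul_sub] using tP.sub this
  have tαc (c : ℂ) : Tendsto (fun z ↦ z ^ 2 * (℘[L] (α * z) - c)) (𝓝[≠] 0) (𝓝 (α ^ 2)⁻¹) := by
    have t0 := (tc c).comp (by simpa using tendsto_mul_const_nhdsNE hα 0)
    have := t0.const_mul (α ^ 2)⁻¹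
    rw [mul_one] at this
    refine this.congr fun z ↦ ?_
    simp only [Function.comp]
    field_simp
  have tprod (S : Finset ℂ) (p : ℂ → ℂ) :
      Tendsto (fun z ↦ ∏ u ∈ S, (z ^ 2 * (℘[L] z - ℘[L] (p u)))) (𝓝[≠] 0) (𝓝 1) := by
    simpa using tendsto_finsetProd S (fun u _ ↦ tc (℘[L] (p u)))
  have hCeq : C = (α ^ 2)⁻¹ := by
    have t1 := (tαc (℘[L] (α * w))).mul (tprod (U.erase 0) fun u ↦ u)
    have t2 := (tprod U fun u ↦ w + u).const_mul C
    rw [mul_one] at t1 t2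
    refine tendsto_nhds_unique t2 (t1.congr' ?_)
    filter_upwards [hC 0] with z hz
    simp only [hf₁, hf₂, hg] at hz
    rw [Finset.prod_mul_distrib, Finset.prod_mul_distrib, Finset.prod_const, Finset.prod_const,
      ← Finset.card_erase_add_one hU.zero_mem, pow_succ]
    linear_combination z ^ 2 * (z ^ 2) ^ (U.erase 0).card * hz
  have hz' : z ∉ L.lattice := fun h ↦ hz (hL _ h)
  have cP := (L.analyticAt_P hz').continuousAt
  have cα : ContinuousAt (fun z ↦ ℘[L] (α * z)) z :=
    ContinuousAt.comp (f := fun z ↦ α * z) (L.analyticAt_P hz).continuousAt (by fun_prop)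
  have fin := eq_of_eventuallyEq (hC z)
    (by
      refine ContinuousAt.mul (f := f₁) (g := f₂) (by fun_prop) ?_
      exact tendsto_finsetProd (x := 𝓝 z) (f := fun u z ↦ ℘[L] z - ℘[L] u) (U.erase 0)
        fun u _ ↦ cP.sub_const _)
    (by
      refine continuousAt_const.mul ?_
      exact tendsto_finsetProd (x := 𝓝 z) (f := fun u z ↦ ℘[L] z - ℘[L] (w + u)) U
        fun u _ ↦ cP.sub_const _)
  rw [hCeq] at fin
  exact fin

end IsKernel
end PeriodPair

open Polynomial in
/-- The pair `P`, `Q` is a rational solution `P / Q` of the differential equation expressing that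
`P(℘(z)) / Q(℘(z))` is `℘(α z)`. -/
structure IsMulPair (g₂ g₃ α : ℂ) (P Q : ℂ[X]) : Prop where
  ne_zero : Q ≠ 0
  natDegree_lt : Q.natDegree < P.natDegree
  ode : (derivative P * Q - P * derivative Q) ^ 2 * (4 * X ^ 3 - C g₂ * X - C g₃) =
    C (α ^ 2) * Q * (4 * P ^ 3 - C g₂ * P * Q ^ 2 - C g₃ * Q ^ 3)

theorem IsMulPair.map {g₂ g₃ α : ℂ} {P Q : Polynomial ℂ} (h : IsMulPair g₂ g₃ α P Q)
    (σ : ℂ ≃+* ℂ) : IsMulPair (σ g₂) (σ g₃) (σ α) (P.map (σ : ℂ →+* ℂ)) (Q.map (σ : ℂ →+* ℂ)) where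
  ne_zero := (Polynomial.map_ne_zero_iff σ.injective).2 h.ne_zero
  natDegree_lt := by
    rw [Polynomial.natDegree_map_eq_of_injective σ.injective,
      Polynomial.natDegree_map_eq_of_injective σ.injective]
    exact h.natDegree_lt
  ode := by
    have := congrArg (Polynomial.map (σ : ℂ →+* ℂ)) h.ode
    simpa [Polynomial.derivative_map] using this

namespace PeriodPair
variable (L : PeriodPair)

theorem tendsto_pow_mul_eval_P (p : Polynomial ℂ) :
    Tendsto (fun z ↦ z ^ (2 * p.natDegree) * p.eval (℘[L] z)) (𝓝[≠] 0) (𝓝 p.leadingCoeff) := by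
  have t (i : ℕ) (hi : i ∈ Finset.range (p.natDegree + 1)) :
      Tendsto (fun z ↦ p.coeff i * (z ^ 2 * ℘[L] z) ^ i * (z ^ 2) ^ (p.natDegree - i)) (𝓝[≠] 0)
      (𝓝 (p.coeff i * 1 ^ i * (0 ^ 2) ^ (p.natDegree - i))) :=
    ((L.tendsto_sq_mul_P.pow i).const_mul _).mul
      (((continuous_id.pow 2).pow _).tendsto (0 : ℂ) |>.mono_left nhdsWithin_le_nhds)
  have := tendsto_finsetSum _ t
  have e : ∑ i ∈ Finset.range (p.natDegree + 1),
      p.coeff i * 1 ^ i * (0 ^ 2) ^ (p.natDegree - i) = p.leadingCoeff := by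
    rw [Finset.sum_eq_single_of_mem p.natDegree (by simp)]
    · simp
    · intro i hi hne
      have : p.natDegree - i ≠ 0 := by have := Finset.mem_range.1 hi; omega
      simp [this]
  rw [e] at this
  refine this.congr fun z ↦ ?_
  rw [Polynomial.eval_eq_sum_range, Finset.mul_sum]
  refine Finset.sum_congr rfl fun i hi ↦ ?_
  have hi' := Nat.lt_succ_iff.1 (Finset.mem_range.1 hi)
  rw [mul_pow, ← Nat.add_sub_of_le hi', mul_add, pow_add, Nat.add_sub_cancel_left]
  ring

theorem eventually_eval_P_ne_zero {p : Polynomial ℂ} (hp : p ≠ 0) :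
    ∀ᶠ z in 𝓝[≠] 0, p.eval (℘[L] z) ≠ 0 := by
  filter_upwards [(L.tendsto_pow_mul_eval_P p).eventually_ne
    (Polynomial.leadingCoeff_ne_zero.2 hp)] with z hz h
  exact hz (by rw [h, mul_zero])

end PeriodPair

namespace IsMulPair
open scoped PeriodPair
variable {L : PeriodPair} {α : ℂ} {P Q : Polynomial ℂ}

theorem hasDerivAt {z : ℂ} (hz : z ∉ L.lattice) (hQ : Q.eval (℘[L] z) ≠ 0) :
    HasDerivAt (fun z ↦ P.eval (℘[L] z) / Q.eval (℘[L] z))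
      ((P.derivative.eval (℘[L] z) * Q.eval (℘[L] z) -
        P.eval (℘[L] z) * Q.derivative.eval (℘[L] z)) / Q.eval (℘[L] z) ^ 2 * ℘'[L] z) z := by
  have d := L.hasDerivAt_P hz
  refine ((P.hasDerivAt (℘[L] z)).comp z d).div ((Q.hasDerivAt (℘[L] z)).comp z d) hQ
    |>.congr_deriv ?_
  simp only [Function.comp]
  ring

theorem eventuallyEq (h : IsMulPair L.g₂ L.g₃ α P Q) (hα : α ≠ 0) (z : ℂ) :
    (fun z ↦ P.eval (℘[L] z) / Q.eval (℘[L] z)) =ᶠ[𝓝[≠] z] fun z ↦ ℘[L] (α * z) := by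
  have hP : P ≠ 0 := fun h0 ↦ by simpa [h0] using h.natDegree_lt
  refine L.eventuallyEq_P_mul (fun z ↦ ?_) hα ?_ ?_ z
  · have hm := L.meromorphic_weierstrassP z
    have aux (p : Polynomial ℂ) : MeromorphicAt (fun z ↦ p.eval (℘[L] z)) z := by
      simp only [Polynomial.eval_eq_sum_range]
      exact MeromorphicAt.fun_sum fun i ↦ by fun_prop
    exact (aux P).div (aux Q)
  · have t := (L.tendsto_pow_mul_eval_P Q).div (L.tendsto_pow_mul_eval_P P)
      (Polynomial.leadingCoeff_ne_zero.2 hP)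
    have t2 : Tendsto (fun z : ℂ ↦ z ^ (2 * (P.natDegree - Q.natDegree))) (𝓝[≠] 0) (𝓝 0) := by
      have h0 : 2 * (P.natDegree - Q.natDegree) ≠ 0 := by have := h.natDegree_lt; omega
      have := ((continuous_pow (M := ℂ) (2 * (P.natDegree - Q.natDegree))).tendsto
        0).mono_left (nhdsWithin_le_nhds (s := {0}ᶜ))
      simpa only [zero_pow h0] using this
    have t3 := t2.mul t
    rw [zero_mul] at t3
    have t4 : Tendsto (fun z ↦ (P.eval (℘[L] z) / Q.eval (℘[L] z))⁻¹) (𝓝[≠] 0) (𝓝[≠] 0) := by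
      refine tendsto_nhdsWithin_iff.2 ⟨t3.congr' ?_, ?_⟩
      · filter_upwards [self_mem_nhdsWithin] with z hz
        have hz : z ≠ 0 := hz
        rw [inv_div]
        simp only [Pi.div_apply]
        have : z ^ (2 * P.natDegree) = z ^ (2 * (P.natDegree - Q.natDegree)) *
            z ^ (2 * Q.natDegree) := by
          rw [← pow_add, ← mul_add, Nat.sub_add_cancel h.natDegree_lt.le]
        rw [this]
        field_simp
      · filter_upwards [L.eventually_eval_P_ne_zero hP, L.eventually_eval_P_ne_zero h.ne_zero]
          with z h1 h2
        exact inv_ne_zero (div_ne_zero h1 h2)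
    refine (tendsto_inv₀_nhdsNE_zero.comp t4).congr fun z ↦ ?_
    simp
  · filter_upwards [L.compl_mem_nhdsNE 0, L.eventually_eval_P_ne_zero h.ne_zero] with z hz hQ
    rw [(IsMulPair.hasDerivAt hz hQ).deriv, mul_pow, L.derivWeierstrassP_sq z hz, div_pow]
    have := congrArg (Polynomial.eval (℘[L] z)) h.ode
    simp only [Polynomial.eval_mul, Polynomial.eval_pow, Polynomial.eval_sub, Polynomial.eval_C,
      Polynomial.eval_X, Polynomial.eval_ofNat] at this
    field_simp
    linear_combination this

theorem notMem (h : IsMulPair L.g₂ L.g₃ α P Q) (hα : α ≠ 0) {z : ℂ} (hz : z ∉ L.lattice)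
    (hQ : Q.eval (℘[L] z) ≠ 0) :
    α * z ∉ L.lattice := fun hl ↦ by
  have t1 := ((L.tendsto_P_cobounded hl).comp (tendsto_mul_const_nhdsNE hα z)).congr'
    (h.eventuallyEq hα z).symm
  have t2 := (IsMulPair.hasDerivAt (P := P) hz hQ).continuousAt.tendsto.mono_left
    (nhdsWithin_le_nhds (s := {z}ᶜ))
  exact t2.not_tendsto (Metric.disjoint_nhds_cobounded _) t1

theorem P_mul (h : IsMulPair L.g₂ L.g₃ α P Q) (hα : α ≠ 0) {z : ℂ} (hz : z ∉ L.lattice)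
    (hQ : Q.eval (℘[L] z) ≠ 0) :
    ℘[L] (α * z) = P.eval (℘[L] z) / Q.eval (℘[L] z) :=
  (PeriodPair.eq_of_eventuallyEq (h.eventuallyEq hα z) (IsMulPair.hasDerivAt hz hQ).continuousAt
    (ContinuousAt.comp (f := fun z ↦ α * z) (L.analyticAt_P (h.notMem hα hz hQ)).continuousAt
      (by fun_prop))).symm

theorem P'_mul (h : IsMulPair L.g₂ L.g₃ α P Q) (hα : α ≠ 0) {z : ℂ} (hz : z ∉ L.lattice)
    (hQ : Q.eval (℘[L] z) ≠ 0) :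
    α * ℘'[L] (α * z) = (P.derivative.eval (℘[L] z) * Q.eval (℘[L] z) -
        P.eval (℘[L] z) * Q.derivative.eval (℘[L] z)) / Q.eval (℘[L] z) ^ 2 * ℘'[L] z := by
  have d1 : HasDerivAt (fun z ↦ ℘[L] (α * z)) (℘'[L] (α * z) * α) z := by
    have := (L.hasDerivAt_P (h.notMem hα hz hQ)).comp z ((hasDerivAt_id z).const_mul α)
    simpa using! this
  have e : (fun z ↦ ℘[L] (α * z)) =ᶠ[𝓝 z] fun z ↦ P.eval (℘[L] z) / Q.eval (℘[L] z) := by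
    have c : ContinuousAt (fun z ↦ Q.eval (℘[L] z)) z :=
      Q.continuousAt.comp (L.analyticAt_P hz).continuousAt
    filter_upwards [L.compl_mem_nhds hz, c.eventually_ne hQ] with w hw hQw
    exact h.P_mul hα hw hQw
  rw [mul_comm]
  exact d1.unique ((IsMulPair.hasDerivAt hz hQ).congr_of_eventuallyEq e)

theorem mul_mem (h : IsMulPair L.g₂ L.g₃ α P Q) (hα : α ≠ 0) {l : ℂ} (hl : l ∈ L.lattice) :
    α * l ∈ L.lattice := by
  by_contra hn
  have e0 := h.eventuallyEq hα 0
  have e1 : ∀ᶠ z in 𝓝[≠] 0, ℘[L] (α * (z + l)) = ℘[L] (α * z) := by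
    have := (tendsto_add_const_nhdsNE 0 l).eventually (h.eventuallyEq hα (0 + l))
    filter_upwards [this, e0] with z h1 h2
    rw [← h1, ← h2, L.P_add hl]
  have t1 := ((L.tendsto_P_cobounded L.lattice.zero_mem).comp
    (by simpa using tendsto_mul_const_nhdsNE hα 0)).congr'
    (f₁ := ℘[L] ∘ fun z ↦ α * z) (f₂ := fun z ↦ ℘[L] (α * (z + l))) (by
      filter_upwards [e1] with z hz using hz.symm)
  have c : ContinuousAt (fun z ↦ ℘[L] (α * (z + l))) 0 :=
    ContinuousAt.comp (f := fun z ↦ α * (z + l)) (g := ℘[L])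
      (by simpa using (L.analyticAt_P hn).continuousAt) (by fun_prop)
  exact (c.tendsto.mono_left (nhdsWithin_le_nhds (s := {0}ᶜ))).not_tendsto
    (Metric.disjoint_nhds_cobounded _) t1

end IsMulPair

namespace PeriodPair
variable (L : PeriodPair)
open Polynomial in
theorem exists_isMulPair {α : ℂ} (hα : α ≠ 0) (hL : ∀ l ∈ L.lattice, α * l ∈ L.lattice) :
    ∃ P Q : ℂ[X], IsMulPair L.g₂ L.g₃ α P Q ∧ ∀ z, α * z ∉ L.lattice → Q.eval (℘[L] z) ≠ 0 := by
  classical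
  obtain ⟨U, hU⟩ := L.exists_isKernel hα hL
  obtain ⟨w, hw⟩ := ((tendsto_mul_const_nhdsNE hα 0).eventually (L.compl_mem_nhdsNE (α * 0))).exists
  change α * w ∉ L.lattice at hw
  set Q : ℂ[X] := ∏ u ∈ U.erase 0, (X - C (℘[L] u)) with hQ
  set N : ℂ[X] := ∏ u ∈ U, (X - C (℘[L] (w + u))) with hN
  set P : ℂ[X] := C (℘[L] (α * w)) * Q + C ((α ^ 2)⁻¹) * N with hP
  have hQ0 : Q ≠ 0 := (monic_prod_of_monic _ _ fun u _ ↦ monic_X_sub_C _).ne_zero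
  have evQ (z : ℂ) : Q.eval (℘[L] z) = ∏ u ∈ U.erase 0, (℘[L] z - ℘[L] u) := by
    rw [hQ, eval_prod]; simp
  have evN (z : ℂ) : N.eval (℘[L] z) = ∏ u ∈ U, (℘[L] z - ℘[L] (w + u)) := by
    rw [hN, eval_prod]; simp
  have hQz (z : ℂ) (hz : α * z ∉ L.lattice) : Q.eval (℘[L] z) ≠ 0 := by
    rw [evQ]; exact hU.prod_erase_ne_zero hL hz
  have eqn (z : ℂ) (hz : α * z ∉ L.lattice) :
      ℘[L] (α * z) * Q.eval (℘[L] z) = P.eval (℘[L] z) := by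
    have := hU.P_mul_sub_mul_prod hα hL hw hz
    rw [← evQ] at this
    simp only [hP, eval_add, eval_mul, eval_C, evN]
    linear_combination this
  refine ⟨P, Q, ⟨hQ0, ?_, ?_⟩, hQz⟩
  · have d1 : Q.natDegree = U.card - 1 := by
      rw [hQ, natDegree_prod_of_monic _ _ fun u _ ↦ monic_X_sub_C _]
      simp [hU.zero_mem]
    have d2 : (C ((α ^ 2)⁻¹) * N).natDegree = U.card := by
      rw [natDegree_C_mul (by positivity), hN,
        natDegree_prod_of_monic _ _ fun u _ ↦ monic_X_sub_C _]
      simp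
    have hc : 1 ≤ U.card := Finset.card_pos.2 ⟨0, hU.zero_mem⟩
    have d3 : (C (℘[L] (α * w)) * Q).natDegree < (C ((α ^ 2)⁻¹) * N).natDegree := by
      have := natDegree_C_mul_le (℘[L] (α * w)) Q
      omega
    rw [hP, natDegree_add_eq_right_of_natDegree_lt d3]
    omega
  · apply mul_left_cancel₀ hQ0
    refine Polynomial.funext fun x ↦ ?_
    obtain ⟨z, hz, rfl⟩ := L.exists_P_eq x
    by_cases hαz : α * z ∈ L.lattice
    · obtain ⟨u, hu, hzu⟩ := hU.exists_sub_mem z hαz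
      have hu0 : u ≠ 0 := fun h ↦ hz (by simpa [h] using hzu)
      have : Q.eval (℘[L] z) = 0 := by
        rw [evQ]
        refine Finset.prod_eq_zero (Finset.mem_erase.2 ⟨hu0, hu⟩) ?_
        rw [sub_eq_zero, L.P_eq_iff hz (hU.notMem_of_mem_erase (Finset.mem_erase.2 ⟨hu0, hu⟩))]
        exact Or.inl hzu
      simp [this]
    · have h0 := hQz z hαz
      have d1 : HasDerivAt (fun z ↦ ℘[L] (α * z)) (℘'[L] (α * z) * α) z := by
        have := (L.hasDerivAt_P hαz).comp z ((hasDerivAt_id z).const_mul α)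
        simpa using! this
      have dp := L.hasDerivAt_P hz
      have d2 := d1.fun_mul ((Q.hasDerivAt (℘[L] z)).comp z dp)
      have d3 := (P.hasDerivAt (℘[L] z)).comp z dp
      have e : (fun z ↦ ℘[L] (α * z) * Q.eval (℘[L] z)) =ᶠ[𝓝 z] fun z ↦ P.eval (℘[L] z) := by
        filter_upwards [((continuous_const_mul α).tendsto z).eventually
          (L.compl_mem_nhds hαz)] with v hv using eqn v hv
      have d4 := d2.unique (d3.congr_of_eventuallyEq e)
      have e1 := eqn z hαz
      have e2 := L.derivWeierstrassP_sq (α * z) hαz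
      have e3 := L.derivWeierstrassP_sq z hz
      simp only [Function.comp] at d4
      simp only [eval_mul, eval_pow, eval_sub, eval_C, eval_X, eval_ofNat]
      rw [← e3]
      rw [← e1] at *
      set p := ℘[L] (α * z)
      set p' := ℘'[L] (α * z)
      set q := Q.eval (℘[L] z)
      set q₁ := (derivative Q).eval (℘[L] z)
      set p₁ := (derivative P).eval (℘[L] z)
      set y := ℘'[L] z
      have e4 : (p₁ * q - p * q * q₁) * y = α * p' * q ^ 2 := by linear_combination -q * d4
      have : ((p₁ * q - p * q * q₁) ^ 2 * y ^ 2) = α ^ 2 * p' ^ 2 * q ^ 4 := by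
        rw [← mul_pow, e4]; ring
      rw [this, e2]
      ring

/-- A field automorphism of `ℂ` carries the multiplication of a lattice by `α` to the
multiplication by `σ α` of a lattice with conjugate invariants. -/
theorem map_mul_mem {L L' : PeriodPair} (σ : ℂ ≃+* ℂ) (h₂ : L'.g₂ = σ L.g₂) (h₃ : L'.g₃ = σ L.g₃)
    {α : ℂ} (hα : α ≠ 0) (hL : ∀ l ∈ L.lattice, α * l ∈ L.lattice) {l : ℂ} (hl : l ∈ L'.lattice) :
    σ α * l ∈ L'.lattice := by
  obtain ⟨P, Q, h, -⟩ := L.exists_isMulPair hα hL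
  have h' := h.map σ
  rw [← h₂, ← h₃] at h'
  exact h'.mul_mem (by simpa using hα) hl

theorem map_P_mul {L L' : PeriodPair} (σ : ℂ ≃+* ℂ) (h₂ : L'.g₂ = σ L.g₂) (h₃ : L'.g₃ = σ L.g₃)
    {α : ℂ} (hα : α ≠ 0) (hL : ∀ l ∈ L.lattice, α * l ∈ L.lattice) {u u' : ℂ}
    (hu' : u' ∉ L'.lattice) (hP : ℘[L'] u' = σ (℘[L] u)) (hP' : ℘'[L'] u' = σ (℘'[L] u))
    (hαu : α * u ∉ L.lattice) :
    σ α * u' ∉ L'.lattice ∧ ℘[L'] (σ α * u') = σ (℘[L] (α * u)) ∧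
      ℘'[L'] (σ α * u') = σ (℘'[L] (α * u)) := by
  obtain ⟨P, Q, h, hQ⟩ := L.exists_isMulPair hα hL
  have hu : u ∉ L.lattice := fun h ↦ hαu (hL u h)
  have h' := h.map σ
  rw [← h₂, ← h₃] at h'
  have ev (p : Polynomial ℂ) :
      (p.map (σ : ℂ →+* ℂ)).eval (℘[L'] u') = σ (p.eval (℘[L] u)) := by
    rw [hP]; exact Polynomial.eval_map_apply (σ : ℂ →+* ℂ) _
  have hσα : σ α ≠ 0 := by simpa using hα
  have hQ' : (Q.map (σ : ℂ →+* ℂ)).eval (℘[L'] u') ≠ 0 := by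
    rw [ev]; simpa using hQ u hαu
  refine ⟨h'.notMem hσα hu' hQ', ?_, ?_⟩
  · rw [h'.P_mul hσα hu' hQ', h.P_mul hα hu (hQ u hαu), ev, ev, map_div₀]
  · apply mul_left_cancel₀ hσα
    rw [h'.P'_mul hσα hu' hQ', ← map_mul, h.P'_mul hα hu (hQ u hαu), Polynomial.derivative_map,
      Polynomial.derivative_map, ev, ev, ev, ev, hP']
    simp

end PeriodPair

namespace ModularForm
open UpperHalfPlane ModularForm SlashInvariantForm MatrixGroups EisensteinSeries
  SlashInvariantFormClass OnePoint ModularFormClass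

theorem tendsto_E₄_atImInfty : Tendsto E₄ atImInfty (𝓝 1) := by
  have ha := ModularFormClass.analyticAt_cuspFunction_zero E₄ one_pos one_mem_strictPeriods_SL
  have hper := periodic_comp_ofComplex E₄ one_mem_strictPeriods_SL
  have h0 : cuspFunction 1 E₄ 0 = 1 := by
    rw [cuspFunction_apply_zero one_pos ha hper, ← qExpansion_coeff_zero one_pos ha hper]
    exact E_qExpansion_coeff_zero _ ⟨2, rfl⟩
  rw [← h0]
  exact (ha.continuousAt.tendsto.comp (qParam_tendsto_atImInfty one_pos)).congr fun τ ↦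
    SlashInvariantFormClass.eq_cuspFunction E₄ τ one_mem_strictPeriods_SL one_ne_zero

/-- Every complex number is the `j`-invariant of a point of the upper half plane. -/
theorem exists_E₄_cube_eq (c : ℂ) : ∃ z : ℍ, E₄ z ^ 3 = c * discriminant z := by
  by_contra! hne
  let f : ModularForm 𝒮ℒ 12 := ModularForm.mcast (by decide) (E₄.pow 3) -
    c • ((CuspForm.discriminant : CuspForm 𝒮ℒ 12) : ModularForm 𝒮ℒ 12)
  have hf (z : ℍ) : f z = E₄ z ^ 3 - c * discriminant z := by
    simp only [f, _root_.sub_apply, coe_mcast, coe_pow, Pi.pow_apply]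
    rfl
  have hf0 (z : ℍ) : f z ≠ 0 := by rw [hf]; exact sub_ne_zero.2 (hne z)
  have hlim : Tendsto (fun z ↦ discriminant z / f z) atImInfty (𝓝 0) := by
    have h0 : Tendsto discriminant atImInfty (𝓝 0) := discriminant_isZeroAtImInfty
    have := h0.div ((tendsto_E₄_atImInfty.pow 3).sub (h0.const_mul c)) (by norm_num)
    simpa [hf] using! this
  have hslash (γ : SL(2, ℤ)) : (fun z ↦ discriminant z / f z) ∣[(0 : ℤ)] γ =
      fun z ↦ discriminant z / f z := by
    have hγ : (γ : GL (Fin 2) ℝ) ∈ 𝒮ℒ := ⟨γ, rfl⟩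
    change (⇑CuspForm.discriminant / ⇑f) ∣[(12 - 12 : ℤ)] γ = ⇑CuspForm.discriminant / ⇑f
    simp_rw [div_slash_SL2, SL_slash, slash_action_eqn _ _ hγ]
  let g : ModularForm 𝒮ℒ 0 :=
    { toFun z := discriminant z / f z
      slash_action_eq' := fun _ ⟨γ, hγ⟩ ↦ hγ ▸ hslash γ
      holo' := CuspForm.discriminant.holo'.div f.holo' hf0
      bdd_at_cusps' {c} hc := by
        rw [Subgroup.IsArithmetic.isCusp_iff_isCusp_SL2Z] at hc
        rw [isBoundedAt_iff_forall_SL2Z hc]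
        intro γ _
        rw [hslash]
        exact hlim.isBigO_one ℝ }
  obtain ⟨d, hd⟩ := levelOne_weight_zero_const g
  have hd' (z : ℍ) : discriminant z / f z = d := congrFun hd z
  have : d = 0 := by
    simp only [hd'] at hlim
    exact tendsto_nhds_unique tendsto_const_nhds hlim
  exact div_ne_zero (discriminant_ne_zero I) (hf0 I) ((hd' I).trans this)

end ModularForm

namespace PeriodPair
open UpperHalfPlane EisensteinSeries

/-- Multiplication by `c` as a bijection between two lattices. -/
noncomputable def latticeEquivOfMul {L L' : PeriodPair} {c : ℂ} (hc : c ≠ 0)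
    (h : ∀ z, c * z ∈ L'.lattice ↔ z ∈ L.lattice) : L.lattice ≃ L'.lattice where
  toFun l := ⟨c * l, (h l).2 l.2⟩
  invFun l := ⟨c⁻¹ * l, (h _).1 (by rw [mul_inv_cancel_left₀ hc]; exact l.2)⟩
  left_inv l := by simp [hc]
  right_inv l := by simp [hc]

theorem G_eq_of_mul {L L' : PeriodPair} {c : ℂ} (hc : c ≠ 0)
    (h : ∀ z, c * z ∈ L'.lattice ↔ z ∈ L.lattice) (n : ℕ) : L'.G n = (c ^ n)⁻¹ * L.G n := by
  rw [G, G, ← (latticeEquivOfMul hc h).tsum_eq, ← tsum_mul_left]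
  refine tsum_congr fun l ↦ ?_
  simp [latticeEquivOfMul, mul_pow]
  ring

theorem g₂_eq_of_mul {L L' : PeriodPair} {c : ℂ} (hc : c ≠ 0)
    (h : ∀ z, c * z ∈ L'.lattice ↔ z ∈ L.lattice) : L'.g₂ = (c ^ 4)⁻¹ * L.g₂ := by
  rw [g₂, g₂, G_eq_of_mul hc h]; ring

theorem g₃_eq_of_mul {L L' : PeriodPair} {c : ℂ} (hc : c ≠ 0)
    (h : ∀ z, c * z ∈ L'.lattice ↔ z ∈ L.lattice) : L'.g₃ = (c ^ 6)⁻¹ * L.g₃ := by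
  rw [g₃, g₃, G_eq_of_mul hc h]; ring

theorem P_mul_of_mul {L L' : PeriodPair} {c : ℂ} (hc : c ≠ 0)
    (h : ∀ z, c * z ∈ L'.lattice ↔ z ∈ L.lattice) (z : ℂ) :
    ℘[L'] (c * z) = (c ^ 2)⁻¹ * ℘[L] z := by
  rw [weierstrassP, weierstrassP, ← (latticeEquivOfMul hc h).tsum_eq, ← tsum_mul_left]
  refine tsum_congr fun l ↦ ?_
  simp only [latticeEquivOfMul, Equiv.coe_fn_mk, ← mul_sub, mul_pow, one_div, mul_inv]

theorem P'_mul_of_mul {L L' : PeriodPair} {c : ℂ} (hc : c ≠ 0)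
    (h : ∀ z, c * z ∈ L'.lattice ↔ z ∈ L.lattice) (z : ℂ) :
    ℘'[L'] (c * z) = (c ^ 3)⁻¹ * ℘'[L] z := by
  rw [derivWeierstrassP, derivWeierstrassP, ← (latticeEquivOfMul hc h).tsum_eq, mul_neg,
    ← tsum_mul_left]
  congr 1
  refine tsum_congr fun l ↦ ?_
  simp only [latticeEquivOfMul, Equiv.coe_fn_mk, ← mul_sub, mul_pow, div_eq_mul_inv, mul_inv]
  ring

/-- The lattice `c L`. -/
noncomputable def smul (c : ℂ) (hc : c ≠ 0) (L : PeriodPair) : PeriodPair where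
  ω₁ := c * L.ω₁
  ω₂ := c * L.ω₂
  indep := by
    rw [LinearIndependent.pair_iff]
    intro s t hst
    refine LinearIndependent.pair_iff.1 L.indep s t (mul_left_cancel₀ hc ?_)
    simp only [Complex.real_smul] at hst ⊢
    linear_combination hst

theorem mul_mem_smul {c : ℂ} (hc : c ≠ 0) (L : PeriodPair) (z : ℂ) :
    c * z ∈ (L.smul c hc).lattice ↔ z ∈ L.lattice := by
  simp only [mem_lattice, smul]
  refine exists_congr fun m ↦ exists_congr fun n ↦ ?_
  rw [← mul_right_inj' hc (c := z)]
  ring_nf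

/-- The lattice spanned by `1` and `τ`. -/
noncomputable def ofUpperHalfPlane (τ : ℍ) : PeriodPair where
  ω₁ := 1
  ω₂ := τ
  indep := by
    rw [LinearIndependent.pair_iff]
    intro s t hst
    have him := congrArg Complex.im hst
    have hre := congrArg Complex.re hst
    have : t = 0 := by simpa [τ.im_ne_zero] using him
    subst this
    simpa using hre

theorem mem_ofUpperHalfPlane {τ : ℍ} {z : ℂ} :
    z ∈ (ofUpperHalfPlane τ).lattice ↔ ∃ m n : ℤ, m + n * (τ : ℂ) = z := by
  simp [mem_lattice, ofUpperHalfPlane]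

theorem G_ofUpperHalfPlane (τ : ℍ) {k : ℕ} (hk : 3 ≤ k) :
    (ofUpperHalfPlane τ).G k = 2 * riemannZeta k * ModularForm.E hk τ := by
  have h1 : (ofUpperHalfPlane τ).G k = ∑' v : Fin 2 → ℤ, eisSummand k v τ := by
    rw [G, ← (ofUpperHalfPlane τ).latticeEquivProd.symm.toEquiv.tsum_eq,
      ← ((finTwoArrowEquiv ℤ).trans (Equiv.prodComm ℤ ℤ)).tsum_eq]
    refine tsum_congr fun v ↦ ?_
    have := (ofUpperHalfPlane τ).latticeEquiv_symm_apply (v 1, v 0)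
    simp only [LinearEquiv.coe_toEquiv, Equiv.trans_apply, finTwoArrowEquiv_apply,
      Equiv.prodComm_apply, Prod.swap, eisSummand, zpow_neg,
      zpow_natCast]
    erw [this]
    simp [ofUpperHalfPlane, add_comm]
  have h2 : ModularForm.E hk τ = 1 / 2 * eisensteinSeries (N := 1) 0 k τ := rfl
  rw [h1, tsum_eisSummand_eq_riemannZeta_mul_eisensteinSeries hk, h2]
  ring

theorem g₂_ofUpperHalfPlane (τ : ℍ) :
    (ofUpperHalfPlane τ).g₂ = 4 / 3 * (Real.pi : ℂ) ^ 4 * ModularForm.E₄ τ := by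
  have h := riemannZeta_four
  rw [g₂, G_ofUpperHalfPlane τ (by norm_num)]
  push_cast
  rw [h]
  ring

theorem g₃_ofUpperHalfPlane (τ : ℍ) :
    (ofUpperHalfPlane τ).g₃ = 8 / 27 * (Real.pi : ℂ) ^ 6 * ModularForm.E₆ τ := by
  have h := riemannZeta_two_mul_nat (k := 3) (by norm_num)
  have hb : bernoulli 6 = 1 / 42 := by decide +kernel
  norm_num [hb, Nat.factorial] at h
  rw [g₃, G_ofUpperHalfPlane τ (by norm_num)]
  push_cast
  rw [h]
  ring

theorem g₂_cube_sub (τ : ℍ) : (ofUpperHalfPlane τ).g₂ ^ 3 - 27 * (ofUpperHalfPlane τ).g₃ ^ 2 =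
    4096 * (Real.pi : ℂ) ^ 12 * ModularForm.discriminant τ := by
  rw [g₂_ofUpperHalfPlane, g₃_ofUpperHalfPlane, ModularForm.discriminant_eq_E₄_cube_sub_E₆_sq]
  ring

/-- Uniformization: every nonsingular Weierstrass equation comes from a lattice. -/
theorem exists_g₂_eq_g₃_eq {A B : ℂ} (h : A ^ 3 - 27 * B ^ 2 ≠ 0) :
    ∃ L : PeriodPair, L.g₂ = A ∧ L.g₃ = B := by
  obtain ⟨τ, hτ⟩ := ModularForm.exists_E₄_cube_eq (1728 * A ^ 3 / (A ^ 3 - 27 * B ^ 2))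
  have hΔ := g₂_cube_sub τ
  have h₂ := g₂_ofUpperHalfPlane τ
  have hpi : (Real.pi : ℂ) ≠ 0 := by exact_mod_cast Real.pi_ne_zero
  have hne : (ofUpperHalfPlane τ).g₂ ^ 3 - 27 * (ofUpperHalfPlane τ).g₃ ^ 2 ≠ 0 := by
    rw [hΔ]
    have := ModularForm.discriminant_ne_zero τ
    exact mul_ne_zero (mul_ne_zero (by norm_num) (pow_ne_zero _ hpi)) this
  set a := (ofUpperHalfPlane τ).g₂
  set b := (ofUpperHalfPlane τ).g₃
  have hrel : a ^ 3 * B ^ 2 = A ^ 3 * b ^ 2 := by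
    have e1 : a ^ 3 = 64 / 27 * (Real.pi : ℂ) ^ 12 * ModularForm.E₄ τ ^ 3 := by rw [h₂]; ring
    have e2 : a ^ 3 * (A ^ 3 - 27 * B ^ 2) = A ^ 3 * (a ^ 3 - 27 * b ^ 2) := by
      rw [hΔ, e1, hτ]
      field_simp
      ring
    linear_combination (-1 / 27) * e2
  suffices ∃ c : ℂ, c ≠ 0 ∧ c ^ 4 * a = A ∧ c ^ 6 * b = B by
    obtain ⟨c, hc, e1, e2⟩ := this
    have hs := mul_mem_smul (inv_ne_zero hc) (ofUpperHalfPlane τ)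
    refine ⟨(ofUpperHalfPlane τ).smul c⁻¹ (inv_ne_zero hc), ?_, ?_⟩
    · rw [g₂_eq_of_mul (inv_ne_zero hc) hs, inv_pow, inv_inv, e1]
    · rw [g₃_eq_of_mul (inv_ne_zero hc) hs, inv_pow, inv_inv, e2]
  rcases eq_or_ne A 0 with rfl | hA
  · have hB : B ≠ 0 := by rintro rfl; simp at h
    have ha : a = 0 := by simpa [hB] using hrel
    have hb : b ≠ 0 := by intro hb; simp [ha, hb] at hne
    obtain ⟨c, hc⟩ := IsAlgClosed.exists_pow_nat_eq (B / b) (n := 6) (by norm_num)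
    refine ⟨c, ?_, by simp [ha], by rw [hc, div_mul_cancel₀ _ hb]⟩
    rintro rfl
    exact div_ne_zero hB hb (by simpa using hc.symm)
  rcases eq_or_ne B 0 with rfl | hB
  · have hb : b = 0 := by simpa [hA] using hrel.symm
    have ha : a ≠ 0 := by intro ha; simp [ha, hb] at hne
    obtain ⟨c, hc⟩ := IsAlgClosed.exists_pow_nat_eq (A / a) (n := 4) (by norm_num)
    refine ⟨c, ?_, by rw [hc, div_mul_cancel₀ _ ha], by simp [hb]⟩
    rintro rfl
    exact div_ne_zero hA ha (by simpa using hc.symm)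
  have ha : a ≠ 0 := by
    intro ha
    have hb : b = 0 := by simpa [ha, hA] using hrel.symm
    simp [ha, hb] at hne
  have hb : b ≠ 0 := by
    intro hb
    simp [hb, hB, ha] at hrel
  obtain ⟨c, hc⟩ := IsAlgClosed.exists_pow_nat_eq (B * a / (A * b)) (n := 2) (by norm_num)
  refine ⟨c, ?_, ?_, ?_⟩
  · rintro rfl
    exact div_ne_zero (mul_ne_zero hB ha) (mul_ne_zero hA hb) (by simpa using hc.symm)
  · rw [show c ^ 4 = (c ^ 2) ^ 2 by ring, hc]
    field_simp
    linear_combination hrel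
  · rw [show c ^ 6 = (c ^ 2) ^ 3 by ring, hc]
    field_simp
    linear_combination hrel

end PeriodPair

namespace IsAlgClosed

/-- An automorphism of a polynomial ring on a transcendence basis extends to the whole field. -/
theorem exists_ringEquiv_aeval {F K ι : Type*} [Field F] [Field K] [Algebra F K] [IsAlgClosed K]
    {v : ι → K} (hv : IsTranscendenceBasis F v) (e : MvPolynomial ι F ≃+* MvPolynomial ι F) :
    ∃ σ : K ≃+* K, ∀ p, σ (MvPolynomial.aeval v p) = MvPolynomial.aeval v (e p) := by
  let := isAlgClosure_of_transcendence_basis v hv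
  let e' : Algebra.adjoin F (Set.range v) ≃+* Algebra.adjoin F (Set.range v) :=
    (hv.1.aevalEquiv.symm.toRingEquiv.trans e).trans hv.1.aevalEquiv.toRingEquiv
  refine ⟨IsAlgClosure.equivOfEquiv K K e', fun p => ?_⟩
  have h1 : ∀ q, algebraMap (Algebra.adjoin F (Set.range v)) K (hv.1.aevalEquiv q)
      = MvPolynomial.aeval v q := fun q => hv.1.algebraMap_aevalEquiv q
  rw [← h1, IsAlgClosure.equivOfEquiv_algebraMap, ← h1]
  simp [e']

theorem mem_range_algebraMap_of_fixed {F K : Type*} [Field F] [Field K] [Algebra F K]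
    [IsAlgClosed K] [CharZero F] {x : K} (hx : ∀ σ : K ≃+* K, σ x = x) :
    x ∈ Set.range (algebraMap F K) := by
  let A := algebraicClosure F K
  have : CharZero K := charZero_of_injective_algebraMap (algebraMap F K).injective
  by_cases hA : x ∈ A
  · obtain ⟨s, hs⟩ := exists_isTranscendenceBasis A K
    have : IsAlgClosure F A := inferInstance
    have : Normal F A := IsAlgClosure.normal F A
    have : IsGalois F A := ⟨⟩
    have hb : (⟨x, hA⟩ : A) ∈ (⊥ : IntermediateField F A) := by
      rw [InfiniteGalois.mem_bot_iff_fixed]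
      intro τ
      obtain ⟨σ, hσ⟩ := exists_ringEquiv_aeval hs (MvPolynomial.mapEquiv s τ.toRingEquiv)
      have := hσ (MvPolynomial.C ⟨x, hA⟩)
      simp only [MvPolynomial.mapEquiv_apply, MvPolynomial.map_C, MvPolynomial.aeval_C] at this
      apply Subtype.ext
      have h2 : σ x = (τ ⟨x, hA⟩ : A) := this
      rw [← h2, hx]
    obtain ⟨y, hy⟩ := IntermediateField.mem_bot.1 hb
    exact ⟨y, congrArg Subtype.val hy⟩
  · exfalso
    have ht : Transcendental F x := by rwa [mem_algebraicClosure_iff] at hA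
    have hi : AlgebraicIndepOn F id ({x} : Set K) := by
      exact (algebraicIndependent_singleton_iff (ι := ({x} : Set K)) ⟨x, rfl⟩).2 ht
    obtain ⟨s, hs, hb⟩ := exists_isTranscendenceBasis_superset hi
    let f : MvPolynomial s F →ₐ[F] MvPolynomial s F := MvPolynomial.aeval fun i => -MvPolynomial.X i
    have hf : f.comp f = AlgHom.id F _ := by ext; simp [f]
    obtain ⟨σ, hσ⟩ := exists_ringEquiv_aeval hb (AlgEquiv.ofAlgHom f f hf hf).toRingEquiv
    have := hσ (MvPolynomial.X ⟨x, hs rfl⟩)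
    simp [f, hx] at this
    have h0 : x = 0 := by
      have h2 : (2 : K) * x = 0 := by linear_combination this
      simpa using h2
    exact hA (h0 ▸ zero_mem A)

end IsAlgClosed

local notation "Λ" => PeriodPair.ofUpperHalfPlane

namespace PeriodPair
open UpperHalfPlane

/-- The lattice spanned by `1` and `τ` is an order, and every lattice which is stable under
multiplication by `τ` is homothetic to it. -/
structure IsClassOne (τ : ℍ) (m : ℤ) : Prop where
  sq : (τ : ℂ) ^ 2 = τ - m
  exists_mul : ∀ L : PeriodPair, (∀ l ∈ L.lattice, (τ : ℂ) * l ∈ L.lattice) →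
    ∃ c : ℂ, c ≠ 0 ∧ ∀ z, c * z ∈ L.lattice ↔ z ∈ (Λ τ).lattice

/-- How an automorphism `σ` of `ℂ` acts on the invariants and the division values of the
Weierstrass functions of the order spanned by `1` and `τ`. -/
structure IsTransport (τ : ℍ) (σ : ℂ ≃+* ℂ) (c : ℂ) : Prop where
  ne_zero : c ≠ 0
  g₂_eq : σ (Λ τ).g₂ = (c ^ 4)⁻¹ * (Λ τ).g₂
  g₃_eq : σ (Λ τ).g₃ = (c ^ 6)⁻¹ * (Λ τ).g₃
  exists_point : ∀ u ∉ (Λ τ).lattice, ∃ w, ∀ α ∈ (Λ τ).lattice,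
    (α * u ∈ (Λ τ).lattice ↔ σ α * w ∈ (Λ τ).lattice) ∧
    (α * u ∉ (Λ τ).lattice → σ (℘[Λ τ] (α * u)) = (c ^ 2)⁻¹ * ℘[Λ τ] (σ α * w) ∧
      σ (℘'[Λ τ] (α * u)) = (c ^ 3)⁻¹ * ℘'[Λ τ] (σ α * w))

namespace IsClassOne
variable {τ : ℍ} {m : ℤ} (h : IsClassOne τ m)
include h

theorem mul_mem {α l : ℂ} (hα : α ∈ (Λ τ).lattice) (hl : l ∈ (Λ τ).lattice) :
    α * l ∈ (Λ τ).lattice := by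
  rw [mem_ofUpperHalfPlane] at *
  obtain ⟨a, b, rfl⟩ := hα
  obtain ⟨c, d, rfl⟩ := hl
  refine ⟨a * c - b * d * m, a * d + b * c + b * d, ?_⟩
  push_cast
  linear_combination -(b : ℂ) * d * h.sq

theorem map_eq (σ : ℂ ≃+* ℂ) : σ τ = τ ∨ σ τ = 1 - τ := by
  have h1 : σ τ ^ 2 = σ τ - m := by rw [← map_pow, h.sq]; simp
  have h2 : (σ τ - τ) * (σ τ - (1 - τ)) = 0 := by linear_combination h1 - h.sq
  simpa [sub_eq_zero] using h2

theorem exists_isTransport (σ : ℂ ≃+* ℂ) : ∃ c : ℂ, IsTransport τ σ c := by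
  have hΔ : σ (Λ τ).g₂ ^ 3 - 27 * σ (Λ τ).g₃ ^ 2 ≠ 0 := by
    have : (Λ τ).g₂ ^ 3 - 27 * (Λ τ).g₃ ^ 2 ≠ 0 := by
      rw [g₂_cube_sub]
      simpa using ModularForm.discriminant_ne_zero τ
    simpa [show σ 27 = 27 from map_ofNat σ 27] using (map_ne_zero σ).2 this
  obtain ⟨L', h₂, h₃⟩ := exists_g₂_eq_g₃_eq hΔ
  have hτ : ∀ l ∈ L'.lattice, (τ : ℂ) * l ∈ L'.lattice := by
    intro l hl
    have hm := map_mul_mem σ h₂ h₃ τ.ne_zero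
      (fun l hl ↦ h.mul_mem (mem_ofUpperHalfPlane.2 ⟨0, 1, by simp⟩) hl) hl
    rcases h.map_eq σ with e | e <;> rw [e] at hm
    · exact hm
    · simpa [sub_mul] using sub_mem hl hm
  obtain ⟨c, hc, hL⟩ := h.exists_mul L' hτ
  refine ⟨c, hc, ?_, ?_, fun u hu ↦ ?_⟩
  · rw [← h₂, g₂_eq_of_mul hc hL]
  · rw [← h₃, g₃_eq_of_mul hc hL]
  obtain ⟨u', hu', hP, hP'⟩ := L'.exists_P_eq_P'_eq (x := σ (℘[Λ τ] u)) (y := σ (℘'[Λ τ] u))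
    (by rw [h₂, h₃, ← map_pow, derivWeierstrassP_sq _ _ hu]; simp [show σ 4 = 4 from map_ofNat σ 4])
  have hw (α : ℂ) : σ α * u' = c * (σ α * (c⁻¹ * u')) := by field_simp
  refine ⟨c⁻¹ * u', fun α hα ↦ ?_⟩
  rcases eq_or_ne α 0 with rfl | hα0
  · simp
  have key := map_P_mul σ h₂ h₃ hα0 (fun l hl ↦ h.mul_mem hα hl) hu' hP hP'
  have hback : σ α * u' ∉ L'.lattice → α * u ∉ (Λ τ).lattice := by
    intro hn
    have := (map_P_mul (L := L') (L' := Λ τ) σ.symm (by simp [h₂]) (by simp [h₃])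
      (α := σ α) (by simpa) (fun l hl ↦ map_mul_mem σ h₂ h₃ hα0
      (fun l hl ↦ h.mul_mem hα hl) hl) hu (by simp [hP]) (by simp [hP']) hn).1
    simpa using this
  rw [← hL (σ α * (c⁻¹ * u')), ← hw]
  refine ⟨⟨fun h1 ↦ by_contra fun h2 ↦ hback h2 h1, fun h1 ↦ by_contra fun h2 ↦ (key h2).1 h1⟩,
    fun hn ↦ ?_⟩
  obtain ⟨-, e1, e2⟩ := key hn
  rw [← e1, ← e2, hw, P_mul_of_mul hc hL, P'_mul_of_mul hc hL]
  exact ⟨rfl, rfl⟩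

end IsClassOne
end PeriodPair

/-- The resolvent cubic of the three-division polynomial. -/
theorem cube_of_three_division {F : Type*} [Field F] [CharZero F] {a b x₀ x₁ x₂ x₃ : F}
    (h₀ : 3 * x₀ ^ 4 + 6 * a * x₀ ^ 2 + 12 * b * x₀ - a ^ 2 = 0)
    (h₁ : 3 * x₁ ^ 4 + 6 * a * x₁ ^ 2 + 12 * b * x₁ - a ^ 2 = 0)
    (h₂ : 3 * x₂ ^ 4 + 6 * a * x₂ ^ 2 + 12 * b * x₂ - a ^ 2 = 0)
    (h₃ : 3 * x₃ ^ 4 + 6 * a * x₃ ^ 2 + 12 * b * x₃ - a ^ 2 = 0)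
    (d₀₁ : x₀ ≠ x₁) (d₀₂ : x₀ ≠ x₂) (d₀₃ : x₀ ≠ x₃) (d₁₂ : x₁ ≠ x₂) (d₁₃ : x₁ ≠ x₃)
    (d₂₃ : x₂ ≠ x₃) :
    (2 * a - 3 * (x₀ * x₂ + x₁ * x₃)) ^ 3 = -16 * (4 * a ^ 3 + 27 * b ^ 2) := by
  have e₁ : 3 * (x₀ + x₁) * (x₀ ^ 2 + x₁ ^ 2) + 6 * a * (x₀ + x₁) + 12 * b = 0 :=
    mul_left_cancel₀ (sub_ne_zero.2 d₀₁) (by linear_combination h₀ - h₁)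
  have e₂ : 3 * (x₀ + x₂) * (x₀ ^ 2 + x₂ ^ 2) + 6 * a * (x₀ + x₂) + 12 * b = 0 :=
    mul_left_cancel₀ (sub_ne_zero.2 d₀₂) (by linear_combination h₀ - h₂)
  have e₃ : 3 * (x₀ + x₃) * (x₀ ^ 2 + x₃ ^ 2) + 6 * a * (x₀ + x₃) + 12 * b = 0 :=
    mul_left_cancel₀ (sub_ne_zero.2 d₀₃) (by linear_combination h₀ - h₃)
  have f₂ : 3 * (x₀ ^ 2 + x₁ ^ 2 + x₂ ^ 2 + x₀ * x₁ + x₀ * x₂ + x₁ * x₂) + 6 * a = 0 :=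
    mul_left_cancel₀ (sub_ne_zero.2 d₁₂) (by linear_combination e₁ - e₂)
  have f₃ : 3 * (x₀ ^ 2 + x₁ ^ 2 + x₃ ^ 2 + x₀ * x₁ + x₀ * x₃ + x₁ * x₃) + 6 * a = 0 :=
    mul_left_cancel₀ (sub_ne_zero.2 d₁₃) (by linear_combination e₁ - e₃)
  have g : x₀ + x₁ + x₂ + x₃ = 0 :=
    mul_left_cancel₀ (sub_ne_zero.2 d₂₃) (by linear_combination (f₂ - f₃) / 3)
  obtain rfl : x₃ = -(x₀ + x₁ + x₂) := by linear_combination g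
  obtain rfl : a = -(x₀ ^ 2 + x₁ ^ 2 + x₂ ^ 2 + x₀ * x₁ + x₀ * x₂ + x₁ * x₂) / 2 := by
    linear_combination f₂ / 6
  obtain rfl : b = (x₀ + x₁) * (x₀ + x₂) * (x₁ + x₂) / 4 := by
    linear_combination e₁ / 12
  linear_combination 36 * (x₀ ^ 2 + x₁ ^ 2 + x₂ ^ 2 + x₀ * x₁ + x₀ * x₂ + x₁ * x₂ +
    (x₀ * x₂ - x₁ * (x₀ + x₁ + x₂))) * h₀

namespace PeriodPair
open UpperHalfPlane

theorem intCast_add_mul_eq_zero {τ : ℍ} {a b : ℤ} (h : (a : ℂ) + b * τ = 0) : a = 0 ∧ b = 0 := by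
  have him := congrArg Complex.im h
  have hre := congrArg Complex.re h
  have hb : b = 0 := by simpa [τ.im_ne_zero] using him
  subst hb
  exact ⟨by simpa using hre, rfl⟩

/-- Division points of the lattice spanned by `1` and `τ`. -/
theorem div_mem_ofUpperHalfPlane {τ : ℍ} {N : ℤ} (hN : N ≠ 0) {a b : ℤ} {z : ℂ}
    (hz : N * z = a + b * (τ : ℂ)) : z ∈ (Λ τ).lattice ↔ N ∣ a ∧ N ∣ b := by
  have hN' : (N : ℂ) ≠ 0 := by exact_mod_cast hN
  rw [mem_ofUpperHalfPlane]
  constructor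
  · rintro ⟨c, d, rfl⟩
    have := intCast_add_mul_eq_zero (τ := τ) (a := N * c - a) (b := N * d - b)
      (by push_cast; linear_combination hz)
    exact ⟨⟨c, by linarith [this.1]⟩, ⟨d, by linarith [this.2]⟩⟩
  · rintro ⟨⟨c, rfl⟩, ⟨d, rfl⟩⟩
    refine ⟨c, d, mul_left_cancel₀ hN' ?_⟩
    rw [hz]; push_cast; ring

theorem halfTriple_ofUpperHalfPlane (τ : ℍ) :
    (Λ τ).HalfTriple (1 / 2) (τ / 2) ((1 + τ) / 2) := by
  have m₁ : ∀ {a b : ℤ} {z : ℂ}, (2 : ℤ) * z = a + b * (τ : ℂ) →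
      (z ∈ (Λ τ).lattice ↔ 2 ∣ a ∧ 2 ∣ b) := div_mem_ofUpperHalfPlane two_ne_zero
  refine ⟨?_, ?_, ?_, mem_ofUpperHalfPlane.2 ⟨1, 0, ?_⟩, mem_ofUpperHalfPlane.2 ⟨0, 1, ?_⟩,
    mem_ofUpperHalfPlane.2 ⟨1, 1, ?_⟩, mem_ofUpperHalfPlane.2 ⟨1, 1, ?_⟩⟩
  · rw [m₁ (a := 1) (b := 0) (by push_cast; ring)]; decide
  · rw [m₁ (a := 0) (b := 1) (by push_cast; ring)]; decide
  · rw [m₁ (a := 1) (b := 1) (by push_cast; ring)]; decide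
  all_goals push_cast; ring

variable {L : PeriodPair}

theorem P_eq_of_sub_mem {a b : ℂ} (h : a - b ∈ L.lattice) : ℘[L] a = ℘[L] b := by
  have := L.P_add h b
  rwa [add_sub_cancel] at this

theorem P_eq_of_add_mem {a b : ℂ} (h : a + b ∈ L.lattice) : ℘[L] a = ℘[L] b := by
  rw [← L.weierstrassP_neg b]
  exact P_eq_of_sub_mem (by simpa using h)

theorem HalfTriple.three_division {h₁ h₂ h₃ u : ℂ} (H : L.HalfTriple h₁ h₂ h₃)
    (hu : u ∉ L.lattice) (hu₃ : 3 * u ∈ L.lattice) :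
    3 * ℘[L] u ^ 4 + 6 * (-L.g₂ / 4) * ℘[L] u ^ 2 + 12 * (-L.g₃ / 4) * ℘[L] u
      - (-L.g₂ / 4) ^ 2 = 0 := by
  have h2 : 2 * u ∉ L.lattice := fun h ↦ hu (by
    have := L.lattice.sub_mem hu₃ h
    convert! this using 1; ring)
  have e : ℘[L] (2 * u) = ℘[L] u := P_eq_of_add_mem (by convert! hu₃ using 1; ring)
  have h := H.P_two_mul_sub h2
  rw [e, halfRoot, div_pow, eq_div_iff (pow_ne_zero 2 (L.P'_ne_zero h2)),
    L.derivWeierstrassP_sq u hu] at h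
  have r1 := L.derivWeierstrassP_sq h₁ H.notMem₁
  rw [H.P'_eq_zero] at r1
  linear_combination h - (2 * ℘[L] u + ℘[L] h₁) * r1

/-- A cube root of the discriminant, as a modular function of level three. -/
noncomputable def cubeRoot (L : PeriodPair) (τ u : ℂ) : ℂ :=
  -L.g₂ / 2 - 3 * (℘[L] u * ℘[L] ((τ + 1) * u) + ℘[L] (τ * u) * ℘[L] ((τ - 1) * u))

theorem cubeRoot_congr {τ u v : ℂ} (hτ : ∀ l ∈ L.lattice, τ * l ∈ L.lattice)
    (h : u - v ∈ L.lattice) : L.cubeRoot τ u = L.cubeRoot τ v := by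
  have h1 := hτ _ h
  rw [cubeRoot, cubeRoot, P_eq_of_sub_mem h,
    P_eq_of_sub_mem (show (τ + 1) * u - (τ + 1) * v ∈ L.lattice by
      convert! L.lattice.add_mem h1 h using 1; ring),
    P_eq_of_sub_mem (show τ * u - τ * v ∈ L.lattice by convert! h1 using 1; ring),
    P_eq_of_sub_mem (show (τ - 1) * u - (τ - 1) * v ∈ L.lattice by
      convert! L.lattice.sub_mem h1 h using 1; ring)]

theorem cubeRoot_neg (τ u : ℂ) : L.cubeRoot τ (-u) = L.cubeRoot τ u := by
  simp [cubeRoot]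

/-- Multiplication by `τ` permutes the three-division values cyclically. -/
theorem cubeRoot_mul {τ u : ℂ} (hτ : ∀ l ∈ L.lattice, τ * l ∈ L.lattice)
    (h : (τ ^ 2 - τ - 1) * u ∈ L.lattice) (h₃ : 3 * u ∈ L.lattice) :
    L.cubeRoot τ (τ * u) = L.cubeRoot τ u := by
  have h1 := hτ _ h₃
  rw [cubeRoot, cubeRoot,
    P_eq_of_add_mem (a := (τ + 1) * (τ * u)) (b := (τ - 1) * u) (by
      convert! L.lattice.add_mem h h1 using 1; ring),
    P_eq_of_sub_mem (a := τ * (τ * u)) (b := (τ + 1) * u) (by convert! h using 1; ring),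
    P_eq_of_sub_mem (a := (τ - 1) * (τ * u)) (b := u) (by convert! h using 1; ring)]
  ring

theorem IsClassOne.cubeRoot_eq {τ : ℍ} {m : ℤ} (h : IsClassOne τ m) (hm : m % 3 = 2) {w : ℂ}
    (hw : 3 * w ∈ (Λ τ).lattice) (hw' : w ∉ (Λ τ).lattice) :
    (Λ τ).cubeRoot τ w = (Λ τ).cubeRoot τ (1 / 3) := by
  have hτ : ∀ l ∈ (Λ τ).lattice, (τ : ℂ) * l ∈ (Λ τ).lattice :=
    fun l hl ↦ h.mul_mem (mem_ofUpperHalfPlane.2 ⟨0, 1, by simp⟩) hl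
  have hmul {u : ℂ} (h₃ : 3 * u ∈ (Λ τ).lattice) :
      (Λ τ).cubeRoot τ (τ * u) = (Λ τ).cubeRoot τ u := by
    refine cubeRoot_mul hτ ?_ h₃
    have := h.mul_mem (mem_ofUpperHalfPlane.2 ⟨-(m + 1) / 3, 0, rfl⟩) h₃
    convert! this using 1
    have h3 : 3 * (-(m + 1) / 3) = -(m + 1) := by omega
    have h3' : (3 : ℂ) * ((-(m + 1) / 3 : ℤ) : ℂ) = -(m + 1) := by exact_mod_cast h3
    linear_combination u * h.sq - u * h3'
  have key {u : ℂ} {c d : ℤ} (hu : 3 * u = c + d * (τ : ℂ)) (hcd : 3 ∣ c ∧ 3 ∣ d) :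
      u ∈ (Λ τ).lattice := (div_mem_ofUpperHalfPlane three_ne_zero (by simpa using hu)).2 hcd
  have h1 : 3 * (1 / 3 : ℂ) ∈ (Λ τ).lattice := mem_ofUpperHalfPlane.2 ⟨1, 0, by norm_num⟩
  have e1 := hmul h1
  have h2 : 3 * (τ * (1 / 3 : ℂ)) ∈ (Λ τ).lattice := by convert! hτ _ h1 using 1; ring
  have e2 := (hmul h2).trans e1
  have h3 : 3 * (τ * (τ * (1 / 3 : ℂ))) ∈ (Λ τ).lattice := by convert! hτ _ h2 using 1; ring
  have e3 := (hmul h3).trans e2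
  have n1 := (cubeRoot_neg (L := Λ τ) τ _).trans e1
  have n2 := (cubeRoot_neg (L := Λ τ) τ _).trans e2
  have n3 := (cubeRoot_neg (L := Λ τ) τ _).trans e3
  have n0 := cubeRoot_neg (L := Λ τ) τ (1 / 3)
  obtain ⟨a, b, hab⟩ := mem_ofUpperHalfPlane.1 hw
  have h00 : ¬ (3 ∣ a ∧ 3 ∣ b) := fun hh ↦ hw' (key hab.symm hh)
  have ha : a % 3 = 0 ∨ a % 3 = 1 ∨ a % 3 = 2 := by omega
  have hb : b % 3 = 0 ∨ b % 3 = 1 ∨ b % 3 = 2 := by omega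
  rcases ha with ha | ha | ha <;> rcases hb with hb | hb | hb
  · omega
  · rw [← e1]
    exact cubeRoot_congr hτ (key (c := a) (d := b - 1)
      (by push_cast; linear_combination -hab) (by omega))
  · rw [← n1]
    exact cubeRoot_congr hτ (key (c := a) (d := b + 1)
      (by push_cast; linear_combination -hab) (by omega))
  · exact cubeRoot_congr hτ (key (c := a - 1) (d := b)
      (by push_cast; linear_combination -hab) (by omega))
  · rw [← e2]
    exact cubeRoot_congr hτ (key (c := a + m) (d := b - 1)
      (by push_cast; linear_combination -hab - h.sq) (by omega))
  · rw [← e3]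
    exact cubeRoot_congr hτ (key (c := a + m) (d := b - 1 + m)
      (by push_cast; linear_combination -hab - (τ + 1) * h.sq) (by omega))
  · rw [← n0]
    exact cubeRoot_congr hτ (key (c := a + 1) (d := b)
      (by push_cast; linear_combination -hab) (by omega))
  · rw [← n3]
    exact cubeRoot_congr hτ (key (c := a - m) (d := b + 1 - m)
      (by push_cast; linear_combination -hab + (τ + 1) * h.sq) (by omega))
  · rw [← n2]
    exact cubeRoot_congr hτ (key (c := a - m) (d := b + 1)
      (by push_cast; linear_combination -hab + h.sq) (by omega))

theorem cubeRoot_pow (τ : ℍ) :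
    (Λ τ).cubeRoot τ (1 / 3) ^ 3 = (Λ τ).g₂ ^ 3 - 27 * (Λ τ).g₃ ^ 2 := by
  have H := halfTriple_ofUpperHalfPlane τ
  have key {u : ℂ} {c d : ℤ} (hu : 3 * u = c + d * (τ : ℂ)) :
      u ∈ (Λ τ).lattice ↔ 3 ∣ c ∧ 3 ∣ d :=
    div_mem_ofUpperHalfPlane three_ne_zero (by simpa using hu)
  have hr {u : ℂ} (c d : ℤ) (hu : 3 * u = c + d * (τ : ℂ)) (hcd : ¬ (3 ∣ c ∧ 3 ∣ d)) :=
    H.three_division (mt (key hu).1 hcd) (mem_ofUpperHalfPlane.2 ⟨c, d, hu.symm⟩)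
  have hd {u v : ℂ} (c d c' d' : ℤ) (hu : 3 * u = c + d * (τ : ℂ)) (hv : 3 * v = c' + d' * (τ : ℂ))
      (h1 : ¬ (3 ∣ c ∧ 3 ∣ d)) (h2 : ¬ (3 ∣ c' ∧ 3 ∣ d')) (h3 : ¬ (3 ∣ c - c' ∧ 3 ∣ d - d'))
      (h4 : ¬ (3 ∣ c + c' ∧ 3 ∣ d + d')) : ℘[Λ τ] u ≠ ℘[Λ τ] v := by
    rw [Ne, (Λ τ).P_eq_iff (mt (key hu).1 h1) (mt (key hv).1 h2),
      key (c := c - c') (d := d - d') (by push_cast; linear_combination hu - hv),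
      key (c := c + c') (d := d + d') (by push_cast; linear_combination hu + hv)]
    tauto
  have w0 : 3 * (1 / 3 : ℂ) = (1 : ℤ) + (0 : ℤ) * (τ : ℂ) := by norm_num
  have w1 : 3 * (τ * (1 / 3 : ℂ)) = (0 : ℤ) + (1 : ℤ) * (τ : ℂ) := by push_cast; ring
  have w2 : 3 * ((τ + 1) * (1 / 3 : ℂ)) = (1 : ℤ) + (1 : ℤ) * (τ : ℂ) := by push_cast; ring
  have w3 : 3 * ((τ - 1) * (1 / 3 : ℂ)) = (-1 : ℤ) + (1 : ℤ) * (τ : ℂ) := by push_cast; ring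
  have := cube_of_three_division (hr _ _ w0 (by decide)) (hr _ _ w1 (by decide))
    (hr _ _ w2 (by decide)) (hr _ _ w3 (by decide))
    (hd _ _ _ _ w0 w1 (by decide) (by decide) (by decide) (by decide))
    (hd _ _ _ _ w0 w2 (by decide) (by decide) (by decide) (by decide))
    (hd _ _ _ _ w0 w3 (by decide) (by decide) (by decide) (by decide))
    (hd _ _ _ _ w1 w2 (by decide) (by decide) (by decide) (by decide))
    (hd _ _ _ _ w1 w3 (by decide) (by decide) (by decide) (by decide))
    (hd _ _ _ _ w2 w3 (by decide) (by decide) (by decide) (by decide))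
  rw [cubeRoot]
  linear_combination this

theorem IsClassOne.map_cubeRoot {τ : ℍ} {m : ℤ} (h : IsClassOne τ m) (hm : m % 3 = 2)
    {σ : ℂ ≃+* ℂ} {c : ℂ} (hσ : IsTransport τ σ c) :
    σ ((Λ τ).cubeRoot τ (1 / 3)) = (c ^ 4)⁻¹ * (Λ τ).cubeRoot τ (1 / 3) := by
  have key {u : ℂ} {c d : ℤ} (hu : 3 * u = c + d * (τ : ℂ)) :
      u ∈ (Λ τ).lattice ↔ 3 ∣ c ∧ 3 ∣ d :=
    div_mem_ofUpperHalfPlane three_ne_zero (by simpa using hu)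
  obtain ⟨w, hw⟩ := hσ.exists_point (1 / 3) (by
    rw [key (c := 1) (d := 0) (by norm_num)]; decide)
  have i1 : (1 : ℂ) ∈ (Λ τ).lattice := mem_ofUpperHalfPlane.2 ⟨1, 0, by simp⟩
  have iτ : (τ : ℂ) ∈ (Λ τ).lattice := mem_ofUpperHalfPlane.2 ⟨0, 1, by simp⟩
  have i3 : (3 : ℂ) ∈ (Λ τ).lattice := mem_ofUpperHalfPlane.2 ⟨3, 0, by simp⟩
  have w1 := hw 1 i1
  have w2 := hw τ iτ
  have w3 := hw (τ + 1) (add_mem iτ i1)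
  have w4 := hw (τ - 1) (sub_mem iτ i1)
  have w5 := hw 3 i3
  rw [key (c := 1) (d := 0) (by push_cast; ring)] at w1
  rw [key (c := 0) (d := 1) (by push_cast; ring)] at w2
  rw [key (c := 1) (d := 1) (by push_cast; ring)] at w3
  rw [key (c := -1) (d := 1) (by push_cast; ring)] at w4
  rw [key (c := 3) (d := 0) (by push_cast; ring), show σ 3 = 3 from map_ofNat σ 3] at w5
  have hw3 : 3 * w ∈ (Λ τ).lattice := w5.1.1 (by decide)
  have hw0 : w ∉ (Λ τ).lattice := by
    have := (not_congr w1.1).1 (by decide)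
    simpa using this
  conv_rhs => rw [← h.cubeRoot_eq hm hw3 hw0]
  rw [cubeRoot, cubeRoot]
  have v1 := (w1.2 (by decide)).1
  have v2 := (w2.2 (by decide)).1
  have v3 := (w3.2 (by decide)).1
  have v4 := (w4.2 (by decide)).1
  rw [one_mul, map_one, one_mul] at v1
  simp only [map_sub, map_mul, map_neg, map_div₀, map_add, v1, v2, v3, v4, hσ.g₂_eq, map_one,
    show σ 3 = 3 from map_ofNat σ 3, show σ 2 = 2 from map_ofNat σ 2]
  have hc := hσ.ne_zero
  rcases h.map_eq σ with e | e <;> rw [e]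
  · field_simp
  · rw [P_eq_of_add_mem (a := (1 - τ + 1) * w) (b := (τ + 1) * w) (by convert! hw3 using 1; ring),
      show (1 - τ - 1) * w = -(τ * w) by ring, weierstrassP_neg,
      show (1 - τ) * w = -((τ - 1) * w) by ring, weierstrassP_neg]
    field_simp

end PeriodPair

/-- The slopes attached to the three points of order four which are collinear. -/
theorem exists_sq_eq_neg_one_of_collinear {e₁ e₂ e₃ x₁ x₂ x₃ y₁ y₂ y₃ : ℂ}
    (he : e₁ + e₂ + e₃ = 0) (h₁₂ : e₁ ≠ e₂)
    (hx₁ : (x₁ - e₁) ^ 2 = (e₁ - e₂) * (e₁ - e₃)) (hx₂ : (x₂ - e₂) ^ 2 = (e₂ - e₁) * (e₂ - e₃))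
    (hy₁ : y₁ ^ 2 = (x₁ - e₁) * (x₁ - e₂) * (x₁ - e₃))
    (hy₂ : y₂ ^ 2 = (x₂ - e₁) * (x₂ - e₂) * (x₂ - e₃)) (hy₁0 : y₁ ≠ 0) (hy₂0 : y₂ ≠ 0)
    (hx : x₁ ≠ x₂) (hx₃ : x₃ = ((y₁ - y₂) / (x₁ - x₂)) ^ 2 - x₁ - x₂)
    (hy₃ : y₃ = y₁ + (y₁ - y₂) / (x₁ - x₂) * (x₃ - x₁)) :
    ∃ k : ℂ, k ^ 2 = -1 ∧ (e₂ - e₁) * (x₂ - e₃) * (x₁ - e₃) = k * y₁ * y₂ ∧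
      (e₃ - e₂) * (x₃ - e₁) * (x₂ - e₁) = k * y₂ * y₃ ∧
      (e₁ - e₃) * (x₁ - e₂) * (x₃ - e₂) = k * y₃ * y₁ ∧
      ((x₁ - e₁) * (x₂ - e₂) + (x₂ - e₂) * (x₃ - e₃) + (x₃ - e₃) * (x₁ - e₁)) ^ 2 =
        2 * ((x₁ - e₁) + (x₂ - e₂) + (x₃ - e₃)) * ((x₁ - e₁) * (x₂ - e₂) * (x₃ - e₃)) := by
  obtain ⟨k, hk⟩ : ∃ k, k = (e₂ - e₁) * (x₂ - e₃) * (x₁ - e₃) / (y₁ * y₂) := ⟨_, rfl⟩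
  have hky : (e₂ - e₁) * (x₂ - e₃) * (x₁ - e₃) = k * y₁ * y₂ := by rw [hk]; field_simp
  have hk2 : k ^ 2 = -1 := by
    have hyy : (y₁ * y₂) ^ 2 ≠ 0 := pow_ne_zero 2 (mul_ne_zero hy₁0 hy₂0)
    refine mul_right_cancel₀ hyy ?_
    have a1 : (x₁ - e₁) * (x₁ - e₂) = (e₁ - e₂) * (x₁ - e₃) := by linear_combination hx₁
    have a2 : (x₂ - e₁) * (x₂ - e₂) = (e₂ - e₁) * (x₂ - e₃) := by linear_combination hx₂
    have b1 : y₁ ^ 2 = (e₁ - e₂) * (x₁ - e₃) ^ 2 := by rw [hy₁, a1]; ring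
    have b2 : y₂ ^ 2 = (e₂ - e₁) * (x₂ - e₃) ^ 2 := by rw [hy₂, a2]; ring
    calc k ^ 2 * (y₁ * y₂) ^ 2 = (k * y₁ * y₂) ^ 2 := by ring
      _ = _ := by rw [← hky, mul_pow y₁, b1, b2]; ring
  have hk0 : k ≠ 0 := by rintro rfl; norm_num at hk2
  obtain ⟨p, hp⟩ := IsAlgClosed.exists_pow_nat_eq (e₁ - e₂) two_pos
  have hp0 : p ≠ 0 := by rintro rfl; exact h₁₂ (by linear_combination -hp)
  obtain ⟨q, hq⟩ : ∃ q, x₁ - e₁ = p * q := ⟨(x₁ - e₁) / p, by field_simp⟩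
  obtain ⟨s, hs⟩ : ∃ s, x₂ - e₂ = k * p * s := ⟨(x₂ - e₂) / (k * p), by field_simp⟩
  have hq2 : q ^ 2 = e₁ - e₃ := mul_left_cancel₀ (pow_ne_zero 2 hp0) (by
    rw [← mul_pow, ← hq, hx₁, hp])
  have hs2 : s ^ 2 = e₂ - e₃ := mul_left_cancel₀ (pow_ne_zero 2 hp0) (by
    have := hx₂
    rw [hs] at this
    linear_combination -this + p ^ 2 * s ^ 2 * hk2 - (e₂ - e₃) * hp)
  have hpqs : q ^ 2 = p ^ 2 + s ^ 2 := by linear_combination hq2 - hp - hs2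
  obtain rfl : e₂ = e₁ - p ^ 2 := by linear_combination hp
  obtain rfl : e₃ = e₁ - q ^ 2 := by linear_combination hq2
  obtain rfl : x₁ = e₁ + p * q := by linear_combination hq
  obtain rfl : x₂ = e₁ - p ^ 2 + k * p * s := by linear_combination hs
  have hy₁' : y₁ ^ 2 = (p * q * (p + q)) ^ 2 := by rw [hy₁]; ring
  have hpq0 : p * q * (p + q) ≠ 0 := by
    intro h; rw [h] at hy₁'; exact hy₁0 (by simpa using hy₁')
  obtain ⟨η, hη⟩ : ∃ η, y₁ = η * (p * q * (p + q)) := ⟨y₁ / (p * q * (p + q)),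
    (div_mul_cancel₀ _ hpq0).symm⟩
  have hη2 : η ^ 2 = 1 := mul_right_cancel₀ (pow_ne_zero 2 hpq0) (by
    rw [← mul_pow, ← hη, hy₁', one_mul])
  have hη0 : η ≠ 0 := by rintro rfl; norm_num at hη2
  have hy₂' : y₂ = η * k * p * s * (s + k * p) := by
    have h0 : k * y₁ ≠ 0 := mul_ne_zero hk0 hy₁0
    refine mul_left_cancel₀ h0 ?_
    rw [← hky, hη]
    linear_combination (-k*p^3*q^2*s*η^2 - k*p^4*q*s*η^2 - p^2*q^2*s^2*η^2 - p^3*q*s^2*η^2) * hk2 +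
      (k*p^3*q^2*s + k*p^4*q*s + p^2*q^2*s^2 + p^3*q*s^2) * hη2 + (-p^2*q^2 - p^3*q) * hpqs
  have hd : e₁ + p * q - (e₁ - p ^ 2 + k * p * s) ≠ 0 := sub_ne_zero.2 hx
  have hl : (y₁ - y₂) / (e₁ + p * q - (e₁ - p ^ 2 + k * p * s)) =
      η * ((1 + k) * p + (1 - k) * q + (1 + k) * s) / 2 := by
    rw [div_eq_iff hd, hη, hy₂']
    linear_combination ((-1/2)*p*q*s*η + (1/2)*p*s^2*η + (-1/2)*p^2*s*η) * hk2 +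
      ((1/2)*k*p*η + (1/2)*p*η) * hpqs
  rw [hl] at hx₃ hy₃
  have hx₃' : x₃ = q * s + (e₁ - q ^ 2) := by
    rw [hx₃]
    linear_combination ((-1/2)*p*q*η^2 + (1/2)*p*s*η^2 + (1/4)*p^2*η^2 + (-1/2)*q*s*η^2 +
      (1/4)*q^2*η^2 + (1/4)*s^2*η^2) * hk2 + (k*p*s + (1/2)*k*p^2 + (-1/2)*k*q^2 + (1/2)*k*s^2 +
        p*q + q*s) * hη2 + ((-1/2)*k) * hpqs - he
  have hy₃' : y₃ = η * k * q * s * (s - q) := by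
    rw [hy₃, hx₃', hη]
    linear_combination ((1/2)*k*q*η + (-1/2)*q*η) * hpqs
  refine ⟨k, hk2, hky, ?_, ?_, ?_⟩
  · rw [hy₃', hy₂', hx₃']
    linear_combination (-k*p*q*s^4*η^2 + k*p*q^2*s^3*η^2 - k^2*p^2*q*s^3*η^2 + k^2*p^2*q^2*s^2*η^2 +
      p^2*q*s^3*η^2 - p^2*q^2*s^2*η^2) * hk2 + (k*p*q*s^4 - k*p*q^2*s^3 - p^2*q*s^3 + p^2*q^2*s^2)
        * hη2 + (-k*p*q*s^2 + k*p*q^2*s + p^2*q*s - p^2*q^2) * hpqs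
  · rw [hy₃', hη, hx₃']
    linear_combination (-p*q^3*s^2*η^2 + p*q^4*s*η^2 - p^2*q^2*s^2*η^2 + p^2*q^3*s*η^2) * hk2 +
      (p*q^3*s^2 - p*q^4*s + p^2*q^2*s^2 - p^2*q^3*s) * hη2 + (-p*q^3 - p^2*q^2) * hpqs
  · rw [hx₃']
    linear_combination (p^2*q^2*s^4 + p^4*q^2*s^2) * hk2 + (p^2*q^2*s^2) * hpqs

namespace PeriodPair
open UpperHalfPlane

variable {L : PeriodPair} {u v w : ℂ}

/-- Three collinear points of order eight whose multiples by four are the half periods. -/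
structure OctTriple (L : PeriodPair) (u v w : ℂ) : Prop where
  half : L.HalfTriple (4 * u) (4 * v) (4 * w)
  sum : u + v + w ∈ L.lattice

/-- The value at a point of order eight of the square root of `z ↦ ℘(2z) - ℘(4u)`. -/
noncomputable def octRoot (L : PeriodPair) (u : ℂ) : ℂ := L.halfRoot (4 * u) u

/-- Two modular functions of level eight, of weights four and eight. -/
noncomputable def octInv (L : PeriodPair) (u v w : ℂ) : ℂ × ℂ :=
  ((L.octRoot u * L.octRoot v) ^ 2 + (L.octRoot v * L.octRoot w) ^ 2 +
    (L.octRoot w * L.octRoot u) ^ 2,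
    (L.octRoot u * L.octRoot v + L.octRoot v * L.octRoot w + L.octRoot w * L.octRoot u) *
      (L.octRoot u * L.octRoot v * L.octRoot w) ^ 2)

theorem halfRoot_congr {h h' z z' : ℂ} (hh : h - h' ∈ L.lattice) (hz : z - z' ∈ L.lattice) :
    L.halfRoot h z = L.halfRoot h' z' := by
  have := L.halfRoot_add_of_mem h' hz z'
  rw [← this, add_sub_cancel, halfRoot, halfRoot, P_eq_of_sub_mem hh]

theorem four_mul_mem {l : ℂ} (h : l ∈ L.lattice) : 4 * l ∈ L.lattice := by
  convert! L.lattice.smul_mem (4 : ℤ) h using 1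
  simp

theorem octRoot_congr {u' : ℂ} (h : u - u' ∈ L.lattice) : L.octRoot u = L.octRoot u' :=
  halfRoot_congr (by rw [← mul_sub]; exact four_mul_mem h) h

theorem octRoot_neg (hu : 2 * (4 * u) ∈ L.lattice) : L.octRoot (-u) = -L.octRoot u := by
  rw [octRoot, octRoot, halfRoot_neg, halfRoot_congr (h' := 4 * u) (z' := u) _ (by simp)]
  convert! L.lattice.neg_mem hu using 1; ring

theorem octInv_congr {u' v' w' : ℂ} (hu : u - u' ∈ L.lattice) (hv : v - v' ∈ L.lattice)
    (hw : w - w' ∈ L.lattice) : L.octInv u v w = L.octInv u' v' w' := by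
  rw [octInv, octInv, octRoot_congr hu, octRoot_congr hv, octRoot_congr hw]

theorem octInv_rot (u v w : ℂ) : L.octInv v w u = L.octInv u v w := by
  rw [octInv, octInv]; ext <;> ring

theorem octInv_swap (u v w : ℂ) : L.octInv u w v = L.octInv u v w := by
  rw [octInv, octInv]; ext <;> ring

theorem octInv_of_mul {u' v' w' k : ℂ} (hk : k ^ 4 = 1) (hu : L.octRoot u' = k * L.octRoot u)
    (hv : L.octRoot v' = k * L.octRoot v) (hw : L.octRoot w' = k * L.octRoot w) :
    L.octInv u' v' w' = L.octInv u v w := by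
  rw [octInv, octInv, hu, hv, hw]
  ext
  · linear_combination ((L.octRoot u * L.octRoot v) ^ 2 + (L.octRoot v * L.octRoot w) ^ 2 +
      (L.octRoot w * L.octRoot u) ^ 2) * hk
  · linear_combination ((L.octRoot u * L.octRoot v + L.octRoot v * L.octRoot w +
      L.octRoot w * L.octRoot u) * (L.octRoot u * L.octRoot v * L.octRoot w) ^ 2) *
      (k ^ 4 + 1) * hk

namespace OctTriple
variable (H : L.OctTriple u v w)
include H

theorem rot : L.OctTriple v w u :=
  ⟨H.half.rot, by convert! H.sum using 1; ring⟩

theorem two_mul_notMem : 2 * u ∉ L.lattice := fun h ↦ H.half.notMem₁ (by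
  convert! L.lattice.add_mem h h using 1; ring)

theorem four_mul_notMem : 2 * (2 * u) ∉ L.lattice := fun h ↦ H.half.notMem₁ (by
  convert! h using 1; ring)

theorem octInv_neg : L.octInv (-u) (-v) (-w) = L.octInv u v w :=
  octInv_of_mul (k := -1) (by norm_num) (by rw [octRoot_neg H.half.two₁]; ring)
    (by rw [octRoot_neg H.half.two₂]; ring) (by rw [octRoot_neg H.half.two₃]; ring)

theorem octRoot_five_mul : L.octRoot (5 * u) = L.octRoot u := by
  rw [octRoot, octRoot, ← H.half.halfRoot_add_self H.two_mul_notMem]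
  refine halfRoot_congr ?_ (by ring_nf; simp)
  convert! L.lattice.add_mem H.half.two₁ H.half.two₁ using 1; ring

theorem octInv_five_mul : L.octInv (5 * u) (5 * v) (5 * w) = L.octInv u v w := by
  rw [octInv, octInv, H.octRoot_five_mul, H.rot.octRoot_five_mul, H.rot.rot.octRoot_five_mul]

theorem octRoot_add_four_mul : L.octRoot (u + 4 * v) = -1 * L.octRoot u := by
  rw [octRoot, octRoot, neg_one_mul, ← H.half.halfRoot_add_of_ne H.two_mul_notMem]
  refine halfRoot_congr ?_ (by simp)
  convert! L.lattice.add_mem H.half.two₂ H.half.two₂ using 1; ring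

theorem octInv_add_four_mul : L.octInv (u + 4 * v) (v + 4 * w) (w + 4 * u) = L.octInv u v w :=
  octInv_of_mul (by norm_num) H.octRoot_add_four_mul H.rot.octRoot_add_four_mul
    H.rot.rot.octRoot_add_four_mul

theorem sq_sub : (℘[L] (2 * u) - ℘[L] (4 * u)) ^ 2 =
    (℘[L] (4 * u) - ℘[L] (4 * v)) * (℘[L] (4 * u) - ℘[L] (4 * w)) := by
  have h6 : 2 * u + 4 * u ∉ L.lattice := fun h ↦ H.two_mul_notMem (by
    have := L.lattice.sub_mem H.half.two₁ h
    convert! this using 1; ring)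
  have := H.half.P_add_mul H.two_mul_notMem h6
  rw [P_eq_of_add_mem (a := 2 * u + 4 * u) (b := 2 * u) (by
    convert! H.half.two₁ using 1; ring)] at this
  rw [← this]; ring

theorem octRoot_sq : L.octRoot u ^ 2 = ℘[L] (2 * u) - ℘[L] (4 * u) :=
  (H.half.P_two_mul_sub H.two_mul_notMem).symm

theorem octRoot_add_two_mul {k : ℂ}
    (hk : (℘[L] (4 * v) - ℘[L] (4 * u)) * (℘[L] (2 * v) - ℘[L] (4 * w)) *
      (℘[L] (2 * u) - ℘[L] (4 * w)) = k * (℘'[L] (2 * u) / 2) * (℘'[L] (2 * v) / 2)) :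
    L.octRoot (u + 2 * v) = k * L.octRoot u := by
  have h2u := H.two_mul_notMem
  have hv' := L.P'_ne_zero H.rot.four_mul_notMem
  have hu' := L.P'_ne_zero H.four_mul_notMem
  have hm : 2 * (u + 2 * v) ∉ L.lattice := fun h ↦ H.half.notMem₁ (by
    have := L.lattice.sub_mem (L.lattice.add_mem h h) H.half.two₂
    convert! this using 1; ring)
  have e : L.octRoot (u + 2 * v) = L.halfRoot (4 * u) (u + 2 * v) :=
    halfRoot_congr (by convert! H.half.two₂ using 1; ring) (by simp)
  have a := H.half.halfRoot_add_mul (P := 2 * v) (z := u)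
    (by convert! H.half.two₂ using 1; ring) h2u hm
  have b := H.half.P'_two_mul h2u
  have c := H.half.rot.rot.P_two_mul_sub h2u
  have d := H.half.halfRoot_eq (2 * v)
  have s := H.rot.sq_sub
  rw [eq_div_iff hv'] at d
  rw [e, octRoot]
  have n : L.halfRoot (4 * v) u * L.halfRoot (4 * w) u ≠ 0 := fun h ↦ hu' (by
    rw [b]; linear_combination 2 * L.halfRoot (4 * u) u * h)
  refine mul_right_cancel₀ (mul_ne_zero n hv') ?_
  linear_combination L.halfRoot (4 * w) u * ℘'[L] (2 * v) * a +
    L.halfRoot (4 * w) u ^ 2 * d + L.halfRoot (4 * w) u ^ 2 * s +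
    2 * hk + k * ℘'[L] (2 * v) / 2 * b -
    2 * (℘[L] (4 * v) - ℘[L] (4 * u)) * (℘[L] (2 * v) - ℘[L] (4 * w)) * c

theorem exists_sq_eq_neg_one : ∃ k : ℂ, k ^ 2 = -1 ∧ L.octRoot (u + 2 * v) = k * L.octRoot u ∧
    L.octRoot (v + 2 * w) = k * L.octRoot v ∧ L.octRoot (w + 2 * u) = k * L.octRoot w ∧
    (L.octInv u v w).1 ^ 2 = 2 * (L.octRoot u ^ 2 + L.octRoot v ^ 2 + L.octRoot w ^ 2) *
      (L.octRoot u ^ 2 * L.octRoot v ^ 2 * L.octRoot w ^ 2) := by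
  have h2u := H.two_mul_notMem
  have h2v := H.rot.two_mul_notMem
  have h2w := H.rot.rot.two_mul_notMem
  have h2s : 2 * u + 2 * v + 2 * w ∈ L.lattice := by
    convert! L.lattice.add_mem H.sum H.sum using 1; ring
  have hp : 2 * u + 2 * v ∉ L.lattice := fun h ↦ h2w (by
    have := L.lattice.sub_mem h2s h
    convert! this using 1; ring)
  have hm : 2 * u - 2 * v ∉ L.lattice := fun h ↦ H.half.sub_notMem (by
    convert! L.lattice.add_mem h h using 1; ring)
  obtain ⟨A, B⟩ := L.P_add_formula h2u H.rot.four_mul_notMem hp hm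
  have hP : ℘[L] (2 * w) = ℘[L] (2 * u + 2 * v) :=
    P_eq_of_add_mem (by convert! h2s using 1; ring)
  have hP' : ℘'[L] (2 * w) = -℘'[L] (2 * u + 2 * v) := by
    rw [← L.derivWeierstrassP_neg, ← L.P'_add h2s (-_)]
    congr 1; ring
  obtain ⟨k, hk, h1, h2, h3, h4⟩ := exists_sq_eq_neg_one_of_collinear
    (e₁ := ℘[L] (4 * u)) (e₂ := ℘[L] (4 * v)) (e₃ := ℘[L] (4 * w)) (x₁ := ℘[L] (2 * u))
    (x₂ := ℘[L] (2 * v)) (x₃ := ℘[L] (2 * w)) (y₁ := ℘'[L] (2 * u) / 2)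
    (y₂ := ℘'[L] (2 * v) / 2) (y₃ := ℘'[L] (2 * w) / 2) H.half.g_eq.1 H.half.P_ne H.sq_sub
    (by rw [H.rot.sq_sub]; ring) (by rw [div_pow, H.half.P'_sq h2u]; ring)
    (by rw [div_pow, H.half.P'_sq h2v]; ring)
    (by simpa using L.P'_ne_zero H.four_mul_notMem)
    (by simpa using L.P'_ne_zero H.rot.four_mul_notMem)
    (by
      rw [Ne, L.P_eq_iff h2u h2v, not_or]
      exact ⟨hm, hp⟩)
    (by rw [hP, A]; ring) (by rw [hP', hP, B]; ring)
  refine ⟨k, hk, H.octRoot_add_two_mul h1, H.rot.octRoot_add_two_mul h2,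
    H.rot.rot.octRoot_add_two_mul ?_, ?_⟩
  · linear_combination h3
  · rw [octInv, H.octRoot_sq, H.rot.octRoot_sq, H.rot.rot.octRoot_sq, ← h4, ← H.octRoot_sq,
      ← H.rot.octRoot_sq, ← H.rot.rot.octRoot_sq]
    ring

theorem octInv_add_two_mul : L.octInv (u + 2 * v) (v + 2 * w) (w + 2 * u) = L.octInv u v w := by
  obtain ⟨k, hk, h1, h2, h3, -⟩ := H.exists_sq_eq_neg_one
  exact octInv_of_mul (by linear_combination (k ^ 2 - 1) * hk) h1 h2 h3

end OctTriple
end PeriodPair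

/-- The orbits of a group of matrices on primitive vectors modulo eight. -/
theorem eq_of_orbit_mod_eight {α : Type*} (G : ℤ → ℤ → α)
    (hcongr : ∀ a b a' b', 8 ∣ a - a' → 8 ∣ b - b' → G a b = G a' b')
    (hneg : ∀ a b, ¬ (2 ∣ a ∧ 2 ∣ b) → G (-a) (-b) = G a b)
    (hfive : ∀ a b, ¬ (2 ∣ a ∧ 2 ∣ b) → G (5 * a) (5 * b) = G a b)
    (hrot : ∀ a b, ¬ (2 ∣ a ∧ 2 ∣ b) → G (-b) (a - b) = G a b)
    (hfour : ∀ a b, ¬ (2 ∣ a ∧ 2 ∣ b) → G (a - 4 * b) (b + 4 * (a - b)) = G a b)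
    (htwo : ∀ a b, ¬ (2 ∣ a ∧ 2 ∣ b) → G (a - 2 * b) (b + 2 * (a - b)) = G a b)
    (a b : ℤ) (hab : ¬ (2 ∣ a ∧ 2 ∣ b)) : G a b = G 1 0 := by
  have h14 : G 1 4 = G 1 0 := hfour 1 0 (by decide)
  have h12 : G 1 2 = G 1 0 := htwo 1 0 (by decide)
  have h16 : G 1 6 = G 1 0 := by
    rw [← h14, ← htwo 1 4 (by decide)]
    exact hcongr _ _ _ _ (by decide) (by decide)
  have one (b : ℤ) (hb : b % 2 = 0) : G 1 b = G 1 0 := by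
    have : b % 8 = 0 ∨ b % 8 = 2 ∨ b % 8 = 4 ∨ b % 8 = 6 := by omega
    rcases this with h | h | h | h
    · exact hcongr _ _ _ _ (by omega) (by omega)
    · exact (hcongr _ _ 1 2 (by omega) (by omega)).trans h12
    · exact (hcongr _ _ 1 4 (by omega) (by omega)).trans h14
    · exact (hcongr _ _ 1 6 (by omega) (by omega)).trans h16
  have two (a b : ℤ) (ha : a % 4 = 1) (hb : b % 2 = 0) : G a b = G 1 0 := by
    have : a % 8 = 1 ∨ a % 8 = 5 := by omega
    rcases this with h | h
    · rw [hcongr a b 1 b (by omega) (by omega), one b hb]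
    · rw [← hfive a b (by omega), hcongr (5 * a) (5 * b) 1 (5 * b) (by omega) (by omega),
        one (5 * b) (by omega)]
  have three (a b : ℤ) (ha : a % 2 = 1) (hb : b % 2 = 0) : G a b = G 1 0 := by
    have : a % 4 = 1 ∨ a % 4 = 3 := by omega
    rcases this with h | h
    · exact two a b h hb
    · rw [← hneg a b (by omega), two (-a) (-b) (by omega) (by omega)]
  have four (a b : ℤ) (ha : a % 2 = 1) : G a b = G 1 0 := by
    have : b % 2 = 0 ∨ b % 2 = 1 := by omega
    rcases this with h | h
    · exact three a b ha h
    · rw [← hrot a b (by omega), three (-b) (a - b) (by omega) (by omega)]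
  have : a % 2 = 1 ∨ b % 2 = 1 := by omega
  rcases this with h | h
  · exact four a b h
  · rw [← hrot a b (by omega), four (-b) (a - b) (by omega)]

namespace PeriodPair
open UpperHalfPlane

variable {L : PeriodPair}

theorem intCast_mul_mem (n : ℤ) {l : ℂ} (h : l ∈ L.lattice) : (n : ℂ) * l ∈ L.lattice := by
  convert! L.lattice.smul_mem n h using 1
  simp

/-- The values of the level eight functions at the multiples of `u` by powers of `ω`. -/
noncomputable def octVal (L : PeriodPair) (ω u : ℂ) : ℂ × ℂ := L.octInv u (ω * u) (ω ^ 2 * u)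

section
variable {ω u : ℂ} {e : ℤ} (hmul : ∀ l ∈ L.lattice, ω * l ∈ L.lattice)
  (hω : ω ^ 2 + ω + 1 = 8 * e)
include hmul hω

omit hmul in
theorem mul_mem_of_eight (h8 : 8 * u ∈ L.lattice) : (ω ^ 2 + ω + 1) * u ∈ L.lattice := by
  convert! intCast_mul_mem e h8 using 1
  rw [hω]; ring

theorem cube_sub_one_mul_mem (h8 : 8 * u ∈ L.lattice) : ω ^ 3 * u - u ∈ L.lattice := by
  have := mul_mem_of_eight hω h8
  convert! L.lattice.sub_mem (hmul _ this) this using 1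
  ring

theorem octTriple_of_eight (h8 : 8 * u ∈ L.lattice) (h4 : 4 * u ∉ L.lattice) :
    L.OctTriple u (ω * u) (ω ^ 2 * u) := by
  have hs := mul_mem_of_eight hω h8
  have hc := four_mul_mem (cube_sub_one_mul_mem hmul hω h8)
  have h1 : 4 * (ω ^ 2 * u) ∉ L.lattice := fun h ↦ h4 (by
    convert! L.lattice.sub_mem (hmul _ h) hc using 1; ring)
  have h2 : 4 * (ω * u) ∉ L.lattice := fun h ↦ h1 (by
    convert! hmul _ h using 1; ring)
  have t1 := hmul _ h8
  refine ⟨⟨h4, h2, h1, ?_, ?_, ?_, ?_⟩, ?_⟩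
  · convert! h8 using 1; ring
  · convert! t1 using 1; ring
  · convert! hmul _ t1 using 1; ring
  · convert! four_mul_mem hs using 1; ring
  · convert! hs using 1; ring

theorem octVal_mul (h8 : 8 * u ∈ L.lattice) : L.octVal ω (ω * u) = L.octVal ω u := by
  rw [octVal, octVal, ← octInv_rot u]
  refine octInv_congr (by simp) (by ring_nf; simp) ?_
  convert! cube_sub_one_mul_mem hmul hω h8 using 1; ring

theorem octVal_neg (h8 : 8 * u ∈ L.lattice) (h4 : 4 * u ∉ L.lattice) :
    L.octVal ω (-u) = L.octVal ω u := by
  rw [octVal, octVal, mul_neg, mul_neg, (octTriple_of_eight hmul hω h8 h4).octInv_neg]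

theorem octVal_five_mul (h8 : 8 * u ∈ L.lattice) (h4 : 4 * u ∉ L.lattice) :
    L.octVal ω (5 * u) = L.octVal ω u := by
  rw [octVal, octVal, mul_left_comm, mul_left_comm _ 5,
    (octTriple_of_eight hmul hω h8 h4).octInv_five_mul]

theorem octVal_add_four_mul (h8 : 8 * u ∈ L.lattice) (h4 : 4 * u ∉ L.lattice) :
    L.octVal ω (u + 4 * (ω * u)) = L.octVal ω u := by
  rw [octVal, octVal, ← (octTriple_of_eight hmul hω h8 h4).octInv_add_four_mul]
  refine octInv_congr (by simp) (by ring_nf; simp) ?_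
  convert! four_mul_mem (cube_sub_one_mul_mem hmul hω h8) using 1; ring

theorem octVal_add_two_mul (h8 : 8 * u ∈ L.lattice) (h4 : 4 * u ∉ L.lattice) :
    L.octVal ω (u + 2 * (ω * u)) = L.octVal ω u := by
  rw [octVal, octVal, ← (octTriple_of_eight hmul hω h8 h4).octInv_add_two_mul]
  refine octInv_congr (by simp) (by ring_nf; simp) ?_
  have := cube_sub_one_mul_mem hmul hω h8
  convert! L.lattice.add_mem this this using 1; ring

omit hω in
theorem octVal_congr {v : ℂ} (h : u - v ∈ L.lattice) : L.octVal ω u = L.octVal ω v := by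
  have h1 := hmul _ h
  refine octInv_congr h ?_ ?_
  · convert! h1 using 1; ring
  · convert! hmul _ h1 using 1; ring

end

theorem exists_omega {m : ℤ} (hm : m % 2 = 1) : ∃ d y e : ℤ, y = -1 - 2 * d ∧
    d ^ 2 + d + 1 - y ^ 2 * m = 8 * e := by
  have : m % 8 = 1 ∨ m % 8 = 3 ∨ m % 8 = 5 ∨ m % 8 = 7 := by omega
  rcases this with h | h | h | h
  · exact ⟨-1, 1, (1 - m) / 8, by norm_num, by omega⟩
  · exact ⟨-2, 3, (3 - 9 * m) / 8, by norm_num, by omega⟩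
  · exact ⟨-4, 7, (13 - 49 * m) / 8, by norm_num, by omega⟩
  · exact ⟨-3, 5, (7 - 25 * m) / 8, by norm_num, by omega⟩

theorem IsClassOne.octVal_eq {τ : ℍ} {m : ℤ} (h : IsClassOne τ m) {d y e : ℤ}
    (hy : y = -1 - 2 * d) (hω : ((d : ℂ) + y * τ) ^ 2 + (d + y * τ) + 1 = 8 * e) {w : ℂ}
    (hw : 8 * w ∈ (Λ τ).lattice) (hw' : 4 * w ∉ (Λ τ).lattice) :
    (Λ τ).octVal (d + y * τ) w = (Λ τ).octVal (d + y * τ) (1 / 8) := by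
  set ω : ℂ := d + y * τ with hωdef
  have hω_mem : ω ∈ (Λ τ).lattice := mem_ofUpperHalfPlane.2 ⟨d, y, rfl⟩
  have hmul : ∀ l ∈ (Λ τ).lattice, ω * l ∈ (Λ τ).lattice := fun l hl ↦ h.mul_mem hω_mem hl
  have mem (a b : ℤ) : (a : ℂ) + b * ω ∈ (Λ τ).lattice :=
    mem_ofUpperHalfPlane.2 ⟨a + b * d, b * y, by push_cast; rw [hωdef]; ring⟩
  have m8 (a b : ℤ) : 8 * (((a : ℂ) + b * ω) / 8) ∈ (Λ τ).lattice := by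
    convert! mem a b using 1; ring
  have m4 {a b : ℤ} (hab : ¬ (2 ∣ a ∧ 2 ∣ b)) : 4 * (((a : ℂ) + b * ω) / 8) ∉ (Λ τ).lattice := by
    rw [div_mem_ofUpperHalfPlane (N := 2) (a := a + b * d) (b := b * y) two_ne_zero
      (by push_cast; rw [hωdef]; ring)]
    rintro ⟨h1, h2⟩
    have hb : 2 ∣ b := (Int.prime_two.dvd_mul.1 h2).resolve_right (by omega)
    exact hab ⟨by simpa using (Int.dvd_add_left (hb.mul_right d)).1 h1, hb⟩
  have hG {u v : ℂ} {a b : ℤ} (huv : u - v = a + b * ω) :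
      (Λ τ).octVal ω u = (Λ τ).octVal ω v :=
    octVal_congr hmul (by rw [huv]; exact mem a b)
  have key := eq_of_orbit_mod_eight (fun a b : ℤ ↦ (Λ τ).octVal ω ((a + b * ω) / 8))
    (fun a b a' b' ⟨p, hp⟩ ⟨q, hq⟩ ↦ hG (a := p) (b := q) (by
      have hp' : (a : ℂ) - a' = 8 * p := by exact_mod_cast hp
      have hq' : (b : ℂ) - b' = 8 * q := by exact_mod_cast hq
      linear_combination hp' / 8 + ω * hq' / 8))
    (fun a b hab ↦ by
      rw [← octVal_neg hmul hω (m8 a b) (m4 hab)]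
      exact hG (a := 0) (b := 0) (by push_cast; ring))
    (fun a b hab ↦ by
      rw [← octVal_five_mul hmul hω (m8 a b) (m4 hab)]
      exact hG (a := 0) (b := 0) (by push_cast; ring))
    (fun a b hab ↦ by
      rw [← octVal_mul hmul hω (m8 a b)]
      exact hG (a := -b * e) (b := 0) (by push_cast; linear_combination -(b : ℂ) / 8 * hω))
    (fun a b hab ↦ by
      rw [← octVal_add_four_mul hmul hω (m8 a b) (m4 hab)]
      exact hG (a := -4 * b * e) (b := 0) (by
        push_cast; linear_combination -(b : ℂ) / 2 * hω))
    (fun a b hab ↦ by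
      rw [← octVal_add_two_mul hmul hω (m8 a b) (m4 hab)]
      exact hG (a := -2 * b * e) (b := 0) (by
        push_cast; linear_combination -(b : ℂ) / 4 * hω))
  obtain ⟨a, b, hab⟩ := mem_ofUpperHalfPlane.1 hw
  have hy8 : 8 ∣ y ^ 2 - 1 := by
    have : y % 2 = 1 := by omega
    exact Int.eight_dvd_sq_sub_one_of_odd (Int.odd_iff.2 this)
  obtain ⟨f, hf⟩ := hy8
  have hf' : (y : ℂ) ^ 2 - 1 = 8 * f := by exact_mod_cast hf
  have hw2 : (Λ τ).octVal ω w =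
      (Λ τ).octVal ω ((((a - y * d * b : ℤ) : ℂ) + ((y * b : ℤ) : ℂ) * ω) / 8) := by
    refine octVal_congr hmul (mem_ofUpperHalfPlane.2 ⟨0, -b * f, ?_⟩)
    push_cast
    rw [hωdef]
    linear_combination (1 / 8 : ℂ) * hab + b * τ / 8 * hf'
  have hab2 : ¬ (2 ∣ a - y * d * b ∧ 2 ∣ y * b) := by
    rintro ⟨h1, h2⟩
    have hb : 2 ∣ b := (Int.prime_two.dvd_mul.1 h2).resolve_left (by omega)
    have ha : 2 ∣ a := by
      have := Int.dvd_add h1 (hb.mul_left (y * d))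
      simpa using this
    refine hw' ((div_mem_ofUpperHalfPlane (N := 2) two_ne_zero (a := a) (b := b) ?_).2 ⟨ha, hb⟩)
    push_cast; linear_combination -hab
  rw [hw2]
  refine (key _ _ hab2).trans ?_
  simp

theorem IsTransport.map_octRoot {τ : ℍ} {σ : ℂ ≃+* ℂ} {c : ℂ} (hσ : IsTransport τ σ c)
    {u w : ℂ} (hσ4 : σ (℘[Λ τ] (4 * u)) = (c ^ 2)⁻¹ * ℘[Λ τ] (4 * w))
    (hσ1 : σ (℘[Λ τ] u) = (c ^ 2)⁻¹ * ℘[Λ τ] w)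
    (hσ1' : σ (℘'[Λ τ] u) = (c ^ 3)⁻¹ * ℘'[Λ τ] w) :
    σ ((Λ τ).octRoot u) = c⁻¹ * (Λ τ).octRoot w := by
  have hc := hσ.ne_zero
  rw [octRoot, octRoot, halfRoot, halfRoot]
  simp only [map_sub, map_div₀, map_pow, map_mul, hσ4, hσ1, hσ1', hσ.g₂_eq,
    show σ 3 = 3 from map_ofNat σ 3, show σ 4 = 4 from map_ofNat σ 4]
  field_simp

theorem IsClassOne.map_octVal {τ : ℍ} {m : ℤ} (h : IsClassOne τ m) {d y e : ℤ}
    (hy : y = -1 - 2 * d) (hω : ((d : ℂ) + y * τ) ^ 2 + (d + y * τ) + 1 = 8 * e)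
    {σ : ℂ ≃+* ℂ} {c : ℂ} (hσ : IsTransport τ σ c) :
    σ ((Λ τ).octVal (d + y * τ) (1 / 8)).1 =
      (c ^ 4)⁻¹ * ((Λ τ).octVal (d + y * τ) (1 / 8)).1 ∧
    σ ((Λ τ).octVal (d + y * τ) (1 / 8)).2 =
      (c ^ 8)⁻¹ * ((Λ τ).octVal (d + y * τ) (1 / 8)).2 := by
  set ω : ℂ := d + y * τ with hωdef
  have hc := hσ.ne_zero
  have hω_mem : ω ∈ (Λ τ).lattice := mem_ofUpperHalfPlane.2 ⟨d, y, rfl⟩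
  have hmul : ∀ l ∈ (Λ τ).lattice, ω * l ∈ (Λ τ).lattice := fun l hl ↦ h.mul_mem hω_mem hl
  have i1 : (1 : ℂ) ∈ (Λ τ).lattice := mem_ofUpperHalfPlane.2 ⟨1, 0, by simp⟩
  have iω2 : ω ^ 2 ∈ (Λ τ).lattice := by rw [pow_two]; exact hmul _ hω_mem
  have u8 : 8 * (1 / 8 : ℂ) ∈ (Λ τ).lattice := by simpa using i1
  have u4 : 4 * (1 / 8 : ℂ) ∉ (Λ τ).lattice := by
    rw [div_mem_ofUpperHalfPlane (N := 2) (a := 1) (b := 0) two_ne_zero (by norm_num)]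
    decide
  have H := octTriple_of_eight hmul hω u8 u4
  obtain ⟨w, hw⟩ := hσ.exists_point (1 / 8) (fun h ↦ u4 (four_mul_mem h))
  have s4 : σ 4 = 4 := map_ofNat σ 4
  have w8 : 8 * w ∈ (Λ τ).lattice := by
    have := (hw 8 (mem_ofUpperHalfPlane.2 ⟨8, 0, by simp⟩)).1.1 u8
    rwa [show σ 8 = 8 from map_ofNat σ 8] at this
  have w4 : 4 * w ∉ (Λ τ).lattice := by
    have := (hw 4 (mem_ofUpperHalfPlane.2 ⟨4, 0, by simp⟩)).1.2
    rw [s4] at this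
    exact fun h ↦ u4 (this h)
  have root {α : ℂ} (hα : α ∈ (Λ τ).lattice) (h4 : 4 * (α * (1 / 8)) ∉ (Λ τ).lattice) :
      σ ((Λ τ).octRoot (α * (1 / 8))) = c⁻¹ * (Λ τ).octRoot (σ α * w) := by
    have a := (hw α hα).2 (fun h ↦ h4 (four_mul_mem h))
    have b := (hw (4 * α) (four_mul_mem hα)).2 (by rwa [mul_assoc])
    rw [map_mul, s4, mul_assoc, mul_assoc] at b
    exact hσ.map_octRoot b.1 a.1 a.2
  have r0 := root i1 (by simpa using u4)
  rw [map_one, one_mul, one_mul] at r0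
  have r1 := root hω_mem H.half.notMem₂
  have r2 := root iω2 H.half.notMem₃
  have key : (Λ τ).octInv w (σ ω * w) (σ (ω ^ 2) * w) = (Λ τ).octVal ω (1 / 8) := by
    rw [← h.octVal_eq hy hω w8 w4, octVal, map_pow]
    rcases h.map_eq σ with e' | e'
    · have : σ ω = ω := by rw [hωdef]; simp [e']
      rw [this]
    · have e2 : σ ω = -1 - ω := by
        rw [hωdef]; simp only [map_add, map_mul, map_intCast, e', hy]; push_cast; ring
      rw [← octInv_swap w (ω * w), e2]
      have t := mul_mem_of_eight hω w8
      refine octInv_congr (by simp) ?_ ?_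
      · convert! (Λ τ).lattice.neg_mem t using 1; ring
      · convert! t using 1; ring
  constructor
  all_goals
    conv_lhs => rw [octVal, octInv]
    conv_rhs => rw [← key, octInv]
    simp only [map_add, map_mul, map_pow, r0, r1, r2]
    field_simp

end PeriodPair

namespace PeriodPair
open UpperHalfPlane

variable {L : PeriodPair} {u v w : ℂ}

theorem OctTriple.octInv_relations (H : L.OctTriple u v w) {δ : ℂ} (hδ : δ ≠ 0)
    (hδ3 : δ ^ 3 = L.g₂ ^ 3 - 27 * L.g₃ ^ 2) {r x : ℂ} (hr : r * δ = (L.octInv u v w).1)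
    (hx : x * δ ^ 2 = -4 * (L.octInv u v w).2) :
    (x ^ 2 + r) ^ 2 = 2 * r ^ 2 - 2 * x ∧ -3 * L.g₂ / 4 = δ * (4 * r ^ 4 + 2 * r) := by
  obtain ⟨k, -, -, -, -, hk⟩ := H.exists_sq_eq_neg_one
  obtain ⟨a, b, c⟩ := H.half.g_eq
  have h1 := H.sq_sub
  have h2 := H.rot.sq_sub
  have h3 := H.rot.rot.sq_sub
  rw [← H.octRoot_sq] at h1
  rw [← H.rot.octRoot_sq] at h2
  rw [← H.rot.rot.octRoot_sq] at h3
  rw [octInv] at hr hx hk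
  dsimp only at hr hx hk
  generalize L.octRoot u = t₁ at *
  generalize L.octRoot v = t₂ at *
  generalize L.octRoot w = t₃ at *
  generalize ℘[L] (4 * u) = e₁ at *
  generalize ℘[L] (4 * v) = e₂ at *
  generalize ℘[L] (4 * w) = e₃ at *
  obtain rfl : e₃ = -e₁ - e₂ := by linear_combination a
  have hp : -16 * (t₁ ^ 2 * t₂ ^ 2 * t₃ ^ 2) ^ 2 = δ ^ 3 := by
    rw [hδ3, b, c]
    have : (t₁ ^ 2 * t₂ ^ 2 * t₃ ^ 2) ^ 2 = (t₁ ^ 2) ^ 2 * (t₂ ^ 2) ^ 2 * (t₃ ^ 2) ^ 2 := by ring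
    rw [this, h1, h2, h3]; ring
  have hs : (t₁ ^ 2) ^ 2 + (t₂ ^ 2) ^ 2 + (t₃ ^ 2) ^ 2 = 3 * L.g₂ / 4 := by
    rw [h1, h2, h3, b]; ring
  have hq : t₁ ^ 2 * t₂ ^ 2 * t₃ ^ 2 ≠ 0 := by
    intro h
    rw [h] at hp
    exact pow_ne_zero 3 hδ (by linear_combination -hp)
  obtain ⟨p, hpdef⟩ : ∃ p, p = t₁ ^ 2 * t₂ ^ 2 * t₃ ^ 2 := ⟨_, rfl⟩
  obtain ⟨s, hsdef⟩ : ∃ s, s = t₁ ^ 2 + t₂ ^ 2 + t₃ ^ 2 := ⟨_, rfl⟩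
  obtain ⟨ε, hε⟩ : ∃ ε, ε = t₁ * t₂ + t₂ * t₃ + t₃ * t₁ := ⟨_, rfl⟩
  have q1 : (ε ^ 2 - r * δ) ^ 2 = 4 * p * (s + 2 * ε) := by
    rw [hr, hpdef, hsdef, hε]; ring
  have q2 : (r * δ) ^ 2 = 2 * s * p := by rw [hr, hk, hpdef, hsdef]
  have q3 : x * δ ^ 2 = -4 * (ε * p) := by rw [hx, hpdef, hε]; ring
  have q4 : s ^ 2 - 2 * (r * δ) = 3 * L.g₂ / 4 := by rw [← hs, hr, hsdef]; ring
  rw [← hpdef] at hp hq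
  have hδ2 := pow_ne_zero 2 hδ
  have q5 : ε ^ 2 = -x ^ 2 * δ := by
    refine mul_right_cancel₀ (pow_ne_zero 3 hδ) ?_
    linear_combination -ε ^ 2 * hp + (x * δ ^ 2 - 4 * (ε * p)) * q3
  constructor
  · refine mul_right_cancel₀ hδ2 ?_
    rw [q5] at q1
    linear_combination q1 - 2 * q2 + 2 * q3
  · refine mul_right_cancel₀ (pow_ne_zero 3 hδ) ?_
    linear_combination δ ^ 3 * q4 - 4 * ((r * δ) ^ 2 + 2 * s * p) * q2 + s ^ 2 * hp

theorem IsClassOne.exists_rat {τ : ℍ} {m : ℤ} (h : IsClassOne τ m) (hm : m % 6 = 5) :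
    ∃ (r x : ℚ) (δ : ℂ), δ ^ 3 = (Λ τ).g₂ ^ 3 - 27 * (Λ τ).g₃ ^ 2 ∧
      (x ^ 2 + r) ^ 2 = 2 * r ^ 2 - 2 * x ∧ -3 * (Λ τ).g₂ / 4 = δ * (4 * r ^ 4 + 2 * r) := by
  obtain ⟨d, y, e, hy, he⟩ := exists_omega (m := m) (by omega)
  have hω : ((d : ℂ) + y * τ) ^ 2 + (d + y * τ) + 1 = 8 * e := by
    have he' : (d : ℂ) ^ 2 + d + 1 - y ^ 2 * m = 8 * e := by exact_mod_cast he
    have hy' : (y : ℂ) = -1 - 2 * d := by exact_mod_cast hy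
    linear_combination he' + y ^ 2 * h.sq + y * τ * hy'
  have hδ3 := cubeRoot_pow τ
  set δ := (Λ τ).cubeRoot τ (1 / 3) with hδdef
  have hδ : δ ≠ 0 := by
    intro h0
    rw [h0, g₂_cube_sub, eq_comm] at hδ3
    simpa using! And.intro hδ3 (ModularForm.discriminant_ne_zero τ)
  have hmul : ∀ l ∈ (Λ τ).lattice, (d + y * τ : ℂ) * l ∈ (Λ τ).lattice :=
    fun l hl ↦ h.mul_mem (mem_ofUpperHalfPlane.2 ⟨d, y, rfl⟩) hl
  have H := octTriple_of_eight (u := 1 / 8) hmul hω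
    (mem_ofUpperHalfPlane.2 ⟨1, 0, by norm_num⟩) (by
      rw [div_mem_ofUpperHalfPlane (N := 2) (a := 1) (b := 0) two_ne_zero (by norm_num)]
      decide)
  set ω : ℂ := d + y * τ
  have fix (z : ℂ) (hz : ∀ σ c, IsTransport τ σ c → σ z = z) : ∃ q : ℚ, (q : ℂ) = z := by
    obtain ⟨q, hq⟩ := IsAlgClosed.mem_range_algebraMap_of_fixed (F := ℚ) (x := z) fun σ ↦ by
      obtain ⟨c, hc⟩ := h.exists_isTransport σ
      exact hz σ c hc
    exact ⟨q, by simpa using hq⟩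
  have mδ {σ : ℂ ≃+* ℂ} {c : ℂ} (hσ : IsTransport τ σ c) : σ δ = (c ^ 4)⁻¹ * δ :=
    h.map_cubeRoot (by omega) hσ
  have mω {σ : ℂ ≃+* ℂ} {c : ℂ} (hσ : IsTransport τ σ c) :
      σ ((Λ τ).octVal ω (1 / 8)).1 = (c ^ 4)⁻¹ * ((Λ τ).octVal ω (1 / 8)).1 ∧
      σ ((Λ τ).octVal ω (1 / 8)).2 = (c ^ 8)⁻¹ * ((Λ τ).octVal ω (1 / 8)).2 :=
    h.map_octVal hy hω hσ
  obtain ⟨r, hr⟩ := fix (((Λ τ).octVal ω (1 / 8)).1 / δ) fun σ c hσ ↦ by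
    have hc := hσ.ne_zero
    rw [map_div₀, mδ hσ, (mω hσ).1]
    field_simp
  obtain ⟨x, hx⟩ := fix (-4 * ((Λ τ).octVal ω (1 / 8)).2 / δ ^ 2) fun σ c hσ ↦ by
    have hc := hσ.ne_zero
    rw [map_div₀, map_pow, mδ hσ, map_mul, (mω hσ).2,
      map_neg, show σ 4 = 4 from map_ofNat σ 4]
    field_simp
  obtain ⟨h1, h2⟩ := H.octInv_relations hδ hδ3 (r := r) (x := x)
    (by rw [hr, octVal]; field_simp) (by rw [hx, octVal]; field_simp)
  exact ⟨r, x, δ, hδ3, by exact_mod_cast h1, h2⟩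

end PeriodPair

section
variable {F : Type*} [Field F] {S : Subring F} {a b q : S} {w : ℕ → F} {n : ℕ}

/-- The leading term of multiplication by `k` in the formal group of
`Y² = X (X² + a X + b)`, read off from the recurrence for `1 / X`. -/
theorem exists_eq_sq_mul_of_recurrence (hS : ∀ s : S, ∃ d : S, d * (1 - q * s) = 1)
    (h0 : w 0 = 0) (h1 : w 1 = q)
    (hw : ∀ k, 1 ≤ k → k + 1 ≤ n → (w (k + 1) + w (k - 1)) * (1 - b * w k * q) ^ 2 =
      2 * ((w k + q) * (1 + b * w k * q) + 2 * a * w k * q)) :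
    ∀ k, k + 1 ≤ n → (∃ c : S, w k = q * (k ^ 2 + q * c)) ∧
      ∃ c : S, w (k + 1) = q * ((k + 1) ^ 2 + q * c) := by
  intro k
  induction k with
  | zero => exact fun _ ↦ ⟨⟨0, by simp [h0]⟩, 0, by simp [h1]⟩
  | succ k ih =>
    intro hk
    obtain ⟨⟨c, hc⟩, c', hc'⟩ := ih (by omega)
    refine ⟨⟨c', by rw [hc']; push_cast; ring⟩, ?_⟩
    have h := hw (k + 1) (by omega) hk
    rw [show k + 1 - 1 = k by omega] at h
    obtain ⟨t, ht⟩ : ∃ t : S, t = ((k : S) + 1) ^ 2 + q * c' := ⟨_, rfl⟩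
    have ht' : (t : F) = (k + 1) ^ 2 + q * c' := by rw [ht]; push_cast; ring
    rw [← ht'] at hc'
    obtain ⟨d, hd⟩ := hS (q * (b * t))
    have hd' : (d : F) * (1 - q * (q * (b * t))) = 1 := by
      exact_mod_cast congrArg (fun s : S ↦ (s : F)) hd
    have e : (d : F) = 1 + q * (q * (b * t)) * d := by linear_combination hd'
    rw [hc', hc] at h
    refine ⟨2 * c' - c + 2 * (b * t * q * (t + 1) + 2 * a * t) * d ^ 2 + 2 * (t + 1) * q * (b * t) *
      d * (1 + d), ?_⟩
    have h2 : ((2 : S) : F) = 2 := rfl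
    push_cast [h2]
    linear_combination (d : F) ^ 2 * h - (w (k + 1 + 1) + q * (k ^ 2 + q * c)) *
      (d * (1 - q * (q * (b * t))) + 1) * hd' + 2 * q * (t + 1) * (d + 1) * e + 2 * q * ht'

theorem eq_zero_of_recurrence (hS : ∀ s : S, ∃ d : S, d * (1 - q * s) = 1)
    (h0 : w 0 = 0) (h1 : w 1 = q)
    (hw : ∀ k, 1 ≤ k → k + 1 ≤ n → (w (k + 1) + w (k - 1)) * (1 - b * w k * q) ^ 2 =
      2 * ((w k + q) * (1 + b * w k * q) + 2 * a * w k * q)) {j : ℕ} (hj : j + 1 ≤ n)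
    (hjw : w (j + 1) = w j) {u : S} (hu : u * (2 * j + 1) = 1) : q = 0 := by
  obtain ⟨⟨c, hc⟩, c', hc'⟩ := exists_eq_sq_mul_of_recurrence hS h0 h1 hw j hj
  obtain ⟨d, hd⟩ := hS ((c - c') * u)
  rw [hc, hc'] at hjw
  have e : q * (2 * j + 1 - q * (c - c')) = 0 := by
    have h2 : ((2 : S) : F) = 2 := rfl
    refine Subtype.ext ?_
    push_cast [h2]
    linear_combination hjw
  linear_combination d * u * e - q * hd - d * q * hu
end

namespace PeriodPair
variable {L : PeriodPair}

namespace HalfTriple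
variable {h₁ h₂ h₃ : ℂ} (H : L.HalfTriple h₁ h₂ h₃)
include H

theorem P_add_P_sub {z v : ℂ} (hz : z ∉ L.lattice) (hv : 2 * v ∉ L.lattice)
    (hp : z + v ∉ L.lattice) (hm : z - v ∉ L.lattice) {x y A B : ℂ}
    (hx : x = ℘[L] z - ℘[L] h₁) (hy : y = ℘[L] v - ℘[L] h₁)
    (hA : A = ℘[L] h₂ - ℘[L] h₁) (hB : B = ℘[L] h₃ - ℘[L] h₁) :
    (℘[L] (z + v) - ℘[L] h₁ + (℘[L] (z - v) - ℘[L] h₁)) * (x - y) ^ 2 =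
      2 * ((x + y) * (x * y + A * B) - 2 * (A + B) * (x * y)) ∧
    (℘[L] (z + v) - ℘[L] h₁) * (℘[L] (z - v) - ℘[L] h₁) * (x - y) ^ 2 = (x * y - A * B) ^ 2 := by
  have hne : x - y ≠ 0 := by
    rw [hx, hy, sub_sub_sub_cancel_right, sub_ne_zero, Ne, L.P_eq_iff hz (L.notMem_of_two_mul hv)]
    tauto
  obtain ⟨h0, -⟩ := H.g_eq
  have e1 := (L.P_add_formula hz hv hp hm).1
  have e2 := (L.P_add_formula (v := -v) hz
    (fun h ↦ hv (by simpa using neg_mem h)) (by rwa [← sub_eq_add_neg]) (by rwa [sub_neg_eq_add])).1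
  rw [← sub_eq_add_neg, L.weierstrassP_neg, L.derivWeierstrassP_neg] at e2
  have s1 := H.P'_sq hz
  have s2 := H.P'_sq (L.notMem_of_two_mul hv)
  have hxy : ℘[L] z - ℘[L] v = x - y := by rw [hx, hy]; ring
  rw [hxy] at e1 e2
  set p := ℘'[L] z
  set q := ℘'[L] v
  have s1 : p ^ 2 = 4 * x * (x - A) * (x - B) := by rw [s1, hx, hA, hB]; ring
  have s2 : q ^ 2 = 4 * y * (y - A) * (y - B) := by rw [s2, hy, hA, hB]; ring
  have e1 : ℘[L] (z + v) - ℘[L] h₁ = ((p - q) / (x - y)) ^ 2 / 4 - x - y + A + B := by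
    rw [e1, hx, hy, hA, hB]; linear_combination -h0
  have e2 : ℘[L] (z - v) - ℘[L] h₁ = ((p + q) / (x - y)) ^ 2 / 4 - x - y + A + B := by
    rw [e2, hx, hy, hA, hB, sub_neg_eq_add]; linear_combination -h0
  rw [e1, e2]
  constructor
  · field_simp
    linear_combination 2 * (s1 + s2)
  · field_simp
    linear_combination (p ^ 2 - q ^ 2 + 4 * x * (x - A) * (x - B) - 4 * y * (y - A) * (y - B)) *
      (s1 - s2) + 8 * (A + B - x - y) * (x - y) ^ 2 * (s1 + s2)

theorem P_two_mul_sub_mul {z : ℂ} (hz : 2 * z ∉ L.lattice) {x A B : ℂ}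
    (hx : x = ℘[L] z - ℘[L] h₁) (hA : A = ℘[L] h₂ - ℘[L] h₁) (hB : B = ℘[L] h₃ - ℘[L] h₁) :
    (℘[L] (2 * z) - ℘[L] h₁) * (4 * x * (x - A) * (x - B)) = (x ^ 2 - A * B) ^ 2 := by
  have h1 := L.P'_ne_zero hz
  have h2 := H.P'_sq (L.notMem_of_two_mul hz)
  rw [show 4 * x * (x - A) * (x - B) = ℘'[L] z ^ 2 by rw [h2, hx, hA, hB]; ring,
    H.P_two_mul_sub hz, H.halfRoot_eq, ← mul_pow, div_mul_cancel₀ _ h1, hx, hA, hB]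
  ring

/-- Torsion points of order prime to the residue characteristic are integral. -/
theorem valuation_P_sub_le {Γ : Type*} [LinearOrderedCommGroupWithZero Γ] (v : Valuation ℂ Γ)
    (hAB : v (℘[L] h₂ - ℘[L] h₁) ≤ v (℘[L] h₃ - ℘[L] h₁)) {N : ℕ} (hN : Odd N) (hvN : v N = 1)
    {u : ℂ} (hu : u ∉ L.lattice) (hNu : N * u ∈ L.lattice) :
    v (℘[L] u - ℘[L] h₁) ≤ v (℘[L] h₃ - ℘[L] h₁) := by
  classical
  by_contra! hlt
  obtain ⟨o, ho⟩ : ∃ o : ℕ, ∀ k : ℕ, (k : ℂ) * u ∈ L.lattice ↔ o ∣ k :=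
    ⟨addOrderOf (Submodule.Quotient.mk u : ℂ ⧸ L.lattice), fun k ↦ by
      rw [addOrderOf_dvd_iff_nsmul_eq_zero, ← Submodule.Quotient.mk_smul,
        Submodule.Quotient.mk_eq_zero, nsmul_eq_mul]⟩
  obtain ⟨t, rfl⟩ := (ho N).1 hNu
  have hodd := (Nat.odd_mul.1 hN).1
  obtain ⟨j, rfl⟩ := hodd
  have hj : j ≠ 0 := by
    rintro rfl
    exact hu (by simpa using (ho 1).2 (by simp))
  have hB : ℘[L] h₃ - ℘[L] h₁ ≠ 0 := sub_ne_zero.2 H.rot.rot.P_ne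
  obtain ⟨A, hA'⟩ : ∃ A, A = ℘[L] h₂ - ℘[L] h₁ := ⟨_, rfl⟩
  obtain ⟨B, hB'⟩ : ∃ B, B = ℘[L] h₃ - ℘[L] h₁ := ⟨_, rfl⟩
  obtain ⟨x, hx'⟩ : ∃ x, x = ℘[L] u - ℘[L] h₁ := ⟨_, rfl⟩
  rw [← hB'] at hB hlt hAB
  rw [← hA'] at hAB
  rw [← hx'] at hlt
  have hx : x ≠ 0 := by
    rintro rfl
    simp at hlt
  have hvB : 0 < v B := zero_lt_iff.2 ((v.ne_zero_iff).2 hB)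
  have hvx : 0 < v x := zero_lt_iff.2 ((v.ne_zero_iff).2 hx)
  have ha : v (A / B) ≤ 1 := by rw [map_div₀]; exact div_le_one_of_le₀ hAB zero_le
  have hq : v (B / x) < 1 := by rw [map_div₀]; exact (div_lt_one₀ hvx).2 hlt
  have two {k : ℕ} (hk : k ≠ 0) (hkj : k ≤ 2 * j) : 2 * (k * u) ∉ L.lattice := by
    rw [← mul_assoc, show (2 * k : ℂ) = (2 * k : ℕ) by push_cast; rfl, ho,
      Nat.Coprime.dvd_mul_left (by simp)]
    exact Nat.not_dvd_of_pos_of_lt (by omega) (by omega)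
  have mem {k : ℕ} (hk : k ≠ 0) (hkj : k ≤ 2 * j) : k * u ∉ L.lattice :=
    L.notMem_of_two_mul (two hk hkj)
  obtain ⟨w, hw⟩ : ∃ w : ℕ → ℂ, w = fun k : ℕ ↦
    if (k : ℂ) * u ∈ L.lattice then 0 else B / (℘[L] (k * u) - ℘[L] h₁) := ⟨_, rfl⟩
  have wk {k : ℕ} (hk : k ≠ 0) (hkj : k ≤ 2 * j) : w k = B / (℘[L] (k * u) - ℘[L] h₁) := by
    rw [hw]
    exact if_neg (mem hk hkj)
  have w0 : w 0 = 0 := by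
    rw [hw]
    exact if_pos (by simp)
  have w1 : w 1 = B / x := by rw [wk one_ne_zero (by omega), hx']; simp
  let S := v.integer
  have hS (s : S) : ∃ d : S, d * (1 - (⟨B / x, hq.le⟩ : S) * s) = 1 := by
    have h1 : v (B / x * s) < 1 := by
      rw [map_mul]
      exact mul_lt_one_of_lt_of_le hq s.2
    have h2 : v (1 - B / x * s) = 1 := by
      rw [v.map_sub_eq_of_lt_left (by simpa using h1), map_one]
    refine ⟨⟨(1 - B / x * s)⁻¹, by rw [Valuation.mem_integer_iff, map_inv₀, h2, inv_one]⟩,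
      Subtype.ext ?_⟩
    push_cast
    exact inv_mul_cancel₀ fun h ↦ by simp [h] at h2
  have hva : v (-(1 + A / B)) ≤ 1 := by
    rw [Valuation.map_neg]
    exact v.map_add_le v.map_one.le ha
  have hvj : v (2 * j + 1) = 1 := by
    have h1 (n : ℕ) : v n ≤ 1 := natCast_mem v.integer n
    push_cast at hvN
    rw [map_mul] at hvN
    refine le_antisymm (by exact_mod_cast h1 (2 * j + 1)) ?_
    rw [← hvN]
    exact mul_le_of_le_one_right zero_le (h1 t)
  have := eq_zero_of_recurrence (a := (⟨-(1 + A / B), hva⟩ : S)) (b := (⟨A / B, ha⟩ : S))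
    (n := j + 1) (u := ⟨(2 * j + 1)⁻¹, by rw [Valuation.mem_integer_iff, map_inv₀, hvj, inv_one]⟩) hS w0 w1 ?_
      le_rfl ?_ ?_
  · have h0 := congrArg (fun s : S ↦ (s : ℂ)) this
    exact div_ne_zero hB hx h0
  · intro k hk hkj
    show (w (k + 1) + w (k - 1)) * (1 - A / B * w k * (B / x)) ^ 2 = 2 * ((w k + B / x) *
      (1 + A / B * w k * (B / x)) + 2 * -(1 + A / B) * w k * (B / x))
    have hu2 : 2 * u ∉ L.lattice := by simpa using two one_ne_zero (by omega)
    have hk2 := two (k := k) (by omega) (by omega)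
    have hp2 := two (k := k + 1) (by omega) (by omega)
    obtain rfl | hk1 := eq_or_ne k 1
    · have e := H.P_two_mul_sub_mul hu2 hx' hA' hB'
      have hX := H.P_sub_ne (by simpa using hp2)
      rw [wk (by omega) (by omega), w0, w1]
      norm_num at hX ⊢
      field_simp
      linear_combination -e
    · have hm2 := two (k := k - 1) (by omega) (by omega)
      have ep : ((k + 1 : ℕ) : ℂ) * u = k * u + u := by push_cast; ring
      have em : ((k - 1 : ℕ) : ℂ) * u = k * u - u := by
        rw [Nat.cast_sub (by omega)]; push_cast; ring
      have hp := mem (k := k + 1) (by omega) (by omega)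
      have hm := mem (k := k - 1) (by omega) (by omega)
      rw [wk (by omega) (by omega), wk (by omega) (by omega), wk (by omega) (by omega)]
      rw [ep] at hp hp2 ⊢
      rw [em] at hm hm2 ⊢
      obtain ⟨X, hX⟩ : ∃ X, X = ℘[L] (k * u) - ℘[L] h₁ := ⟨_, rfl⟩
      obtain ⟨e1, e2⟩ := H.P_add_P_sub (mem (by omega) (by omega)) hu2 hp hm hX hx' hA' hB'
      have hne : X - x ≠ 0 := by
        rw [hX, hx', sub_sub_sub_cancel_right, sub_ne_zero, Ne,
          L.P_eq_iff (L.notMem_of_two_mul hk2) (L.notMem_of_two_mul hu2)]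
        tauto
      have hX0 := H.P_sub_ne hk2
      have hp0 := H.P_sub_ne hp2
      have hm0 := H.P_sub_ne hm2
      rw [← hX] at hX0 ⊢
      generalize ℘[L] (k * u + u) - ℘[L] h₁ = p at *
      generalize ℘[L] (k * u - u) - ℘[L] h₁ = q at *
      field_simp
      refine mul_right_cancel₀ (pow_ne_zero 2 hne) ?_
      linear_combination p * q * (X - x) ^ 2 * e1 - (p + q) * (X - x) ^ 2 * e2
  · rw [wk (by omega) (by omega), wk hj (by omega)]
    congr 2
    refine P_eq_of_add_mem ?_
    rw [← add_mul, ← Nat.cast_add, ho]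
    exact ⟨1, by ring⟩
  · refine Subtype.ext ?_
    have h2 : ((2 : S) : ℂ) = 2 := rfl
    push_cast [h2]
    exact inv_mul_cancel₀ fun h ↦ by simp [h] at hvj

end HalfTriple
end PeriodPair

namespace PeriodPair
variable {L : PeriodPair}

namespace HalfTriple
variable {h₁ h₂ h₃ : ℂ} (H : L.HalfTriple h₁ h₂ h₃)
include H

theorem sub_P_add_mul {u : ℂ} (hu : u ∉ L.lattice) (hu' : u + h₁ ∉ L.lattice) :
    (℘[L] h₂ - ℘[L] (h₁ + u)) * (℘[L] h₁ - ℘[L] u) =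
      (℘[L] h₂ - ℘[L] h₁) * (℘[L] h₃ - ℘[L] u) := by
  have := H.P_add_mul hu hu'
  rw [add_comm h₁]
  linear_combination this

theorem sub_mul_prod_mul_prod {α : ℂ} {U : Finset ℂ} (hU : L.IsKernel α U) (hα : α ≠ 0)
    (hL : ∀ l ∈ L.lattice, α * l ∈ L.lattice) (h12 : α * h₁ - h₂ ∈ L.lattice)
    (h23 : α * h₂ - h₃ ∈ L.lattice) :
    (℘[L] h₃ - ℘[L] h₂) * (∏ u ∈ U.erase 0, (℘[L] h₂ - ℘[L] u)) * α ^ 2 *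
      ∏ u ∈ U.erase 0, (℘[L] h₁ - ℘[L] u) =
    (℘[L] h₂ - ℘[L] h₁) ^ U.card * ∏ u ∈ U.erase 0, (℘[L] h₃ - ℘[L] u) := by
  have hw : α * h₁ ∉ L.lattice := fun h ↦ H.notMem₂ (by simpa using sub_mem h h12)
  have hz : α * h₂ ∉ L.lattice := fun h ↦ H.notMem₃ (by simpa using sub_mem h h23)
  have key := hU.P_mul_sub_mul_prod hα hL hw hz
  rw [P_eq_of_sub_mem h12, P_eq_of_sub_mem h23, ← Finset.mul_prod_erase _ _ hU.zero_mem,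
    add_zero] at key
  have hprod : (∏ u ∈ U.erase 0, (℘[L] h₂ - ℘[L] (h₁ + u))) *
      ∏ u ∈ U.erase 0, (℘[L] h₁ - ℘[L] u) =
      (℘[L] h₂ - ℘[L] h₁) ^ (U.erase 0).card * ∏ u ∈ U.erase 0, (℘[L] h₃ - ℘[L] u) := by
    rw [← Finset.prod_mul_distrib, ← Finset.prod_const, ← Finset.prod_mul_distrib]
    refine Finset.prod_congr rfl fun u hu ↦ H.sub_P_add_mul (hU.notMem_of_mem_erase hu) ?_
    rw [add_comm]
    exact hU.add_notMem hL hw (Finset.mem_of_mem_erase hu)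
  rw [key, ← Finset.card_erase_add_one hU.zero_mem, pow_succ']
  field_simp
  linear_combination (℘[L] h₂ - ℘[L] h₁) * hprod

theorem valuation_not_lt {Γ : Type*} [LinearOrderedCommGroupWithZero Γ] (v : Valuation ℂ Γ)
    {α : ℂ} (hL : ∀ l ∈ L.lattice, α * l ∈ L.lattice) (h12 : α * h₁ - h₂ ∈ L.lattice)
    (h23 : α * h₂ - h₃ ∈ L.lattice) (h31 : α * h₃ - h₁ ∈ L.lattice) (hα : v α = 1)
    {N : ℕ} (hN : Odd N) (hvN : v N = 1) {β : ℂ} (hαβ : β * α = N)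
    (hβ : ∀ l ∈ L.lattice, β * l ∈ L.lattice) :
    v (℘[L] h₂ - ℘[L] h₃) ≤ v (℘[L] h₁ - ℘[L] h₂) := by
  by_contra! hlt
  have hα0 : α ≠ 0 := by rintro rfl; simp at hα
  obtain ⟨U, hU⟩ := L.exists_isKernel hα0 hL
  have hM : v (℘[L] h₁ - ℘[L] h₃) = v (℘[L] h₂ - ℘[L] h₃) := by
    rw [← v.map_add_eq_of_lt_right hlt]
    congr 1
    ring
  have r2 := congrArg v (H.rot.sub_mul_prod_mul_prod hU hα0 hL h23 h31)
  have r3 := congrArg v (H.rot.rot.sub_mul_prod_mul_prod hU hα0 hL h31 h12)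
  have nz {h h' : ℂ} (hh : α * h - h' ∈ L.lattice) (h' : h' ∉ L.lattice) :
      v (∏ u ∈ U.erase 0, (℘[L] h - ℘[L] u)) ≠ 0 :=
    (v.ne_zero_iff).2 (hU.prod_erase_ne_zero hL fun h ↦ h' (by simpa using sub_mem h hh))
  have n1 := nz h12 H.notMem₂
  have hle : v (∏ u ∈ U.erase 0, (℘[L] h₃ - ℘[L] u)) ≤
      v (℘[L] h₂ - ℘[L] h₃) ^ (U.erase 0).card := by
    rw [map_prod]
    refine Finset.prod_le_pow_card _ _ _ fun u hu ↦ ?_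
    rw [v.map_sub_swap]
    refine H.rot.rot.valuation_P_sub_le v hM.le hN hvN (hU.notMem_of_mem_erase hu) ?_
    rw [← hαβ, mul_assoc]
    exact hβ _ (hU.mul_mem u (Finset.mem_of_mem_erase hu))
  simp only [map_mul, map_pow, hα, one_pow, mul_one] at r2 r3
  rw [hM, v.map_sub_swap (℘[L] h₃)] at r2
  rw [v.map_sub_swap (℘[L] h₂), hM] at r3
  rw [← Finset.card_erase_add_one hU.zero_mem] at r2 r3
  set M := v (℘[L] h₂ - ℘[L] h₃)
  set D := v (℘[L] h₁ - ℘[L] h₂)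
  set k := (U.erase 0).card
  set x := v (∏ u ∈ U.erase 0, (℘[L] h₁ - ℘[L] u))
  set y := v (∏ u ∈ U.erase 0, (℘[L] h₂ - ℘[L] u))
  set z := v (∏ u ∈ U.erase 0, (℘[L] h₃ - ℘[L] u))
  have hM0 : 0 < M := zero_le.trans_lt hlt
  have e : D * M * z ^ 2 = M * M ^ (2 * k + 1) := by
    refine mul_right_cancel₀ n1 ?_
    calc D * M * z ^ 2 * x = M * z * (D * x * z) := by rw [sq]; ac_rfl
      _ = M ^ (k + 1) * (M * z * y) := by rw [r3]; ac_rfl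
      _ = M * M ^ (2 * k + 1) * x := by rw [r2, ← mul_assoc, ← pow_add, ← pow_succ']; congr 2; ring
  have h2 : M * M ^ (2 * k + 1) ≤ D * M ^ (2 * k + 1) := by
    rw [← e, mul_assoc]
    gcongr
    calc M * z ^ 2 ≤ M * (M ^ k) ^ 2 := by gcongr
      _ = M ^ (2 * k + 1) := by rw [← pow_mul, ← pow_succ', mul_comm k]
  exact absurd (le_of_mul_le_mul_right h2 (pow_pos hM0 _)) (not_le.2 hlt)

theorem valuation_eq {Γ : Type*} [LinearOrderedCommGroupWithZero Γ] (v : Valuation ℂ Γ)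
    {α : ℂ} (hL : ∀ l ∈ L.lattice, α * l ∈ L.lattice) (h12 : α * h₁ - h₂ ∈ L.lattice)
    (h23 : α * h₂ - h₃ ∈ L.lattice) (h31 : α * h₃ - h₁ ∈ L.lattice) (hα : v α = 1)
    {N : ℕ} (hN : Odd N) (hvN : v N = 1) {β : ℂ} (hαβ : β * α = N)
    (hβ : ∀ l ∈ L.lattice, β * l ∈ L.lattice) :
    v (℘[L] h₁ - ℘[L] h₂) = v (℘[L] h₂ - ℘[L] h₃) ∧
      v (℘[L] h₃ - ℘[L] h₁) = v (℘[L] h₂ - ℘[L] h₃) := by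
  have i1 := H.valuation_not_lt v hL h12 h23 h31 hα hN hvN hαβ hβ
  have i2 := H.rot.valuation_not_lt v hL h23 h31 h12 hα hN hvN hαβ hβ
  have i3 := H.rot.rot.valuation_not_lt v hL h31 h12 h23 hα hN hvN hαβ hβ
  exact ⟨le_antisymm (i3.trans i2) i1, le_antisymm i2 (i1.trans i3)⟩

end HalfTriple
end PeriodPair

open UpperHalfPlane

section
variable {F Γ : Type*} [Field F] [LinearOrderedCommGroupWithZero Γ] (v : Valuation F Γ)

theorem exists_valuationSubring_lt_one [CharZero F] {ℓ : ℕ} (hℓ : ℓ.Prime) :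
    ∃ A : ValuationSubring F, A.valuation (ℓ : F) < 1 := by
  obtain ⟨A, -, hA⟩ := Ideal.image_subset_nonunits_valuationSubring (K := F)
    (A := (Int.castRingHom F).range) (Ideal.span {(ℓ : (Int.castRingHom F).range)}) fun h ↦ by
      obtain ⟨⟨-, n, rfl⟩, hn⟩ := Ideal.mem_span_singleton.1 ((Ideal.eq_top_iff_one _).1 h)
      have hn := congrArg Subtype.val hn
      have : (1 : ℤ) = ℓ * n := by
        apply Int.cast_injective (α := F)
        simpa using hn
      exact hℓ.one_lt.ne' (by simpa using Int.eq_one_of_mul_eq_one_right (by positivity) this.symm)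
  exact ⟨A, A.mem_nonunits_iff.1 <| hA ⟨_, Ideal.mem_span_singleton_self _, by simp⟩⟩

namespace Valuation

theorem intCast_le_one (n : ℤ) : v n ≤ 1 := intCast_mem v.integer n

theorem intCast_eq_one_of_isCoprime {a n : ℤ} (h : IsCoprime a n) (ha : v a < 1) : v n = 1 := by
  refine (v.intCast_le_one n).antisymm (le_of_not_gt fun hn ↦ ?_)
  obtain ⟨s, t, hst⟩ := h
  have h1 : v ((s * a + t * n : ℤ) : F) < 1 := by
    push_cast
    refine v.map_add_lt ?_ ?_ <;> rw [map_mul]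
    · exact mul_lt_one_of_nonneg_of_lt_one_right (v.intCast_le_one s) zero_le ha
    · exact mul_lt_one_of_nonneg_of_lt_one_right (v.intCast_le_one t) zero_le hn
  simp [hst] at h1

theorem not_dvd_den_of_le_one [CharZero F] {ℓ : ℕ} (hv : v ℓ < 1) {r : ℚ}
    (hr : v (r : F) ≤ 1) : ¬ ℓ ∣ r.den := by
  rintro ⟨k, hk⟩
  have h1 : v (r.num : F) = 1 := by
    refine v.intCast_eq_one_of_isCoprime (a := ℓ) ?_ (by simpa using hv)
    exact (Nat.isCoprime_iff_coprime.2
      (r.reduced.symm.coprime_dvd_left ⟨k, hk⟩)).of_isCoprime_of_dvd_right (by simp)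
  have h2 : (r.num : F) = r * (ℓ * k) := by
    have hd : (r.den : F) ≠ 0 := Nat.cast_ne_zero.2 r.den_ne_zero
    rw [← Nat.cast_mul, ← hk, Rat.cast_def, div_mul_cancel₀ _ hd]
  rw [h2, map_mul, map_mul] at h1
  have h3 : v (k : F) ≤ 1 := by exact_mod_cast v.intCast_le_one k
  exact (mul_lt_one_of_nonneg_of_lt_one_right hr zero_le (mul_lt_one_of_lt_of_le hv h3)).ne h1

theorem le_one_of_sq_eq {t : F} {m : ℤ} (ht : t ^ 2 = t - m) : v t ≤ 1 := by
  by_contra! h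
  have h1 := v.map_sub_le le_rfl ((v.intCast_le_one m).trans h.le)
  rw [← ht, sq, map_mul] at h1
  exact absurd h1 (not_le.2 (lt_mul_of_one_lt_left (zero_lt_one.trans h) h))

theorem eq_one_of_mul_eq_one {a b : F} (ha : v a ≤ 1) (hb : v b ≤ 1) (h : v (b * a) = 1) :
    v a = 1 := by
  refine ha.antisymm ?_
  rw [← h, map_mul]
  exact mul_le_of_le_one_left zero_le hb

theorem le_one_of_four_mul_pow {r : F} (h2 : v 2 = 1) (h : v (4 * r ^ 4 + 2 * r) ≤ 1) :
    v r ≤ 1 := by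
  by_contra! hr
  have h4 : v 4 = 1 := by rw [show (4 : F) = 2 * 2 by norm_num, map_mul, h2, one_mul]
  have h1 : v (2 * r) < v (4 * r ^ 4) := by
    rw [map_mul, map_mul, h2, h4, one_mul, one_mul, map_pow]
    exact lt_self_pow₀ hr (by norm_num)
  rw [v.map_add_eq_of_lt_left h1, map_mul, h4, one_mul, map_pow] at h
  exact absurd h (not_le.2 (one_lt_pow₀ hr (by norm_num)))

theorem le_one_of_sq_add_sq {r x : F} (h2 : v 2 = 1) (hr : v r ≤ 1)
    (h : (x ^ 2 + r) ^ 2 = 2 * r ^ 2 - 2 * x) : v x ≤ 1 := by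
  by_contra! hx
  have h1 : v (x ^ 2 + r) = v x ^ 2 := by
    rw [v.map_add_eq_of_lt_left, map_pow]
    rw [map_pow]
    exact hr.trans_lt (one_lt_pow₀ hx (by norm_num))
  have h3 : v (2 * r ^ 2 - 2 * x) ≤ v x := by
    refine v.map_sub_le ?_ ?_
    · rw [map_mul, h2, one_mul, map_pow]
      exact (pow_le_one₀ zero_le hr).trans hx.le
    · rw [map_mul, h2, one_mul]
  rw [← h, map_pow, h1, ← pow_mul] at h3
  exact absurd h3 (not_le.2 (lt_self_pow₀ hx (by norm_num)))

end Valuation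
end

namespace PeriodPair

theorem HalfTriple.valuation_disc {L : PeriodPair} {h₁ h₂ h₃ : ℂ} (H : L.HalfTriple h₁ h₂ h₃)
    {Γ : Type*} [LinearOrderedCommGroupWithZero Γ] (v : Valuation ℂ Γ) (h2 : v 2 = 1)
    (hv : v (℘[L] h₁ - ℘[L] h₂) = v (℘[L] h₂ - ℘[L] h₃) ∧
      v (℘[L] h₃ - ℘[L] h₁) = v (℘[L] h₂ - ℘[L] h₃)) {δ s : ℂ}
    (hδ : δ ^ 3 = L.g₂ ^ 3 - 27 * L.g₃ ^ 2) (hs : -3 * L.g₂ / 4 = δ * s) : v s ≤ 1 := by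
  obtain ⟨h0, hg2, hg3⟩ := H.g_eq
  have hne := (v.ne_zero_iff).2 (sub_ne_zero.2 H.rot.P_ne)
  set x := ℘[L] h₁ - ℘[L] h₂ with hx
  set y := ℘[L] h₂ - ℘[L] h₃ with hy
  have e1 : δ ^ 3 = 2 ^ 4 * (x * y * (℘[L] h₃ - ℘[L] h₁)) ^ 2 := by
    rw [hδ, hg2, hg3, hx, hy]
    have : ℘[L] h₃ = -℘[L] h₁ - ℘[L] h₂ := by linear_combination h0
    rw [this]
    ring
  have e2 : -3 * L.g₂ / 4 = -(x ^ 2 + (x * y + y ^ 2)) := by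
    rw [hg2, hx, hy]
    have : ℘[L] h₃ = -℘[L] h₁ - ℘[L] h₂ := by linear_combination h0
    rw [this]
    ring
  have e3 : v δ = v y ^ 2 := by
    refine (pow_left_inj₀ zero_le zero_le three_ne_zero).1 ?_
    rw [← map_pow, e1, map_mul, map_pow, h2, one_pow, one_mul, map_pow, map_mul, map_mul, hv.1,
      hv.2,
      ← pow_mul]
    simp only [pow_succ, pow_zero, one_mul, mul_assoc]
  have e4 : v δ * v s ≤ v y ^ 2 := by
    rw [← map_mul, ← hs, e2, Valuation.map_neg]
    refine v.map_add_le ?_ (v.map_add_le ?_ ?_) <;> simp only [map_mul, hv.1, sq, le_refl]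
  rw [e3] at e4
  exact le_of_mul_le_mul_left (by simpa using e4) (pow_pos (zero_lt_iff.2 hne) 2)

/-- Good reduction away from 2 of an elliptic curve with class number one complex multiplication. -/
theorem IsClassOne.valuation_le_one {τ : ℍ} {m : ℤ} (h : IsClassOne τ m) (hm : m % 2 = 1)
    (hm0 : 0 < m) {Γ : Type*} [LinearOrderedCommGroupWithZero Γ] (v : Valuation ℂ Γ) (h2 : v 2 = 1)
    {δ s : ℂ} (hδ : δ ^ 3 = (Λ τ).g₂ ^ 3 - 27 * (Λ τ).g₃ ^ 2)
    (hs : -3 * (Λ τ).g₂ / 4 = δ * s) : v s ≤ 1 := by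
  have hτ := v.le_one_of_sq_eq h.sq
  obtain ⟨k, hk, hvk⟩ : ∃ k : ℤ, (k = 0 ∨ k = 2) ∧ v (m + k : ℤ) = 1 := by
    by_cases h1 : v (m : ℂ) = 1
    · exact ⟨0, by simp, by simpa using h1⟩
    · refine ⟨2, by simp, v.intCast_eq_one_of_isCoprime (a := m) ?_
        ((v.intCast_le_one m).lt_of_ne h1)⟩
      exact ⟨m / 2 + 1, -(m / 2), by
        linear_combination -(1 : ℤ) * Int.mul_ediv_add_emod m 2 + hm⟩
  obtain ⟨N, hN⟩ := Int.eq_ofNat_of_zero_le (a := m + k) (by omega)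
  have hN' : (N : ℂ) = m + k := by exact_mod_cast hN.symm
  rw [hN] at hvk
  have mem (a b : ℤ) : (a + b * τ : ℂ) ∈ (Λ τ).lattice := mem_ofUpperHalfPlane.2 ⟨a, b, rfl⟩
  have hsq := h.sq
  have hkk : (k : ℂ) ^ 2 = 2 * k := by
    obtain rfl | rfl := hk <;> norm_num
  have hprod : (((1 - k : ℤ) : ℂ) + (-1 : ℤ) * τ) * ((-k : ℤ) + (1 : ℤ) * τ) = N := by
    push_cast
    rw [hN']
    linear_combination -hsq + hkk
  have hv1 (a b : ℤ) : v (a + b * τ : ℂ) ≤ 1 := by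
    refine v.map_add_le (v.intCast_le_one a) ?_
    rw [map_mul]
    exact mul_le_one' (v.intCast_le_one b) hτ
  obtain ⟨q, hq⟩ : ∃ q, m = 2 * q + 1 := ⟨m / 2, by omega⟩
  obtain ⟨j, hj⟩ : ∃ j, k = 2 * j := ⟨k / 2, by omega⟩
  have H := halfTriple_ofUpperHalfPlane τ
  have hN1 : v (N : ℂ) = 1 := by exact_mod_cast hvk
  refine H.valuation_disc v h2 (H.valuation_eq v (N := N) (fun l ↦ h.mul_mem (mem (-k) 1)) ?_ ?_ ?_
    ?_ ?_ ?_ hprod (fun l ↦ h.mul_mem (mem (1 - k) (-1)))) hδ hs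
  · convert! mem (-j) 0 using 1
    rw [hj]; push_cast; ring
  · convert! mem (-q - 1) (-j) using 1
    rw [hj] at *; push_cast
    have hq' : (m : ℂ) = 2 * q + 1 := by exact_mod_cast hq
    linear_combination hsq / 2 - hq' / 2
  · convert! mem (-q - 1 - j) (1 - j) using 1
    rw [hj] at *; push_cast
    have hq' : (m : ℂ) = 2 * q + 1 := by exact_mod_cast hq
    linear_combination hsq / 2 - hq' / 2
  · exact v.eq_one_of_mul_eq_one (hv1 _ _) (hv1 _ _) (by rw [hprod, hN1])
  · rw [← Int.odd_coe_nat, Int.odd_iff]; omega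
  · exact hN1

end PeriodPair

namespace Int

theorem eq_or_of_sq_add_add_one_eq_sq {z t : ℤ} (h : z ^ 2 + z + 1 = t ^ 2) : z = 0 ∨ z = -1 := by
  obtain ⟨s, hs0, hs⟩ : ∃ s, 0 ≤ s ∧ z ^ 2 + z + 1 = s ^ 2 := ⟨|t|, abs_nonneg t, by rw [h, sq_abs]⟩
  by_contra! hz
  obtain h1 | h1 : 1 ≤ z ∨ z ≤ -2 := by omega
  · have : z < s := by nlinarith
    nlinarith
  · have : -z - 1 < s := by nlinarith
    nlinarith

theorem sq_of_isCoprime_of_nonneg {a b c : ℤ} (h : IsCoprime a b) (hab : a * b = c ^ 2)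
    (ha : 0 ≤ a) :
    ∃ t, a = t ^ 2 := by
  obtain ⟨t, ht | ht⟩ := sq_of_isCoprime h hab
  · exact ⟨t, ht⟩
  · exact ⟨0, by nlinarith [sq_nonneg t]⟩

theorem isCoprime_three {a : ℤ} (h : a % 3 ≠ 0) : IsCoprime a 3 :=
  ((prime_three.irreducible.coprime_iff_not_dvd).2 (by omega)).symm

theorem sq_le_one_of_pow_six_add_one {z w : ℤ} (h : z ^ 6 + 1 = 2 * w ^ 2) : z ^ 2 ≤ 1 := by
  have h3 : IsCoprime (z ^ 2 + 1) 3 := isCoprime_three (by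
    have : z % 3 = 0 ∨ z % 3 = 1 ∨ z % 3 = 2 := by omega
    obtain h | h | h := this <;> simp [pow_succ, Int.add_emod, Int.mul_emod, h])
  have h1 : IsCoprime (z ^ 4 - z ^ 2 + 1) (z ^ 2 + 1) := by
    rw [show z ^ 4 - z ^ 2 + 1 = 3 + (z ^ 2 + 1) * (z ^ 2 - 2) by ring]
    exact h3.symm.add_mul_left_left _
  obtain ⟨k, hk⟩ := even_mul_pred_self (z ^ 2)
  have h2 : IsCoprime (z ^ 4 - z ^ 2 + 1) 2 := ⟨1, -k, by linear_combination hk⟩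
  obtain ⟨t, ht⟩ := sq_of_isCoprime_of_nonneg (h2.mul_right h1) (c := 2 * w)
    (by linear_combination 2 * h) (by nlinarith [sq_nonneg (z ^ 2 - 1)])
  obtain h | h := eq_or_of_sq_add_add_one_eq_sq (z := -z ^ 2) (t := t)
    (by rw [← ht]; ring) <;> omega

theorem sq_le_one_of_pow_six_sub_one {z w : ℤ} (h : z ^ 6 - 1 = 2 * w ^ 2) : z ^ 2 ≤ 1 := by
  wlog hz : z % 3 ≠ 1 generalizing z
  · rw [← neg_sq]
    exact this (by rw [← h]; ring) (by omega)
  have h3 : IsCoprime (z ^ 2 + z + 1) (z - 1) := by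
    rw [show z ^ 2 + z + 1 = 3 + (z - 1) * (z + 2) by ring]
    exact (isCoprime_three (by omega)).symm.add_mul_left_left _
  obtain ⟨k, hk⟩ := even_mul_succ_self z
  have h2 : IsCoprime (z ^ 2 + z + 1) 2 := ⟨1, -k, by linear_combination hk⟩
  have h1 : IsCoprime (z ^ 2 + z + 1) (z + 1) := ⟨1, -z, by ring⟩
  have h0 : IsCoprime (z ^ 2 + z + 1) (z ^ 2 - z + 1) := by
    have h4 : IsCoprime (z ^ 2 + z + 1) (2 * z) := h2.mul_right ⟨1, -z - 1, by ring⟩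
    rw [show z ^ 2 - z + 1 = -(2 * z) + (z ^ 2 + z + 1) * 1 by ring]
    exact h4.neg_right.add_mul_left_right _
  obtain ⟨t, ht⟩ := sq_of_isCoprime_of_nonneg (h2.mul_right ((h3.mul_right h1).mul_right h0))
    (c := 2 * w)
    (by linear_combination 2 * h) (by nlinarith [sq_nonneg (z + 1)])
  obtain rfl | rfl := eq_or_of_sq_add_add_one_eq_sq ht <;> norm_num

theorem pow_six_of_isCoprime_of_nonneg {a b c : ℤ} (h : IsCoprime a b) (hab : a * b = c ^ 6)
    (ha : 0 ≤ a) : ∃ t, a = t ^ 6 := by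
  obtain ⟨t, ht⟩ := exists_associated_pow_of_mul_eq_pow' h hab
  obtain ht | ht := associated_iff.1 ht
  · exact ⟨t, ht.symm⟩
  · have := Even.pow_nonneg (by decide : Even 6) t
    exact ⟨0, by omega⟩

theorem pow_six_le_one {z : ℤ} (h : z ^ 2 ≤ 1) : z ^ 6 ≤ 1 := by
  rw [show z ^ 6 = (z ^ 2) ^ 3 by ring]
  exact pow_le_one₀ (sq_nonneg z) h

theorem sq_le_one_of_eight_mul_pow_six_add_one {z b : ℤ} (h : 8 * z ^ 6 + 1 = b ^ 2) :
    z ^ 2 ≤ 1 := by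
  wlog hb0 : 0 ≤ b generalizing b
  · exact this (b := -b) (by rw [h]; ring) (by omega)
  suffices z ^ 6 ≤ 1 by
    by_contra! hz
    nlinarith [show z ^ 6 = z ^ 2 * z ^ 2 * z ^ 2 by ring, mul_self_nonneg (z ^ 2)]
  obtain ⟨c, rfl | rfl⟩ := even_or_odd' b
  · ring_nf at h; omega
  have hc : c * (c + 1) = 2 * z ^ 6 := by linarith
  obtain ⟨d, rfl | rfl⟩ := even_or_odd' c
  · have hd : d * (2 * d + 1) = z ^ 6 := by linarith
    have h1 : IsCoprime d (2 * d + 1) := ⟨-2, 1, by ring⟩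
    obtain ⟨s, hs⟩ := pow_six_of_isCoprime_of_nonneg h1 hd (by omega)
    obtain ⟨t, ht⟩ := pow_six_of_isCoprime_of_nonneg h1.symm (by rw [mul_comm, hd]) (by omega)
    have := pow_six_le_one (sq_le_one_of_pow_six_sub_one (w := s ^ 3) (z := t) (by
      rw [← ht, hs]; ring))
    nlinarith
  · have hd : (d + 1) * (2 * d + 1) = z ^ 6 := by linarith
    have h1 : IsCoprime (d + 1) (2 * d + 1) := ⟨2, -1, by ring⟩
    obtain ⟨s, hs⟩ := pow_six_of_isCoprime_of_nonneg h1 hd (by omega)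
    obtain ⟨t, ht⟩ := pow_six_of_isCoprime_of_nonneg h1.symm (by rw [mul_comm, hd]) (by omega)
    have := pow_six_le_one (sq_le_one_of_pow_six_add_one (w := s ^ 3) (z := t) (by
      rw [← ht, ← pow_mul, ← hs]; ring))
    nlinarith

/-- The integral points on Heegner's curve. -/
theorem eq_of_sq_eq_two_mul {X Y : ℤ} (h : Y ^ 2 = 2 * X * (X ^ 3 + 1)) :
    X = 0 ∨ X = -1 ∨ X = 1 ∨ X = 2 := by
  have hc : IsCoprime X (X ^ 3 + 1) := ⟨-X ^ 2, 1, by ring⟩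
  obtain ⟨k, rfl | rfl⟩ := even_or_odd' X
  · have h2 : IsCoprime (2 * k) ((2 * k) ^ 3 + 1) := hc
    have h4 : IsCoprime (4 * k) ((2 * k) ^ 3 + 1) := by
      rw [show 4 * k = 2 * (2 * k) by ring]
      exact IsCoprime.mul_left h2.of_mul_left_left h2
    have hY : 4 * k * ((2 * k) ^ 3 + 1) = Y ^ 2 := by rw [h]; ring
    obtain ⟨a, ha⟩ := sq_of_isCoprime h4 hY
    obtain ⟨b, hb⟩ := sq_of_isCoprime h4.symm (by rw [mul_comm, hY])
    obtain ⟨z, rfl⟩ : (2 : ℤ) ∣ a := prime_two.dvd_of_dvd_pow (n := 2)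
      (by obtain ha | ha := ha <;> [exact ⟨2 * k, by linarith⟩; exact ⟨-2 * k, by linarith⟩])
    obtain ha | ha := ha
    · have hk : k = z ^ 2 := by linarith
      have : 8 * z ^ 6 + 1 = b ^ 2 := by
        obtain hb | hb := hb
        · rw [← hb, hk]; ring
        · rw [hk] at hb
          nlinarith [sq_nonneg b, sq_nonneg (z ^ 3)]
      have := sq_le_one_of_eight_mul_pow_six_add_one this
      have := sq_nonneg z
      omega
    · have hk : k = -z ^ 2 := by linarith
      obtain hb | hb := hb
      · have := pow_nonneg (sq_nonneg z) 3
        have hz : (z ^ 2) ^ 3 ≤ 0 := by rw [hk] at hb; nlinarith [sq_nonneg b]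
        have : z = 0 := by
          have : (z ^ 2) ^ 3 = 0 := by omega
          simpa using this
        simp [hk, this]
      · obtain ⟨c, rfl | rfl⟩ := even_or_odd' b <;> ring_nf at hb <;> omega
  · obtain ⟨c, hc'⟩ : ∃ c, (2 * k + 1) ^ 3 + 1 = 2 * c :=
      ⟨4 * k ^ 3 + 6 * k ^ 2 + 3 * k + 1, by ring⟩
    rw [hc'] at h hc
    obtain ⟨y, rfl⟩ : (2 : ℤ) ∣ Y := prime_two.dvd_of_dvd_pow (n := 2) ⟨_, by rw [h, mul_assoc]⟩
    have hy : (2 * k + 1) * c = y ^ 2 := by linarith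
    obtain ⟨a, ha⟩ := sq_of_isCoprime hc.of_mul_right_right hy
    obtain ⟨b, hb⟩ := sq_of_isCoprime hc.of_mul_right_right.symm (by rw [mul_comm, hy])
    have hX : (2 * k + 1) ^ 2 ≤ 1 := by
      obtain ha | ha := ha
      · have : a ^ 6 + 1 = 2 * b ^ 2 := by
          obtain rfl | rfl := hb
          · rw [← hc', ha]; ring
          · rw [ha] at hc'
            nlinarith [sq_nonneg b, sq_nonneg (a ^ 3)]
        rw [ha]
        nlinarith [sq_le_one_of_pow_six_add_one this, sq_nonneg a]
      · by_cases ha0 : a = 0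
        · subst ha0; omega
        have : a ^ 6 - 1 = 2 * b ^ 2 := by
          rw [ha] at hc'
          obtain rfl | rfl := hb
          · have h0 : 0 < a ^ 6 := by positivity
            nlinarith [sq_nonneg b]
          · linear_combination -hc'
        rw [ha]
        nlinarith [sq_le_one_of_pow_six_sub_one this, sq_nonneg a]
    have : k ≤ 0 := by nlinarith
    have : -1 ≤ k := by nlinarith
    omega

end Int

theorem Rat.exists_int_of_sq_eq {z : ℚ} {n : ℤ} (h : z ^ 2 = n) : ∃ k : ℤ, z = k := by
  have h1 : z.den ^ 2 = 1 := by rw [← Rat.den_pow, h, Rat.den_intCast]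
  exact ⟨z.num, (Rat.den_eq_one_iff z).1 (by simpa using h1) |>.symm⟩

theorem Rat.exists_int_of_sq_add_sq {r x : ℚ} (h : (x ^ 2 + r) ^ 2 = 2 * r ^ 2 - 2 * x)
    (hx : ∀ ℓ : ℕ, ℓ.Prime → ℓ ≠ 2 → ¬ ℓ ∣ x.den) :
    ∃ X Y : ℤ, r = Y + X ^ 2 ∧ Y ^ 2 = 2 * X * (X ^ 3 + 1) := by
  have hd : (x.den : ℚ) ≠ 0 := Nat.cast_ne_zero.2 x.den_ne_zero
  have hxd : x * x.den = x.num := x.mul_den_eq_num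
  have h1 : (r - x ^ 2) ^ 2 = 2 * x * (x ^ 3 + 1) := by linear_combination -h
  have h2 : ((r - x ^ 2) * x.den ^ 2) ^ 2 = (2 * x.num * (x.num ^ 3 + x.den ^ 3) : ℤ) := by
    push_cast
    rw [mul_pow, h1, ← hxd]
    ring
  obtain ⟨s, hs⟩ := Rat.exists_int_of_sq_eq h2
  have hs2 : s ^ 2 = 2 * x.num * (x.num ^ 3 + x.den ^ 3) := by
    rw [hs] at h2
    exact_mod_cast h2
  have hden : x.den = 1 := by
    by_contra hne
    obtain ⟨ℓ, hℓ, hdvd⟩ := Nat.exists_prime_and_dvd hne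
    obtain rfl | h2 := eq_or_ne ℓ 2
    · obtain ⟨k, hk⟩ := hdvd
      rw [hk] at hs2
      push_cast at hs2
      obtain ⟨t, rfl⟩ : (2 : ℤ) ∣ s :=
        Int.prime_two.dvd_of_dvd_pow (n := 2) ⟨_, by rw [hs2, mul_assoc]⟩
      have : (2 : ℤ) ∣ x.num := Int.prime_two.dvd_of_dvd_pow (n := 4)
        ⟨t ^ 2 - 4 * x.num * k ^ 3, by linarith⟩
      have h3 := Nat.dvd_gcd (Int.natCast_dvd.1 (by exact_mod_cast this)) ⟨k, hk⟩
      rw [x.reduced] at h3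
      exact absurd h3 (by norm_num)
    · exact hx ℓ hℓ h2 hdvd
  have hxX : x = x.num := by rw [← hxd, hden]; simp
  set X := x.num
  rw [hxX] at h1
  obtain ⟨Y, hY⟩ := Rat.exists_int_of_sq_eq (z := r - X ^ 2) (n := 2 * X * (X ^ 3 + 1)) (by
    rw [h1]; push_cast; ring)
  refine ⟨X, Y, by rw [← hY]; ring, ?_⟩
  rw [hY] at h1
  exact_mod_cast h1

theorem Int.sq_add_bound {X Y : ℤ} (h : Y ^ 2 = 2 * X * (X ^ 3 + 1)) : |Y + X ^ 2| ≤ 10 := by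
  obtain rfl | rfl | rfl | rfl := Int.eq_of_sq_eq_two_mul h
  · simp_all
  · simp_all
  · have := abs_le_of_sq_le_sq (a := Y) (b := 2) (by omega) (by norm_num)
    rw [abs_le] at *
    omega
  · have := abs_le_of_sq_le_sq (a := Y) (b := 6) (by omega) (by norm_num)
    rw [abs_le] at *
    omega

namespace PeriodPair

theorem IsClassOne.norm_E₄_le {τ : ℍ} {m : ℤ} (h : IsClassOne τ m) (hm : m % 6 = 5) (hm0 : 0 < m) :
    ‖ModularForm.E₄ τ‖ ^ 3 ≤ 640320 ^ 3 * ‖ModularForm.discriminant τ‖ := by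
  obtain ⟨r, x, δ, hδ, hrx, hs⟩ := h.exists_rat hm
  obtain ⟨X, Y, hr, hXY⟩ := Rat.exists_int_of_sq_add_sq hrx fun ℓ hℓ h2 ↦ by
    obtain ⟨A, hA⟩ := exists_valuationSubring_lt_one (F := ℂ) hℓ
    have hv2 : A.valuation 2 = 1 := by
      have := A.valuation.intCast_eq_one_of_isCoprime (a := ℓ) (n := 2)
        (by
          have := (Nat.coprime_primes hℓ Nat.prime_two).2 h2
          exact_mod_cast Nat.isCoprime_iff_coprime.2 this) (by exact_mod_cast hA)
      exact_mod_cast this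
    refine A.valuation.not_dvd_den_of_le_one hA (A.valuation.le_one_of_sq_add_sq (r := r) hv2 ?_ ?_)
    · exact A.valuation.le_one_of_four_mul_pow hv2
        (h.valuation_le_one (by omega) hm0 A.valuation hv2 hδ hs)
    · exact_mod_cast congrArg (fun q : ℚ ↦ (q : ℂ)) hrx
  have hr10 : ‖(r : ℂ)‖ ≤ 10 := by
    rw [hr]
    have := Int.sq_add_bound hXY
    have e : (((Y : ℚ) + X ^ 2 : ℚ) : ℂ) = ((Y + X ^ 2 : ℤ) : ℂ) := by push_cast; rfl
    rw [e, Complex.norm_intCast]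
    exact_mod_cast this
  have hs1 : ‖(4 * r ^ 4 + 2 * r : ℂ)‖ ≤ 40020 := by
    refine (norm_add_le _ _).trans ?_
    rw [norm_mul, norm_mul, norm_pow]
    norm_num
    have := pow_le_pow_left₀ (norm_nonneg _) hr10 4
    norm_num at this hr10
    linarith
  rw [g₂_cube_sub] at hδ
  rw [g₂_ofUpperHalfPlane] at hs
  have hd : δ ^ 3 = (16 * Real.pi ^ 4 : ℂ) ^ 3 * ModularForm.discriminant τ := by rw [hδ]; ring
  have hd' := congrArg norm hd
  have hs' : Real.pi ^ 4 * ‖ModularForm.E₄ τ‖ = ‖δ‖ * ‖(4 * r ^ 4 + 2 * r : ℂ)‖ := by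
    rw [← norm_mul, ← hs, ← norm_neg]
    have : ‖(Real.pi ^ 4 : ℂ)‖ = Real.pi ^ 4 := by simp [abs_of_pos Real.pi_pos]
    rw [← this, ← norm_mul]
    congr 1
    ring
  rw [norm_mul, norm_pow, norm_pow] at hd'
  have h16 : ‖(16 * Real.pi ^ 4 : ℂ)‖ = 16 * Real.pi ^ 4 := by simp [abs_of_pos Real.pi_pos]
  rw [h16] at hd'
  have hle : Real.pi ^ 4 * ‖ModularForm.E₄ τ‖ ≤ ‖δ‖ * 40020 := by
    rw [hs']
    gcongr
  have := pow_le_pow_left₀ (by positivity) hle 3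
  rw [mul_pow, mul_pow, hd'] at this
  have hpi : 0 < (Real.pi ^ 4) ^ 3 := by positivity
  refine le_of_mul_le_mul_left ?_ hpi
  linarith

end PeriodPair

namespace ModularForm
open EisensteinSeries Complex
open scoped ArithmeticFunction.sigma

theorem norm_E_sub_one_le {k : ℕ} (hk : 3 ≤ k) (hk2 : Even k) (z : ℍ)
    (hz : 2 ^ (k + 1) * ‖cexp (2 * Real.pi * Complex.I * z)‖ ≤ 1) :
    ‖E hk z - 1‖ ≤ ‖(2 * k / bernoulli k : ℂ)‖ * (2 * ‖cexp (2 * Real.pi * Complex.I * z)‖) := by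
  rw [q_expansion_bernoulli hk hk2 z, sub_sub_cancel_left, norm_neg, norm_mul]
  simp_rw [zpow_natCast]
  set q := cexp (2 * Real.pi * Complex.I * z)
  rw [tsum_pnat_eq_tsum_succ (f := fun n ↦ (σ (k - 1) n : ℂ) * q ^ n)]
  gcongr
  have hr : 2 ^ k * ‖q‖ ≤ 1 / 2 := by rw [pow_succ] at hz; linarith
  have hg := (hasSum_geometric_of_lt_one (r := 2 ^ k * ‖q‖) (by positivity)
    (by linarith)).mul_left ‖q‖
  refine (tsum_of_norm_bounded hg fun n ↦ ?_).trans ?_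
  · rw [norm_mul, norm_pow, Complex.norm_natCast, mul_pow, pow_succ' ‖q‖]
    have h : (σ (k - 1) (n + 1) : ℝ) ≤ (2 ^ k) ^ n := by
      have h1 := ArithmeticFunction.sigma_le_pow_succ (k - 1) (n + 1)
      rw [Nat.sub_add_cancel (by lia)] at h1
      have h2 : (n + 1) ^ k ≤ (2 ^ n) ^ k := by
        gcongr
        exact Nat.lt_two_pow_self
      rw [← pow_mul, mul_comm, pow_mul]
      exact_mod_cast h1.trans h2
    calc _ ≤ (2 ^ k) ^ n * (‖q‖ * ‖q‖ ^ n) := by gcongr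
      _ = _ := by ring
  · rw [mul_comm]
    gcongr
    rw [inv_le_comm₀ (by linarith) two_pos]
    linarith

theorem discriminant_mul_lt_norm_E₄ {z : ℍ} (hz : 67 / 10 ≤ z.im) :
    640320 ^ 3 * ‖discriminant z‖ < ‖E₄ z‖ ^ 3 := by
  set q := cexp (2 * Real.pi * Complex.I * z) with hq
  have hqn : ‖q‖ * 10 ^ 18 ≤ 1 := by
    have h1 : ‖q‖ = Real.exp (-(2 * Real.pi * z.im)) := by
      rw [hq, Complex.norm_exp]
      simp
    have h2 : (42 : ℝ) ≤ 2 * Real.pi * z.im := by nlinarith [Real.pi_gt_d2]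
    have h3 : Real.exp (42 : ℝ) = Real.exp 1 ^ 42 := by
      rw [← Real.exp_nat_mul]
      norm_num
    have h4 : (10 : ℝ) ^ 18 ≤ Real.exp (2 * Real.pi * z.im) := calc
      _ ≤ (2.718 : ℝ) ^ 42 := by norm_num
      _ ≤ Real.exp 1 ^ 42 := by
        gcongr
        linarith [Real.exp_one_gt_d9]
      _ ≤ _ := h3 ▸ Real.exp_le_exp.2 h2
    rw [h1, Real.exp_neg, inv_mul_le_iff₀ (Real.exp_pos _), mul_one]
    exact h4
  have h4 : ‖E₄ z - 1‖ ≤ 480 * ‖q‖ := by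
    have h := norm_E_sub_one_le (k := 4) (by norm_num) ⟨2, rfl⟩ z (by norm_num; linarith)
    rw [show bernoulli 4 = -1 / 30 by decide +kernel] at h
    norm_num at h
    change ‖E₄ z - 1‖ ≤ _ at h
    linarith
  have h6 : ‖E₆ z - 1‖ ≤ 1008 * ‖q‖ := by
    have h := norm_E_sub_one_le (k := 6) (by norm_num) ⟨3, rfl⟩ z (by norm_num; linarith)
    rw [show bernoulli 6 = 1 / 42 by decide +kernel] at h
    norm_num at h
    change ‖E₆ z - 1‖ ≤ _ at h
    linarith
  have hΔ : ‖discriminant z‖ ≤ 3 * ‖q‖ := by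
    rw [discriminant_eq_E₄_cube_sub_E₆_sq, norm_div, div_le_iff₀ (by norm_num)]
    obtain ⟨a, ha⟩ : ∃ a, a = E₄ z - 1 := ⟨_, rfl⟩
    obtain ⟨b, hb⟩ : ∃ b, b = E₆ z - 1 := ⟨_, rfl⟩
    rw [← ha] at h4
    rw [← hb] at h6
    have h : E₄ z ^ 3 - E₆ z ^ 2 = a * (3 + 3 * a + a ^ 2) - b * (2 + b) := by
      rw [ha, hb]
      ring
    have h1 : ‖3 + 3 * a + a ^ 2‖ ≤ 3 + 3 * ‖a‖ + ‖a‖ ^ 2 := by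
      refine (norm_add₃_le).trans ?_
      simp
    have h2 : ‖2 + b‖ ≤ 2 + ‖b‖ := by
      refine (norm_add_le _ _).trans ?_
      simp
    rw [h]
    refine (norm_sub_le _ _).trans ?_
    rw [norm_mul, norm_mul]
    have := norm_nonneg a
    have := norm_nonneg b
    have := norm_nonneg q
    norm_num
    calc _ ≤ 480 * ‖q‖ * (31 / 10) + 1008 * ‖q‖ * (21 / 10) := by
          gcongr
          · refine h1.trans ?_
            nlinarith
          · linarith
      _ ≤ _ := by linarith
  have hE : (99 / 100 : ℝ) ≤ ‖E₄ z‖ := by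
    have := norm_sub_norm_le 1 (1 - E₄ z)
    rw [norm_sub_rev 1 (E₄ z), norm_one, sub_sub_cancel] at this
    linarith
  have := pow_le_pow_left₀ (by norm_num) hE 3
  norm_num at this ⊢
  linarith

end ModularForm

theorem PeriodPair.IsClassOne.lt_of_mod_six {τ : ℍ} {m : ℤ} (h : IsClassOne τ m)
    (hm : m % 6 = 5) (hm0 : 0 < m) : m < 47 := by
  by_contra! hm47
  refine (h.norm_E₄_le hm hm0).not_gt (ModularForm.discriminant_mul_lt_norm_E₄ ?_)
  have hsq := h.sq
  rw [_root_.sq] at hsq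
  have hre := congrArg Complex.re hsq
  have him := congrArg Complex.im hsq
  simp at hre him
  have hpos := τ.im_pos
  have h1 : τ.re = 1 / 2 := mul_right_cancel₀ hpos.ne' (by linarith)
  have h2 : (47 : ℝ) ≤ m := by exact_mod_cast hm47
  rw [h1] at hre
  nlinarith

theorem Algebra.exists_basis_fin_two_eq_one {R : Type*} [CommRing R]
    (b : Module.Basis (Fin 2) ℤ R) :
    ∃ b' : Module.Basis (Fin 2) ℤ R, b' 0 = 1 := by
  have h1 : 1 = b.repr 1 0 • b 0 + b.repr 1 1 • b 1 := by
    conv_lhs => rw [← b.sum_repr 1, Fin.sum_univ_two]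
  obtain ⟨p, hp⟩ : ∃ p, p = b.repr 1 0 := ⟨_, rfl⟩
  obtain ⟨q, hq⟩ : ∃ q, q = b.repr 1 1 := ⟨_, rfl⟩
  rw [← hp, ← hq] at h1
  have hcop : IsCoprime p q := by
    rw [Int.isCoprime_iff_gcd_eq_one]
    obtain ⟨x, hx⟩ := Int.gcd_dvd_left p q
    obtain ⟨y, hy⟩ := Int.gcd_dvd_right p q
    have h2 : ((Int.gcd p q : ℤ) : R) * (x • b 0 + y • b 1) = 1 := by
      rw [← zsmul_eq_mul, smul_add, smul_smul, smul_smul, ← hx, ← hy, ← h1]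
    have h3 := congrArg (Algebra.norm ℤ) h2
    rw [map_mul, map_one (Algebra.norm ℤ), ← eq_intCast (algebraMap ℤ R),
      Algebra.norm_algebraMap_of_basis b,
      Fintype.card_fin] at h3
    have h4 := Int.isUnit_iff.1 ((isUnit_pow_iff two_ne_zero).1 (IsUnit.of_mul_eq_one _ h3))
    lia
  obtain ⟨u, v, huv⟩ := hcop
  have huv' := congrArg (Int.cast (R := R)) huv
  simp only [zsmul_eq_mul] at h1
  push_cast at huv'
  have hli : LinearIndependent ℤ ![(1 : R), u • b 1 - v • b 0] := by
    rw [LinearIndependent.pair_iff]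
    intro s t hst
    have h2 (i : Fin 2) := DFunLike.congr_fun (congrArg b.repr hst) i
    have h3 := h2 0
    have h4 := h2 1
    simp [-zsmul_eq_mul, -zsmul_one, ← hp, ← hq] at h3 h4
    constructor
    · linear_combination -s * huv + u * h3 + v * h4
    · linear_combination -t * huv - q * h3 + p * h4
  refine ⟨Module.Basis.mk hli fun x _ ↦ ?_, by simp⟩
  rw [Matrix.range_cons, Matrix.range_cons, Matrix.range_empty, Set.union_empty,
    Set.singleton_union, Submodule.mem_span_pair]
  refine ⟨b.repr x 0 * u + b.repr x 1 * v, - b.repr x 0 * q + b.repr x 1 * p, ?_⟩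
  conv_rhs => rw [← b.sum_repr x, Fin.sum_univ_two]
  simp only [zsmul_eq_mul]
  push_cast
  rw [h1]
  linear_combination (b.repr x 0 * b 0 + b.repr x 1 * b 1) * huv'

theorem Algebra.discr_of_basis_fin_two {R : Type*} [CommRing R] (b : Module.Basis (Fin 2) ℤ R)
    (h0 : b 0 = 1) {t m : ℤ} (h1 : b 1 ^ 2 = t * b 1 - m) :
    Algebra.discr ℤ b = t ^ 2 - 4 * m := by
  have tr1 : Algebra.trace ℤ R 1 = 2 := by
    simpa using Algebra.trace_algebraMap_of_basis b 1
  have e2 : b 1 * b 1 = t • b 1 - m • b 0 := by rw [← sq, h1, h0]; simp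
  have tr2 : Algebra.trace ℤ R (b 1) = t := by
    rw [Algebra.trace_eq_matrix_trace b, Matrix.trace_fin_two,
      Algebra.leftMulMatrix_eq_repr_mul, Algebra.leftMulMatrix_eq_repr_mul, h0, mul_one, e2,
      map_sub,
      map_zsmul, map_zsmul]
    simp
  have tr3 : Algebra.trace ℤ R (b 1 * b 1) = t ^ 2 - 2 * m := by
    rw [e2, h0, map_sub, map_zsmul, map_zsmul, tr1, tr2]
    simp
    ring
  rw [Algebra.discr_def, Matrix.det_fin_two]
  simp only [Algebra.traceMatrix_apply, Algebra.traceForm_apply, h0, mul_one, one_mul, tr1, tr2,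
    tr3]
  ring

namespace NumberField

theorem exists_sq_eq_of_finrank_eq_two {K : Type*} [Field K] [NumberField K]
    (hdeg : Module.finrank ℚ K = 2) :
    ∃ (θ : 𝓞 K) (e m : ℤ), (e = 0 ∨ e = 1) ∧ θ ^ 2 = e * θ - m ∧ discr K = e ^ 2 - 4 * m ∧
      ∀ x, ∃ a b : ℤ, x = a + b * θ := by
  obtain ⟨b, h0⟩ := Algebra.exists_basis_fin_two_eq_one
    (Module.finBasisOfFinrankEq ℤ (𝓞 K) ((RingOfIntegers.rank K).trans hdeg))
  have hsum (x : 𝓞 K) : x = b.repr x 0 + b.repr x 1 * b 1 := by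
    conv_lhs => rw [← b.sum_repr x, Fin.sum_univ_two, h0]
    simp
  obtain ⟨m, hm⟩ : ∃ m : ℤ, -m = b.repr (b 1 ^ 2) 0 := ⟨_, neg_neg _⟩
  obtain ⟨t, ht⟩ : ∃ t, t = b.repr (b 1 ^ 2) 1 := ⟨_, rfl⟩
  have hsq := hsum (b 1 ^ 2)
  rw [← hm, ← ht] at hsq
  push_cast at hsq
  have hd := Algebra.discr_of_basis_fin_two b h0 (t := t) (m := m) (by linear_combination hsq)
  rw [discr_eq_discr] at hd
  have ht2 := Int.mul_ediv_add_emod t 2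
  obtain ⟨k, hk⟩ : ∃ k, k = t / 2 := ⟨_, rfl⟩
  have he := Int.emod_two_eq_zero_or_one t
  obtain ⟨e, he'⟩ : ∃ e, e = t % 2 := ⟨_, rfl⟩
  rw [← hk, ← he'] at ht2
  rw [← he'] at he
  subst ht2
  refine ⟨b 1 - k, e, m - k ^ 2 - e * k, he, ?_, ?_, fun x ↦
    ⟨b.repr x 0 + b.repr x 1 * k, b.repr x 1, ?_⟩⟩
  · push_cast at hsq ⊢
    linear_combination hsq
  · rw [hd]
    ring
  · conv_lhs => rw [hsum x]
    push_cast
    ring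

end NumberField

namespace PeriodPair

theorem exists_norm_eq {τ : ℍ} {e m : ℤ} (hsq : (τ : ℂ) ^ 2 = e * τ - m)
    (hmul : ∀ L : PeriodPair, (∀ l ∈ L.lattice, (τ : ℂ) * l ∈ L.lattice) →
      ∃ c : ℂ, c ≠ 0 ∧ ∀ z, c * z ∈ L.lattice ↔ z ∈ (Λ τ).lattice)
    {q : ℤ} (r : ℤ) (hq : 0 < q) (hr : q ∣ r ^ 2 - e * r + m) :
    ∃ a b : ℤ, a ^ 2 + e * a * b + m * b ^ 2 = q := by
  have him := τ.im_pos
  have hq' : (0 : ℝ) < q := by exact_mod_cast hq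
  obtain ⟨k, hk⟩ := hr
  have hre : 2 * τ.re = e := by
    have h := congrArg Complex.im hsq
    simp [sq] at h
    exact mul_right_cancel₀ him.ne' (by linarith)
  have hnorm : τ.re ^ 2 + τ.im ^ 2 = m := by
    have h := congrArg Complex.re hsq
    simp [sq] at h
    linear_combination -h + τ.re * hre
  let L : PeriodPair :=
    { ω₁ := q
      ω₂ := τ - r
      indep := by
        rw [LinearIndependent.pair_iff]
        intro s t hst
        have h := congrArg Complex.im hst
        simp at h
        obtain rfl : t = 0 := h.resolve_right him.ne'
        simpa [hq.ne'] using hst }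
  have hL (z : ℂ) : z ∈ L.lattice ↔ ∃ x y : ℤ, x * (q : ℂ) + y * (τ - r) = z := mem_lattice
  obtain ⟨c, hc, h⟩ := hmul L fun l hl ↦ by
    obtain ⟨x, y, rfl⟩ := (hL _).1 hl
    refine (hL _).2 ⟨x * r - y * k, x * q + y * (e - r), ?_⟩
    have hk' := congrArg (Int.cast (R := ℂ)) hk
    push_cast at hk' ⊢
    linear_combination y * hk' - y * hsq
  obtain ⟨x, y, h1⟩ := (hL _).1 ((h 1).2 (mem_ofUpperHalfPlane.2 ⟨1, 0, by simp⟩))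
  obtain ⟨x', y', h2⟩ := (hL _).1 ((h τ).2 (mem_ofUpperHalfPlane.2 ⟨0, 1, by simp⟩))
  obtain ⟨s, t, h3⟩ := mem_ofUpperHalfPlane.1 ((h (q / c)).1 ((hL _).2
    ⟨1, 0, by field_simp; simp⟩))
  obtain ⟨s', t', h4⟩ := mem_ofUpperHalfPlane.1 ((h ((τ - r) / c)).1 ((hL _).2
    ⟨0, 1, by field_simp; simp⟩))
  rw [eq_div_iff hc] at h3 h4
  have hN : 0 < c.re ^ 2 + c.im ^ 2 := by
    rw [← Complex.sq_norm_sub_sq_re c, add_sub_cancel]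
    positivity
  have r1 := congrArg Complex.re h1
  have i1 := congrArg Complex.im h1
  have r2 := congrArg Complex.re h2
  have i2 := congrArg Complex.im h2
  have r3 := congrArg Complex.re h3
  have i3 := congrArg Complex.im h3
  have r4 := congrArg Complex.re h4
  have i4 := congrArg Complex.im h4
  simp at r1 i1 r2 i2 r3 i3 r4 i4
  have d1 : (x * y' - x' * y : ℝ) * q = c.re ^ 2 + c.im ^ 2 := by
    refine mul_right_cancel₀ him.ne' ?_
    have : c.re * (c.re * τ.im + c.im * τ.re) - c.im * (c.re * τ.re - c.im * τ.im) =
      (x * y' - x' * y : ℝ) * q * τ.im := by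
      rw [← i2, ← r2, ← r1, ← i1]
      ring
    linear_combination -this
  have d2 : (s * t' - s' * t : ℝ) * (c.re ^ 2 + c.im ^ 2) = q := by
    refine mul_right_cancel₀ him.ne' ?_
    have p1 := congrArg₂ (· * ·) r3 i4
    have p2 := congrArg₂ (· * ·) i3 r4
    linear_combination p1 - p2
  have h_int : (x * y' - x' * y) * (s * t' - s' * t) = 1 := by
    have : (x * y' - x' * y : ℝ) * (s * t' - s' * t) = 1 := by
      refine mul_right_cancel₀ hq'.ne' ?_
      linear_combination (s * t' - s' * t : ℝ) * d1 + d2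
    exact_mod_cast this
  have hpos : 0 < x * y' - x' * y := by
    have : (0 : ℝ) < x * y' - x' * y := pos_of_mul_pos_left (d1 ▸ hN) hq'.le
    exact_mod_cast this
  have hdet : x * y' - x' * y = 1 :=
    (Int.isUnit_iff.1 (IsUnit.of_mul_eq_one _ h_int)).resolve_right (by lia)
  have hdet' : (x * y' - x' * y : ℝ) = 1 := by exact_mod_cast hdet
  refine ⟨x * q - y * r, y, ?_⟩
  have : ((x * q - y * r : ℝ)) ^ 2 + e * (x * q - y * r) * y + m * y ^ 2 = q := by
    rw [hdet', one_mul, ← r1, ← i1] at d1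
    rw [← hre, ← hnorm]
    linear_combination -d1
  exact_mod_cast this

end PeriodPair

namespace NumberField
open PeriodPair

theorem exists_mul_of_classNumber_eq_one {K : Type*} [Field K] [NumberField K]
    (hcl : classNumber K = 1) (φ : K →+* ℂ) {τ : ℍ} {θ : 𝓞 K} (hθ : φ θ = τ)
    (hO : ∀ x : 𝓞 K, ∃ a b : ℤ, x = a + b * θ) (L : PeriodPair)
    (hL : ∀ l ∈ L.lattice, (τ : ℂ) * l ∈ L.lattice) :
    ∃ c : ℂ, c ≠ 0 ∧ ∀ z, c * z ∈ L.lattice ↔ z ∈ (ofUpperHalfPlane τ).lattice := by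
  have := classNumber_eq_one_iff.1 hcl
  have hmem (z : ℂ) : z ∈ (ofUpperHalfPlane τ).lattice ↔ ∃ x : 𝓞 K, φ x = z := by
    rw [mem_ofUpperHalfPlane]
    constructor
    · rintro ⟨a, b, rfl⟩
      exact ⟨a + b * θ, by simp [hθ]⟩
    · rintro ⟨x, rfl⟩
      obtain ⟨a, b, rfl⟩ := hO x
      exact ⟨a, b, by simp [hθ]⟩
  have hsmul (x : 𝓞 K) {l : ℂ} (hl : l ∈ L.lattice) : φ x * l ∈ L.lattice := by
    obtain ⟨a, b, rfl⟩ := hO x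
    have := add_mem (L.lattice.smul_mem a hl) (L.lattice.smul_mem b (hL l hl))
    simp only [zsmul_eq_mul] at this
    simpa [hθ, add_mul, mul_assoc] using this
  have hω : L.ω₁ ≠ 0 := L.indep.ne_zero 0
  obtain ⟨p, u, hpu⟩ := mem_lattice.1 (hL _ L.ω₁_mem_lattice)
  have hu : u ≠ 0 := by
    rintro rfl
    have h1 : (p : ℂ) = τ := mul_right_cancel₀ hω (by simpa using hpu)
    simpa [τ.im_pos.ne] using congrArg Complex.im h1
  have hu' : (u : ℂ) ≠ 0 := Int.cast_ne_zero.2 hu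
  have hsub {l : ℂ} (hl : l ∈ L.lattice) : ∃ x : 𝓞 K, φ x * (L.ω₁ / u) = l := by
    obtain ⟨a, b, rfl⟩ := mem_lattice.1 hl
    refine ⟨a * u + b * (θ - p), ?_⟩
    simp only [map_add, map_mul, map_sub, map_intCast, hθ]
    field_simp
    linear_combination -b * hpu
  let J : Ideal (𝓞 K) :=
    { carrier := {x | φ x * (L.ω₁ / u) ∈ L.lattice}
      add_mem' := fun ha hb ↦ by simpa [add_mul] using add_mem ha hb
      zero_mem' := by simp
      smul_mem' := fun x y hy ↦ by simpa [mul_assoc] using hsmul x hy }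
  obtain ⟨α, hα⟩ := (IsPrincipalIdealRing.principal J).principal
  have hJ (x : 𝓞 K) : φ x * (L.ω₁ / u) ∈ L.lattice ↔ ∃ y, y * α = x := by
    rw [← Ideal.mem_span_singleton', ← Ideal.submodule_span_eq, ← hα]
    rfl
  have hα0 : φ α ≠ 0 := by
    obtain ⟨y, hy⟩ := (hJ u).1 (by simpa [mul_div_cancel₀ _ hu'] using L.ω₁_mem_lattice)
    intro h0
    refine hu' ?_
    have := congrArg (fun x : 𝓞 K ↦ φ x) hy
    simpa [h0] using this.symm
  refine ⟨φ α * (L.ω₁ / u), mul_ne_zero hα0 (div_ne_zero hω hu'), fun z ↦ ?_⟩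
  rw [hmem]
  constructor
  · intro hz
    obtain ⟨x, hx⟩ := hsub hz
    obtain ⟨y, rfl⟩ := (hJ x).1 (hx ▸ hz)
    refine ⟨y, mul_left_cancel₀ (mul_ne_zero hα0 (div_ne_zero hω hu')) ?_⟩
    rw [← hx]
    simp
    ring
  · rintro ⟨x, rfl⟩
    have := (hJ (x * α)).2 ⟨x, rfl⟩
    convert! this using 1
    simp
    ring

end NumberField

/-- The class number one problem: an imaginary quadratic field with class number 1
has discriminant in `{-3, -4, -7, -8, -11, -19, -43, -67, -163}`. -/
theorem class_number_one_problem (K : Type*) [Field K] [NumberField K]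
    (hdeg : Module.finrank ℚ K = 2) (hdisc : NumberField.discr K < 0)
    (hcl : NumberField.classNumber K = 1) :
    NumberField.discr K ∈
      ({-3, -4, -7, -8, -11, -19, -43, -67, -163} : Set ℤ) := by
  obtain ⟨θ, e, m, he, hsq, hd, hO⟩ := NumberField.exists_sq_eq_of_finrank_eq_two hdeg
  rw [hd] at hdisc
  obtain ⟨φ, hφ⟩ : ∃ φ : K →+* ℂ, 0 < (φ θ).im := by
    obtain ⟨φ⟩ : Nonempty (K →+* ℂ) := inferInstance
    have h0 : (φ θ).im ≠ 0 := by
      intro h0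
      have h1 : (φ θ) ^ 2 = e * φ θ - m := by
        have := congrArg (fun x : NumberField.RingOfIntegers K ↦ φ x) hsq
        simpa using this
      have h2 := congrArg Complex.re h1
      simp [sq, h0] at h2
      have h3 : (e ^ 2 - 4 * m : ℝ) < 0 := by exact_mod_cast hdisc
      nlinarith [sq_nonneg (2 * (φ θ).re - e)]
    rcases h0.lt_or_gt with h0 | h0
    · exact ⟨NumberField.ComplexEmbedding.conjugate φ, by simpa using h0⟩
    · exact ⟨φ, h0⟩
  obtain ⟨τ, hτ⟩ : ∃ τ : ℍ, φ θ = τ := ⟨⟨φ θ, hφ⟩, rfl⟩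
  have hτsq : (τ : ℂ) ^ 2 = e * τ - m := by
    have := congrArg (fun x : NumberField.RingOfIntegers K ↦ φ x) hsq
    simpa [hτ] using this
  have hmul := NumberField.exists_mul_of_classNumber_eq_one hcl φ hτ hO
  have key {q : ℤ} (r : ℤ) := PeriodPair.exists_norm_eq hτsq hmul (q := q) r
  clear hO hsq
  rw [hd]
  simp only [Set.mem_insert_iff, Set.mem_singleton_iff]
  rcases he with rfl | rfl
  · obtain ⟨a, b, hab⟩ := key (q := 2) m (by norm_num) (by
      have := Int.even_mul_succ_self m
      rw [even_iff_two_dvd] at this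
      convert! this using 1
      ring)
    have hm : m ≤ 2 := by
      by_contra! hm
      obtain rfl : b = 0 := by
        by_contra hb
        have : 0 < b ^ 2 := by positivity
        nlinarith [sq_nonneg a]
      have : -2 < a := by nlinarith
      have : a < 2 := by nlinarith
      interval_cases a <;> simp at hab
    have : 0 < m := by linarith
    interval_cases m <;> simp
  · have hm0 : 0 < m := by linarith
    have hbound {q : ℤ} (r : ℤ) (hq : 0 < q) (hr : q ∣ r ^ 2 - r + m) (hq2 : ¬ IsSquare q) :
        4 * m ≤ 4 * q + 1 := by
      obtain ⟨a, b, hab⟩ := key r hq (by simpa using hr)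
      have hb : b ≠ 0 := by
        rintro rfl
        exact hq2 ⟨a, by linarith⟩
      have hb2 : 0 < b ^ 2 := by positivity
      have ha : a ≠ 0 ∨ 2 * a + b ≠ 0 := by lia
      nlinarith [sq_nonneg (2 * a + b)]
    have h2 : m % 2 = 0 → m ≤ 2 := fun h ↦ by
      have := hbound (q := 2) 0 (by norm_num) (by lia) (by decide +kernel)
      lia
    have h3 : m % 3 = 0 ∨ m % 3 = 1 → m ≤ 3 := fun h ↦ by
      have := hbound (q := 3) (if m % 3 = 0 then 0 else 2) (by norm_num)
        (by split_ifs <;> lia) (by decide +kernel)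
      lia
    have h5 : m % 5 = 0 ∨ m % 5 = 3 ∨ m % 5 = 4 → m ≤ 5 := fun h ↦ by
      have := hbound (q := 5) (if m % 5 = 0 then 0 else if m % 5 = 3 then 2 else 3) (by norm_num)
        (by split_ifs <;> lia) (by decide +kernel)
      lia
    have h47 : m % 6 = 5 → m < 47 := fun h ↦
      PeriodPair.IsClassOne.lt_of_mod_six ⟨by simpa using hτsq, hmul⟩ h hm0
    lia
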